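/- There exists a locally compact, Hausdorff, étale, second countable, principal, ample groupoid G with H_n(G) = 0 for all n ≥ 2 such that the canonical map μ_0 : H_0(G) → K_0(C*_r(G)) is not surjective. -/

import Mathlib

noncomputable section

open Function Set

attribute [local instance] Classical.propDecidable

universe u v w

/-- `ℤ[Y]`: the set of compactly supported continuous `ℤ`-valued functions on a space `Y`
(`ℤ` carries the discrete topology). -/
def ccZ (Y : Type v) [TopologicalSpace Y] : Set (Y → ℤ) :=
  {f | Continuous f ∧ HasCompactSupport f}

/-- `ℤ[Y]` as an additive subgroup of the group of all functions `Y → ℤ`. -/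
def ccZSub (Y : Type v) [TopologicalSpace Y] : AddSubgroup (Y → ℤ) where
  carrier := ccZ Y
  add_mem' {a b} ha hb := ⟨ha.1.add hb.1, ha.2.add hb.2⟩
  zero_mem' := ⟨continuous_const, by
    have h : tsupport (0 : Y → ℤ) = ∅ := by simp [tsupport]
    unfold HasCompactSupport
    rw [h]; exact isCompact_empty⟩
  neg_mem' {a} ha := ⟨ha.1.neg, HasCompactSupport.neg ha.2⟩

@[simp] lemma mem_ccZSub {Y : Type v} [TopologicalSpace Y] (f : Y → ℤ) :
    f ∈ ccZSub Y ↔ f ∈ ccZ Y := Iff.rfl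

/-- The pushforward `φ_*(a)(y) = ∑_{x ∈ φ⁻¹(y)} a x` of a function along a map. -/
def pushf {X : Type v} {Y : Type w} (φ : X → Y) (a : X → ℤ) : Y → ℤ :=
  fun y => ∑ᶠ x ∈ φ ⁻¹' {y}, a x

/-- The generated equivalence relation. -/
inductive RelGen {α : Sort*} (r : α → α → Prop) : α → α → Prop
  | rel {x y} : r x y → RelGen r x y
  | refl (x) : RelGen r x x
  | symm {x y} : RelGen r x y → RelGen r y x
  | trans {x y z} : RelGen r x y → RelGen r y z → RelGen r x z

/-- The purely algebraic data of a topological groupoid, with arrow space `G`: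
the set of units, source and range maps (valued in units), a (junk-total)
partially defined composition, and inversion. -/
structure GroupoidData (G : Type u) where
  unitSpace : Set G
  source : G → G
  range : G → G
  mul : G → G → G
  inv : G → G

namespace GroupoidData

variable {G : Type u} (D : GroupoidData G)

/-- The product of two subsets of a groupoid. -/
def setMul (A B : Set G) : Set G :=
  {w | ∃ a ∈ A, ∃ b ∈ B, D.source a = D.range b ∧ w = D.mul a b}

/-- A bisection: a subset on which both the source and the range map are injective. -/
def IsBisection (B : Set G) : Prop := Set.InjOn D.source B ∧ Set.InjOn D.range B

/-- Membership in the subgroupoid generated by a subset `A` of `G`. -/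
inductive InSubgroupoid (A : Set G) : G → Prop
  | base {g} : g ∈ A → InSubgroupoid A g
  | inv {g} : InSubgroupoid A g → InSubgroupoid A (D.inv g)
  | mul {g h} : InSubgroupoid A g → InSubgroupoid A h → D.source g = D.range h →
      InSubgroupoid A (D.mul g h)

/-- `G` is a (locally compact, Hausdorff, étale) ample groupoid: all the algebraic groupoid
axioms hold, the structure maps are suitably continuous, the source and range maps are local
homeomorphisms onto the open unit space (étaleness), and the compact open bisections form a
basis for the topology (ampleness). -/
structure IsAmpleGroupoid [TopologicalSpace G] : Prop where
  t2 : T2Space G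
  locallyCompact : LocallyCompactSpace G
  source_mem : ∀ g, D.source g ∈ D.unitSpace
  range_mem : ∀ g, D.range g ∈ D.unitSpace
  source_unit : ∀ x ∈ D.unitSpace, D.source x = x
  range_unit : ∀ x ∈ D.unitSpace, D.range x = x
  source_mul : ∀ g h, D.source g = D.range h → D.source (D.mul g h) = D.source h
  range_mul : ∀ g h, D.source g = D.range h → D.range (D.mul g h) = D.range g
  mul_assoc : ∀ g h k, D.source g = D.range h → D.source h = D.range k →
      D.mul (D.mul g h) k = D.mul g (D.mul h k)
  source_inv : ∀ g, D.source (D.inv g) = D.range g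
  range_inv : ∀ g, D.range (D.inv g) = D.source g
  inv_mul : ∀ g, D.mul (D.inv g) g = D.source g
  mul_inv : ∀ g, D.mul g (D.inv g) = D.range g
  unit_mul : ∀ g, D.mul (D.range g) g = g
  mul_unit : ∀ g, D.mul g (D.source g) = g
  continuous_inv : Continuous D.inv
  continuous_mul : Continuous fun p : {p : G × G // D.source p.1 = D.range p.2} =>
      D.mul p.1.1 p.1.2
  open_unitSpace : IsOpen D.unitSpace
  etale_source : IsLocalHomeomorph D.source
  etale_range : IsLocalHomeomorph D.range
  ample : ∀ g : G, ∀ U : Set G, IsOpen U → g ∈ U →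
      ∃ B : Set G, g ∈ B ∧ B ⊆ U ∧ IsOpen B ∧ IsCompact B ∧ D.IsBisection B

/-- A groupoid is principal if every arrow with equal range and source is a unit. -/
def IsPrincipal : Prop := ∀ g, D.source g = D.range g → g ∈ D.unitSpace

/-- `G` has dynamic asymptotic dimension at most `d`: for every relatively compact open
subset `K` of `G` there are `d+1` open subsets of the unit space covering `r(K) ∪ s(K)` such
that the subgroupoid generated by the elements of `K` with source and range in one of these
sets is relatively compact. -/
def DadLE [TopologicalSpace G] (d : ℕ) : Prop :=
  ∀ K : Set G, IsOpen K → IsCompact (closure K) →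
    ∃ U : Fin (d + 1) → Set G,
      (∀ i, IsOpen (U i) ∧ U i ⊆ D.unitSpace) ∧
      (D.range '' K ∪ D.source '' K ⊆ ⋃ i, U i) ∧
      ∀ i, IsCompact (closure
        {g | D.InSubgroupoid {g ∈ K | D.source g ∈ U i ∧ D.range g ∈ U i} g})

/-! ### Matui's complex computing the Crainic–Moerdijk groupoid homology `H_*(G)` -/

/-- The space `G^(n)` of composable `n`-tuples. -/
def Comps (n : ℕ) : Set (Fin n → G) :=
  {v | ∀ (j : Fin n) (h : (j : ℕ) + 1 < n), D.source (v j) = D.range (v ⟨(j : ℕ) + 1, h⟩)}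

/-- The face maps of Matui's complex on tuples:
`d_0` drops the first entry, `d_{n+1}` drops the last one, and the intermediate
`d_i` compose two consecutive entries. -/
def dface (n : ℕ) (i : Fin (n + 2)) (v : Fin (n + 1) → G) : Fin n → G := fun j =>
  if (j : ℕ) + 1 < (i : ℕ) then v j.castSucc
  else if (j : ℕ) + 1 = (i : ℕ) then D.mul (v j.castSucc) (v j.succ)
  else v j.succ

/-- The spaces of Matui's complex: `G^0` in degree `0`, and `G^(n)` in degree `n ≥ 1`. -/
def MSp : ℕ → Type u
  | 0 => ↥(D.unitSpace)
  | (n + 1) => ↥(D.Comps (n + 1))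

instance [TopologicalSpace G] (n : ℕ) : TopologicalSpace (D.MSp n) := by
  cases n with
  | zero => exact (inferInstance : TopologicalSpace ↥(D.unitSpace))
  | succ n => exact (inferInstance : TopologicalSpace ↥(D.Comps (n + 1)))

/-- The boundary maps of Matui's complex, given by alternating sums of pushforwards
along the face maps (in degree one, `∂₁ = s_* - r_*`). -/
def mBdry : (n : ℕ) → ((D.MSp (n + 1)) → ℤ) → (D.MSp n) → ℤ
  | 0, a => fun u =>
      (∑ᶠ x ∈ {x : ↥(D.Comps 1) | D.source (x.1 0) = u.1}, a x)
        - ∑ᶠ x ∈ {x : ↥(D.Comps 1) | D.range (x.1 0) = u.1}, a x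
  | (n + 1), a => fun y =>
      ∑ i : Fin (n + 3), (-1 : ℤ) ^ (i : ℕ) *
        ∑ᶠ x ∈ {x : ↥(D.Comps (n + 2)) | D.dface (n + 1) i x.1 = y.1}, a x

variable [TopologicalSpace G]

/-- The cycle subgroup of Matui's complex in degree `n`. -/
def mCycles : (n : ℕ) → AddSubgroup ((D.MSp n) → ℤ)
  | 0 => ccZSub (D.MSp 0)
  | (n + 1) => AddSubgroup.closure {a | a ∈ ccZ (D.MSp (n + 1)) ∧ D.mBdry n a = 0}

/-- The boundary subgroup of Matui's complex in degree `n`. -/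
def mBdries (n : ℕ) : AddSubgroup ((D.MSp n) → ℤ) :=
  AddSubgroup.closure {c | ∃ a ∈ ccZ (D.MSp (n + 1)), D.mBdry n a = c}

/-- The groupoid homology `H_n(G)` (Crainic–Moerdijk homology, computed by Matui's complex). -/
def Homology (n : ℕ) : Type u :=
  (D.mCycles n) ⧸ AddSubgroup.comap (D.mCycles n).subtype (D.mBdries n)

instance (n : ℕ) : AddCommGroup (D.Homology n) :=
  QuotientAddGroup.Quotient.addCommGroup _

/-- The homology class of a cycle. -/
def hcls {n : ℕ} (a : (D.MSp n) → ℤ) (ha : a ∈ D.mCycles n) : D.Homology n :=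
  QuotientAddGroup.mk ⟨a, ha⟩

end GroupoidData
/-! ### Operator K-theory via projections and unitaries over matrix algebras -/

section KTheory

/-- Block sum of square matrices. -/
def bSum {α : Type v} [Zero α] {m n : ℕ} (a : Matrix (Fin m) (Fin m) α)
    (b : Matrix (Fin n) (Fin n) α) : Matrix (Fin (m + n)) (Fin (m + n)) α :=
  Matrix.reindex finSumFinEquiv finSumFinEquiv (Matrix.fromBlocks a 0 0 b)

/-- Re-indexing a square matrix along an equality of sizes. -/
def castM {α : Type v} {a b : ℕ} (h : a = b) (M : Matrix (Fin a) (Fin a) α) :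
    Matrix (Fin b) (Fin b) α :=
  Matrix.reindex (finCongr h) (finCongr h) M

variable {B : Type u} [NonUnitalNormedRing B] [StarRing B] [NormedSpace ℂ B]
  [IsScalarTower ℂ B B] [SMulCommClass ℂ B B] [StarModule ℂ B]

/-- `p` is a projection matrix over the unitization `B⁺ = Unitization ℂ B`, with
`B`-components belonging to the subset `S ⊆ B` (take `S = univ` for the K-theory of `B`
itself; a closed subalgebra `S` computes the K-theory of `S`). -/
def IsProjM (S : Set B) {n : ℕ} (p : Matrix (Fin n) (Fin n) (Unitization ℂ B)) : Prop :=
  p * p = p ∧ star p = p ∧ ∀ i j, (p i j).snd ∈ S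

/-- `u` is a unitary matrix over the unitization `B⁺`, with `B`-components in `S`. -/
def IsUnitaryM (S : Set B) {n : ℕ} (u : Matrix (Fin n) (Fin n) (Unitization ℂ B)) : Prop :=
  u * star u = 1 ∧ star u * u = 1 ∧ ∀ i j, (u i j).snd ∈ S

/-- Continuity of a path of matrices over `B⁺` (componentwise). -/
def PathCont {n : ℕ} (P : ℝ → Matrix (Fin n) (Fin n) (Unitization ℂ B)) : Prop :=
  ∀ i j, Continuous (fun t => ((P t) i j).fst) ∧ Continuous (fun t => ((P t) i j).snd)

/-- Homotopy of projection matrices over `B⁺` through projections (with components in `S`). -/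
def ProjHtpy (S : Set B) {n : ℕ} (p q : Matrix (Fin n) (Fin n) (Unitization ℂ B)) : Prop :=
  ∃ P : ℝ → Matrix (Fin n) (Fin n) (Unitization ℂ B), PathCont P ∧ P 0 = p ∧ P 1 = q ∧
    ∀ t ∈ Set.Icc (0 : ℝ) 1, IsProjM S (P t)

/-- Homotopy of unitary matrices over `B⁺` through unitaries (with components in `S`). -/
def UnitaryHtpy (S : Set B) {n : ℕ} (u v : Matrix (Fin n) (Fin n) (Unitization ℂ B)) : Prop :=
  ∃ P : ℝ → Matrix (Fin n) (Fin n) (Unitization ℂ B), PathCont P ∧ P 0 = u ∧ P 1 = v ∧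
    ∀ t ∈ Set.Icc (0 : ℝ) 1, IsUnitaryM S (P t)

variable (B) in
/-- Representatives of `K₀`-classes: pairs of matrices over `B⁺` of a common size. -/
def K0Cycle : Type u :=
  Σ n : ℕ, Matrix (Fin n) (Fin n) (Unitization ℂ B) × Matrix (Fin n) (Fin n) (Unitization ℂ B)

/-- A pair `(p, q)` represents a `K₀`-class if `p` and `q` are projections over `B⁺` whose
scalar parts agree (so that `[p] - [q]` is a `K₀(B)`-class). -/
def IsK0Cycle (S : Set B) (x : K0Cycle B) : Prop :=
  IsProjM S x.2.1 ∧ IsProjM S x.2.2 ∧ ∀ i j, (x.2.1 i j).fst = (x.2.2 i j).fst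

/-- Block sum of `K₀`-representatives (inducing the group operation on `K₀`). -/
def k0blk (x y : K0Cycle B) : K0Cycle B := ⟨x.1 + y.1, bSum x.2.1 y.2.1, bSum x.2.2 y.2.2⟩

/-- The relation generating equality in `K₀(B)`: `[p, q] = [p', q']` when
`p ⊕ q' ⊕ r` is homotopic through projections to `p' ⊕ q ⊕ r` for some projection `r`. -/
def K0Rel (S : Set B) (x y : K0Cycle B) : Prop :=
  IsK0Cycle S x ∧ IsK0Cycle S y ∧
    ∃ (k : ℕ) (r : Matrix (Fin k) (Fin k) (Unitization ℂ B)), IsProjM S r ∧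
      ProjHtpy S (bSum (bSum x.2.1 y.2.2) r)
        (castM (by omega) (bSum (bSum y.2.1 x.2.2) r))

/-- Equality of `K₀`-classes. -/
def K0Eq (S : Set B) : K0Cycle B → K0Cycle B → Prop := RelGen (K0Rel S)

variable (B) in
/-- Representatives of `K₁`-classes: matrices over `B⁺`. -/
def K1Cycle : Type u := Σ n : ℕ, Matrix (Fin n) (Fin n) (Unitization ℂ B)

/-- Block sum of `K₁`-representatives (inducing the group operation on `K₁`). -/
def k1blk (x y : K1Cycle B) : K1Cycle B := ⟨x.1 + y.1, bSum x.2 y.2⟩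

/-- The relation generating equality in `K₁(B)`: two unitaries are identified when they are
homotopic through unitaries after stabilisation by identity blocks. -/
def K1Rel (S : Set B) (x y : K1Cycle B) : Prop :=
  IsUnitaryM S x.2 ∧ IsUnitaryM S y.2 ∧
    ∃ (a b : ℕ) (h : x.1 + a = y.1 + b),
      UnitaryHtpy S (castM h (bSum x.2 (1 : Matrix (Fin a) (Fin a) (Unitization ℂ B))))
        (bSum y.2 (1 : Matrix (Fin b) (Fin b) (Unitization ℂ B)))

/-- Equality of `K₁`-classes. -/
def K1Eq (S : Set B) : K1Cycle B → K1Cycle B → Prop := RelGen (K1Rel S)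

end KTheory

section KIso

variable {B : Type u} [NonUnitalNormedRing B] [StarRing B] [NormedSpace ℂ B]
  [IsScalarTower ℂ B B] [SMulCommClass ℂ B B] [StarModule ℂ B]

/-- The group `K₀` (of the closed subalgebra `S ⊆ B`) is isomorphic to the abelian group
`A`: there is a map on `K₀`-cycles which is constant on classes, additive for block sums,
and induces a bijection onto `A`. -/
def K0IsoTo (S : Set B) (A : Type v) [AddCommGroup A] : Prop :=
  ∃ T : K0Cycle B → A,
    (∀ x y, K0Rel S x y → T x = T y) ∧
    (∀ x y, IsK0Cycle S x → IsK0Cycle S y → T (k0blk x y) = T x + T y) ∧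
    (∀ z : A, ∃ x, IsK0Cycle S x ∧ T x = z) ∧
    (∀ x y, IsK0Cycle S x → IsK0Cycle S y → T x = T y → K0Eq S x y)

/-- The group `K₁` (of the closed subalgebra `S ⊆ B`) is isomorphic to the abelian group
`A`. -/
def K1IsoTo (S : Set B) (A : Type v) [AddCommGroup A] : Prop :=
  ∃ T : K1Cycle B → A,
    (∀ x y, K1Rel S x y → T x = T y) ∧
    (∀ x y, IsUnitaryM S x.2 → IsUnitaryM S y.2 → T (k1blk x y) = T x + T y) ∧
    (∀ z : A, ∃ x, IsUnitaryM S x.2 ∧ T x = z) ∧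
    (∀ x y, IsUnitaryM S x.2 → IsUnitaryM S y.2 → T x = T y → K1Eq S x y)

end KIso
/-! ### The reduced groupoid C*-algebra -/

/-- `C_c(Y, ℂ)`: compactly supported continuous complex-valued functions. -/
def ccC (Y : Type v) [TopologicalSpace Y] : Set (Y → ℂ) :=
  {f | Continuous f ∧ HasCompactSupport f}

/-- The indicator function of a set, with values in `ℂ`. -/
def indC {Y : Type v} (V : Set Y) : Y → ℂ := fun y => if y ∈ V then 1 else 0

/-- The indicator function of a set, with values in `ℤ`. -/
def indZ {Y : Type v} (V : Set Y) : Y → ℤ := fun y => if y ∈ V then 1 else 0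

namespace GroupoidData

variable {G : Type u} (D : GroupoidData G)

/-- The convolution product on `C_c(G, ℂ)`. -/
def convC (f f' : G → ℂ) : G → ℂ := fun g =>
  ∑ᶠ h : G, if D.range h = D.range g then f h * f' (D.mul (D.inv h) g) else 0

/-- The star operation `f*(g) = conj (f(g⁻¹))` on `C_c(G, ℂ)`. -/
def starC (f : G → ℂ) : G → ℂ := fun g => starRingEnd ℂ (f (D.inv g))

/-- The `ℓ²`-norm of a (finitely supported) function. -/
def l2norm {Y : Type v} (ξ : Y → ℂ) : ℝ := Real.sqrt (∑ᶠ y, ‖ξ y‖ ^ 2)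

/-- The norm of the regular representation `π_x(f)` of `f ∈ C_c(G)` on `ℓ²(G_x)`. -/
def opNormAt (x : G) (f : G → ℂ) : ℝ :=
  sSup {c | ∃ ξ : G → ℂ, (Function.support ξ).Finite ∧ (∀ g, ξ g ≠ 0 → D.source g = x) ∧
    l2norm ξ ≤ 1 ∧ c = l2norm (D.convC f ξ)}

/-- The reduced norm `‖f‖_r = sup_{x ∈ G⁰} ‖π_x(f)‖` on `C_c(G, ℂ)`. -/
def redNorm (f : G → ℂ) : ℝ := sSup {c | ∃ x ∈ D.unitSpace, c = D.opNormAt x f}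

variable [TopologicalSpace G]

/-- A realization of the reduced groupoid C*-algebra `C*_r(G)`: a C*-algebra `B` together
with an injective-by-isometry map `j` defined on `C_c(G, ℂ)` that is linear, multiplicative
for convolution, star-preserving, isometric for the reduced norm, and has dense range. -/
structure RedCStarRep (B : Type v) [NonUnitalNormedRing B] [StarRing B]
    [NormedSpace ℂ B] where
  j : (G → ℂ) → B
  j_add : ∀ f ∈ ccC G, ∀ f' ∈ ccC G, j (f + f') = j f + j f'
  j_smul : ∀ (c : ℂ), ∀ f ∈ ccC G, j (c • f) = c • j f
  j_mul : ∀ f ∈ ccC G, ∀ f' ∈ ccC G, j (D.convC f f') = j f * j f'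
  j_star : ∀ f ∈ ccC G, j (D.starC f) = star (j f)
  j_norm : ∀ f ∈ ccC G, ‖j f‖ = D.redNorm f
  j_dense : closure (j '' (ccC G)) = Set.univ

end GroupoidData
/-! ### The relative group `V_∞(C_0(G⁰), C*_r(G))/≈` and the homomorphism `ρ̃` -/

namespace GroupoidData

variable {G : Type u} [TopologicalSpace G] (D : GroupoidData G)

/-- The space `G^(2)` of composable pairs. -/
def compPairs : Set (G × G) := {p | D.source p.1 = D.range p.2}

/-- The boundary `∂₂ : ℤ[G^(2)] → ℤ[G]`, the alternating sum of the pushforwards along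
`(g₁, g₂) ↦ g₂`, `(g₁, g₂) ↦ g₁g₂` and `(g₁, g₂) ↦ g₁`. -/
def bdry2 (b : ↥(D.compPairs) → ℤ) : G → ℤ :=
  pushf (fun p : ↥(D.compPairs) => p.1.2) b
    - pushf (fun p : ↥(D.compPairs) => D.mul p.1.1 p.1.2) b
    + pushf (fun p : ↥(D.compPairs) => p.1.1) b

variable {B : Type v} [NonUnitalNormedRing B] [StarRing B] [NormedSpace ℂ B]
  (ρ : D.RedCStarRep B)

/-- An element of `B = C*_r(G)` lying in the canonical image of `C_0(G⁰)`. -/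
def unitAlgElem (b : B) : Prop :=
  ∃ f, f ∈ ccC G ∧ (∀ g, f g ≠ 0 → g ∈ D.unitSpace) ∧ b = ρ.j f

variable (B) in
/-- Representatives of classes in `V_∞(C_0(G⁰), C*_r(G))`: triples of matrices over `B`. -/
def VCycle : Type v :=
  Σ n : ℕ, Matrix (Fin n) (Fin n) B × Matrix (Fin n) (Fin n) B × Matrix (Fin n) (Fin n) B

/-- `(p, v, q)` is a triple in `V_∞(C_0(G⁰), C*_r(G))`: `p` and `q` are projection matrices
over (the image of) `C_0(G⁰)` and `v` is a partial isometry matrix over `C*_r(G)` with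
`vv* = p` and `v*v = q`. -/
def IsVTriple (x : VCycle B) : Prop :=
  (∀ i j, D.unitAlgElem ρ (x.2.1 i j)) ∧ (∀ i j, D.unitAlgElem ρ (x.2.2.2 i j)) ∧
    x.2.1 * x.2.1 = x.2.1 ∧ star x.2.1 = x.2.1 ∧
    x.2.2.2 * x.2.2.2 = x.2.2.2 ∧ star x.2.2.2 = x.2.2.2 ∧
    x.2.2.1 * star x.2.2.1 = x.2.1 ∧ star x.2.2.1 * x.2.2.1 = x.2.2.2

/-- Block sum of triples. -/
def vblk (x y : VCycle B) : VCycle B :=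
  ⟨x.1 + y.1, bSum x.2.1 y.2.1, bSum x.2.2.1 y.2.2.1, bSum x.2.2.2 y.2.2.2⟩

/-- Cast of a triple along an equality of sizes. -/
def vcast {a b : ℕ} (h : a = b)
    (x : Matrix (Fin a) (Fin a) B × Matrix (Fin a) (Fin a) B × Matrix (Fin a) (Fin a) B) :
    Matrix (Fin b) (Fin b) B × Matrix (Fin b) (Fin b) B × Matrix (Fin b) (Fin b) B :=
  (castM h x.1, castM h x.2.1, castM h x.2.2)

/-- Homotopy of triples within `V_∞(C_0(G⁰), C*_r(G))`. -/
def TripleHtpy {n : ℕ}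
    (x y : Matrix (Fin n) (Fin n) B × Matrix (Fin n) (Fin n) B × Matrix (Fin n) (Fin n) B) :
    Prop :=
  ∃ P : ℝ →
      Matrix (Fin n) (Fin n) B × Matrix (Fin n) (Fin n) B × Matrix (Fin n) (Fin n) B,
    (∀ i j, Continuous (fun t => (P t).1 i j) ∧ Continuous (fun t => (P t).2.1 i j) ∧
      Continuous (fun t => (P t).2.2 i j)) ∧
    P 0 = x ∧ P 1 = y ∧ ∀ t ∈ Set.Icc (0 : ℝ) 1, D.IsVTriple ρ ⟨n, P t⟩

/-- The relation `≈` on triples: `(p, v, q) ≈ (p', v', q')` when, after adding degenerate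
triples `(r, r, r)` and `(r', r', r')`, the two become homotopic within `V_∞`. -/
def VRel (x y : VCycle B) : Prop :=
  D.IsVTriple ρ x ∧ D.IsVTriple ρ y ∧
    ∃ (a a' : ℕ) (r : Matrix (Fin a) (Fin a) B) (r' : Matrix (Fin a') (Fin a') B),
      D.IsVTriple ρ ⟨a, r, r, r⟩ ∧ D.IsVTriple ρ ⟨a', r', r', r'⟩ ∧
      ∃ h : x.1 + a = y.1 + a',
        D.TripleHtpy ρ (vcast h (vblk x ⟨a, r, r, r⟩).2)
          (vblk y ⟨a', r', r', r'⟩).2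

/-- Equality of classes in `V_∞(C_0(G⁰), C*_r(G))/≈`. -/
def VEq : VCycle B → VCycle B → Prop := RelGen (D.VRel ρ)

/-- The triple `(1_{r(W)}, 1_W^*, 1_{s(W)})` associated with a compact open bisection. -/
def bisTriple (W : Set G) : VCycle B :=
  ⟨1, Matrix.of fun _ _ => ρ.j (indC (D.range '' W)),
    Matrix.of fun _ _ => star (ρ.j (indC W)),
    Matrix.of fun _ _ => ρ.j (indC (D.source '' W))⟩

/-- The reversed triple `(1_{s(W)}, 1_W, 1_{r(W)})` associated with a compact open
bisection. -/
def bisTripleInv (W : Set G) : VCycle B :=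
  ⟨1, Matrix.of fun _ _ => ρ.j (indC (D.source '' W)),
    Matrix.of fun _ _ => ρ.j (indC W),
    Matrix.of fun _ _ => ρ.j (indC (D.range '' W))⟩

/-- The defining properties of the homomorphism
`ρ̃ : ℤ[G] → V_∞(C_0(G⁰), C*_r(G))/≈` of Lemma `Lemma:ConstructionH1`:
it takes values in honest triples, it is additive, it is determined on (negatives of)
indicators of compact open bisections by `ρ̃(1_W) = [1_{r(W)}, 1_W^*, 1_{s(W)}]` and
`ρ̃(-1_W) = [1_{s(W)}, 1_W, 1_{r(W)}]`, and it vanishes on the image of `∂₂` (hence factors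
through `H₁(G, G⁰) ≅ ℤ[G]/im ∂₂`). -/
def IsRhoTilde (ρt : (G → ℤ) → VCycle B) : Prop :=
  (∀ f ∈ ccZ G, D.IsVTriple ρ (ρt f)) ∧
  (∀ f ∈ ccZ G, ∀ f' ∈ ccZ G, D.VEq ρ (ρt (f + f')) (vblk (ρt f) (ρt f'))) ∧
  (∀ W : Set G, IsCompact W → IsOpen W → D.IsBisection W →
    D.VEq ρ (ρt (indZ W)) (D.bisTriple ρ W) ∧
    D.VEq ρ (ρt (-indZ W)) (D.bisTripleInv ρ W)) ∧
  (∀ b : ↥(D.compPairs) → ℤ, b ∈ ccZ ↥(D.compPairs) → ∀ f ∈ ccZ G,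
    D.VEq ρ (ρt (f + D.bdry2 b)) (ρt f))

end GroupoidData
/-! ### The canonical comparison maps `μ₀` and `μ₁` -/

namespace GroupoidData

variable {G : Type u} [TopologicalSpace G] (D : GroupoidData G)
  {B : Type v} [NonUnitalNormedRing B] [StarRing B] [NormedSpace ℂ B]
  [IsScalarTower ℂ B B] [SMulCommClass ℂ B B] [StarModule ℂ B]
  (ρ : D.RedCStarRep B)

/-- A `1`-chain of Matui's complex viewed as a function on `G`. -/
def toFun1 (a : D.MSp 1 → ℤ) : G → ℤ :=
  fun g => a ⟨fun _ => g, fun j h => absurd (Nat.lt_of_succ_lt_succ h) (Nat.not_lt_zero _)⟩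

/-- The defining properties of the canonical comparison map
`μ₀ : H₀(G) → K₀(C*_r(G))` (given here at the level of `K₀`-cycles): it is additive, and it
sends the class of the indicator function of a compact open subset `V ⊆ G⁰` to the class of
the projection `ι(1_V) ∈ C*_r(G)`. -/
def IsMu0 (μ0 : D.Homology 0 → K0Cycle B) : Prop :=
  (∀ x, IsK0Cycle Set.univ (μ0 x)) ∧
  (∀ x y, K0Eq Set.univ (μ0 (x + y)) (k0blk (μ0 x) (μ0 y))) ∧
  (∀ V : Set G, IsCompact V → IsOpen V → V ⊆ D.unitSpace →
    ∀ hV : (fun u : D.MSp 0 => indZ V u.1) ∈ D.mCycles 0,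
      K0Eq Set.univ (μ0 (D.hcls (fun u : D.MSp 0 => indZ V u.1) hV))
        ⟨1, Matrix.of fun _ _ => (Unitization.inr (ρ.j (indC V)) : Unitization ℂ B), 0⟩)

/-- The defining properties of the canonical comparison map
`μ₁ : H₁(G) → K₁(C*_r(G))` (given at the level of `K₁`-cycles): it is additive, and its
composition with the canonical injection `K₁(C*_r(G)) → V_∞(C_0(G⁰), C*_r(G))/≈`,
`[u]₁ ↦ [p, u, p]` for `u` a unitary matrix in a corner `p M_n(C*_r(G)) p` with `p` a
projection matrix over `C_0(G⁰)`, agrees with the homomorphism `ρ̃` (of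
`GroupoidData.IsRhoTilde`) on cycles representing classes of `H₁(G) ⊆ H₁(G, G⁰)`. -/
def IsMu1 (μ1 : D.Homology 1 → K1Cycle B) : Prop :=
  (∀ x, IsUnitaryM Set.univ (μ1 x).2) ∧
  (∀ x y, K1Eq Set.univ (μ1 (x + y)) (k1blk (μ1 x) (μ1 y))) ∧
  (∀ ρt : (G → ℤ) → VCycle B, D.IsRhoTilde ρ ρt →
    ∀ (a : D.MSp 1 → ℤ) (ha : a ∈ D.mCycles 1),
      ∃ (n : ℕ) (p : Matrix (Fin n) (Fin n) (G → ℂ))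
        (_ : ∀ i j, p i j ∈ ccC G ∧ ∀ g, (p i j) g ≠ 0 → g ∈ D.unitSpace)
        (u : Matrix (Fin n) (Fin n) B),
        (u * star u = Matrix.of (fun i j => ρ.j (p i j)) ∧
          star u * u = Matrix.of (fun i j => ρ.j (p i j)) ∧
          Matrix.of (fun i j => ρ.j (p i j)) * u = u ∧
          u * Matrix.of (fun i j => ρ.j (p i j)) = u) ∧
        K1Eq Set.univ (μ1 (D.hcls a ha))
          ⟨n, Matrix.of fun i j =>
            (Unitization.inr (u i j) : Unitization ℂ B) +
              ((1 : Matrix (Fin n) (Fin n) (Unitization ℂ B)) i j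
                - Unitization.inr (ρ.j (p i j)))⟩ ∧
        D.VEq ρ (ρt (D.toFun1 a))
          ⟨n, Matrix.of (fun i j => ρ.j (p i j)), u, Matrix.of fun i j => ρ.j (p i j)⟩)

end GroupoidData
namespace GroupoidData

variable {G : Type} [TopologicalSpace G]

/-- The groupoid `G` is a counterexample to the surjectivity of the canonical map
`μ₀ : H₀(G) → K₀(C*_r(G))`: it is ample, second countable and principal, its homology
vanishes in all degrees `n ≥ 2`, and for every realisation of `C*_r(G)` the canonical map
`μ₀` (which exists) is not surjective. -/
def Mu0NotSurjBody (D : GroupoidData G) : Prop :=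
  D.IsAmpleGroupoid ∧ SecondCountableTopology G ∧ D.IsPrincipal ∧
  (∀ n : ℕ, 2 ≤ n → ∀ x : D.Homology n, x = 0) ∧
  ∀ (B : Type) (_ : NonUnitalNormedRing B) (_ : StarRing B) (_ : CStarRing B)
    (_ : NormedSpace ℂ B) (_ : IsScalarTower ℂ B B) (_ : SMulCommClass ℂ B B)
    (_ : StarModule ℂ B) (_ : CompleteSpace B) (ρ : D.RedCStarRep B),
    (∃ μ0 : D.Homology 0 → K0Cycle B, D.IsMu0 ρ μ0) ∧
    ∀ μ0 : D.Homology 0 → K0Cycle B, D.IsMu0 ρ μ0 →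
      ¬ (∀ c : K0Cycle B, IsK0Cycle Set.univ c → ∃ x, K0Eq Set.univ c (μ0 x))

end GroupoidData

set_option linter.unusedSectionVars false

open Polynomial in
/-- Column vectors. -/
abbrev PVec (F : Type) [Field F] := Polynomial F × Polynomial F

section Counting
open Polynomial
variable {F : Type} [Field F]

def vD (v : PVec F) : ℕ := max v.1.natDegree v.2.natDegree

def vstep (c : F × F) (v : PVec F) : PVec F :=
  (v.1 - C c.1 * v.2, v.2 - C c.2 * X * (v.1 - C c.1 * v.2))

lemma le_vD_of_coeff1 (v : PVec F) (d : ℕ) (h : v.1.coeff d ≠ 0) : d ≤ vD v :=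
  le_max_of_le_left (le_natDegree_of_ne_zero h)
lemma le_vD_of_coeff2 (v : PVec F) (d : ℕ) (h : v.2.coeff d ≠ 0) : d ≤ vD v :=
  le_max_of_le_right (le_natDegree_of_ne_zero h)

lemma coeff_vstep1 (c : F × F) (v : PVec F) (d : ℕ) :
    (vstep c v).1.coeff d = v.1.coeff d - c.1 * v.2.coeff d := by
  simp [vstep]
lemma coeff_vstep2_succ (c : F × F) (v : PVec F) (d : ℕ) :
    (vstep c v).2.coeff (d+1) = v.2.coeff (d+1) - c.2 * (vstep c v).1.coeff d := by
  simp only [vstep, coeff_sub, mul_assoc, coeff_C_mul, coeff_X_mul]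
lemma coeff_vstep2_zero (c : F × F) (v : PVec F) :
    (vstep c v).2.coeff 0 = v.2.coeff 0 := by
  simp [vstep, mul_assoc]

lemma vstep_ne (c : F × F) (v : PVec F) (hv : v ≠ 0) : vstep c v ≠ 0 := by
  intro h
  have h1 : (vstep c v).1 = 0 := by rw [h]; rfl
  have h2 : (vstep c v).2 = 0 := by rw [h]; rfl
  simp only [vstep] at h1 h2
  rw [h1, mul_zero, sub_zero] at h2
  rw [h2, mul_zero, sub_zero] at h1
  exact hv (Prod.ext h1 h2)


lemma coeff_vD_ne (v : PVec F) (hv : v ≠ 0) :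
    v.1.coeff (vD v) ≠ 0 ∨ v.2.coeff (vD v) ≠ 0 := by
  by_contra! h
  obtain ⟨h1, h2⟩ := h
  rcases le_total v.1.natDegree v.2.natDegree with h | h
  · have e : vD v = v.2.natDegree := max_eq_right h
    rw [e] at h1 h2
    have h3 : v.2 = 0 := by simpa using h2
    rw [h3] at h h1
    have h4 : v.1.natDegree = 0 := by simpa using h
    have : v.1 = 0 := by rw [eq_C_of_natDegree_eq_zero h4]; simpa using h1
    exact hv (Prod.ext this h3)
  · have e : vD v = v.1.natDegree := max_eq_left h
    rw [e] at h1 h2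
    have h3 : v.1 = 0 := by simpa using h1
    rw [h3] at h h2
    have h4 : v.2.natDegree = 0 := by simpa using h
    have : v.2 = 0 := by rw [eq_C_of_natDegree_eq_zero h4]; simpa using h2
    exact hv (Prod.ext h3 this)

/-- The key degree recursion. -/
lemma vstep_bound (v : PVec F) (hv : v ≠ 0) : ∃ α β : F, ∀ c : F × F,
    vD v ≤ vD (vstep c v) + 1 ∧ (vD (vstep c v) < vD v → c = (α, β)) ∧
    (vD (vstep c v) ≤ vD v → c.1 = α ∨ c.2 = 0) := by
  set D := vD v with hD
  have big : ∀ c : F × F, (vstep c v).1.coeff D ≠ 0 → D ≤ vD (vstep c v) ∧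
      (vD (vstep c v) ≤ D → c.2 = 0) := by
    intro c hc
    refine ⟨le_vD_of_coeff1 _ _ hc, fun h => ?_⟩
    by_contra h2
    have : (vstep c v).2.coeff (D+1) ≠ 0 := by
      rw [coeff_vstep2_succ]
      have : v.2.coeff (D+1) = 0 := by
        apply coeff_eq_zero_of_natDegree_lt
        have : v.2.natDegree ≤ D := le_max_right _ _
        omega
      rw [this, zero_sub]
      exact neg_ne_zero.mpr (mul_ne_zero h2 hc)
    have := le_vD_of_coeff2 _ _ this
    omega
  by_cases hy : v.2.coeff D = 0
  · have hx : v.1.coeff D ≠ 0 := (coeff_vD_ne v hv).resolve_right (by simpa using hy)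
    refine ⟨0, 0, fun c => ?_⟩
    have h := big c (by rw [coeff_vstep1, hy]; simpa using hx)
    exact ⟨by omega, fun h' => by omega, fun h' => Or.inr (h.2 h')⟩
  · set α := v.1.coeff D / v.2.coeff D with hα
    have h1 : ∀ c : F × F, c.1 ≠ α → (vstep c v).1.coeff D ≠ 0 := by
      intro c hc h
      rw [coeff_vstep1, sub_eq_zero] at h
      exact hc (by rw [hα, h]; field_simp)
    rcases Nat.eq_zero_or_pos D with h0 | hpos
    · refine ⟨α, 0, fun c => ⟨by omega, fun h => by omega, fun h => ?_⟩⟩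
      by_cases hc : c.1 = α
      · exact Or.inl hc
      · exact Or.inr ((big c (h1 c hc)).2 h)
    · obtain ⟨d, hd⟩ : ∃ d, D = d + 1 := ⟨D - 1, by omega⟩
      set x := v.1.coeff d - α * v.2.coeff d with hx
      refine ⟨α, v.2.coeff D / x, fun c => ?_⟩
      by_cases hc : c.1 = α
      · have e1 : (vstep c v).1.coeff d = x := by rw [coeff_vstep1, hc]
        have e2 : (vstep c v).2.coeff D = v.2.coeff D - c.2 * x := by
          rw [hd, coeff_vstep2_succ, e1]
        by_cases h2 : (vstep c v).2.coeff D = 0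
        · have hx0 : x ≠ 0 := by
            intro h; rw [e2, h] at h2; simp at h2; exact hy h2
          have := le_vD_of_coeff1 (vstep c v) d (by rw [e1]; exact hx0)
          refine ⟨by omega, fun _ => Prod.ext hc ?_, fun _ => Or.inl hc⟩
          rw [e2, sub_eq_zero] at h2
          simp only
          rw [h2]; field_simp
        · have := le_vD_of_coeff2 _ _ h2
          exact ⟨by omega, fun _ => by omega, fun _ => Or.inl hc⟩
      · have h := big c (h1 c hc)
        exact ⟨by omega, fun h' => by omega, fun h' => Or.inr (h.2 h')⟩

variable [Fintype F]

lemma vstep_sum (v : PVec F) (hv : v ≠ 0) :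
    ∑ c : F × F, ((Fintype.card F : ℝ))⁻¹ ^ (vD (vstep c v)) ≤
      4 * Fintype.card F * ((Fintype.card F : ℝ))⁻¹ ^ (vD v) := by
  obtain ⟨α, β, h⟩ := vstep_bound v hv
  set q : ℝ := (Fintype.card F : ℝ) with hq
  have hq1 : 1 ≤ q := by
    have : 0 < Fintype.card F := Fintype.card_pos
    rw [hq]; exact_mod_cast this
  have hq0 : 0 < q := by linarith
  have hi : q⁻¹ ≤ 1 := inv_le_one_of_one_le₀ hq1
  set P := q⁻¹ ^ (vD v) with hP
  have hP0 : 0 < P := by positivity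
  have key : ∀ c : F × F, q⁻¹ ^ (vD (vstep c v)) ≤
      (if c = (α, β) then q * P else 0) + (if c.1 = α then P else 0) +
        (if c.2 = 0 then P else 0) + q⁻¹ * P := by
    intro c
    obtain ⟨ha, hb, hc⟩ := h c
    have n1 : 0 ≤ (if c = (α, β) then q * P else 0) := by split_ifs <;> positivity
    have n2 : 0 ≤ (if c.1 = α then P else 0) := by split_ifs <;> positivity
    have n3 : 0 ≤ (if c.2 = 0 then P else 0) := by split_ifs <;> positivity
    have n4 : 0 ≤ q⁻¹ * P := by positivity
    rcases lt_trichotomy (vD (vstep c v)) (vD v) with hl | hl | hl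
    · have e : vD v = vD (vstep c v) + 1 := by omega
      have : q * P = q⁻¹ ^ (vD (vstep c v)) := by
        rw [hP, e, pow_succ]; field_simp
      rw [if_pos (hb hl)] at *
      linarith
    · have : P = q⁻¹ ^ (vD (vstep c v)) := by rw [hP, hl]
      rcases hc hl.le with h' | h'
      · rw [if_pos h'] at *; linarith
      · rw [if_pos h'] at *; linarith
    · have : q⁻¹ ^ (vD (vstep c v)) ≤ q⁻¹ * P := by
        rw [hP, ← pow_succ']
        exact pow_le_pow_of_le_one (by positivity) hi hl
      linarith
  calc _ ≤ ∑ c : F × F, ((if c = (α, β) then q * P else 0) + (if c.1 = α then P else 0) +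
        (if c.2 = 0 then P else 0) + q⁻¹ * P) := Finset.sum_le_sum fun c _ => key c
    _ = q * P + q * P + q * P + (q * q) * (q⁻¹ * P) := by
      simp only [Finset.sum_add_distrib, Fintype.sum_prod_type]
      have s1 : ∑ x : F, ∑ _y : F, (if x = α then P else 0) = q * P := by
        rw [Finset.sum_comm]; simp [← hq]
      rw [s1]
      simp [Prod.ext_iff, ite_and, ← hq]
      ring
    _ = _ := by field_simp; ring

/-! Elementary matrices -/
def eeM {R : Type} [CommRing R] (r : R) : Matrix.SpecialLinearGroup (Fin 2) R :=
  ⟨!![1, r; 0, 1], by simp [Matrix.det_fin_two]⟩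
def ffM {R : Type} [CommRing R] (r : R) : Matrix.SpecialLinearGroup (Fin 2) R :=
  ⟨!![1, 0; r, 1], by simp [Matrix.det_fin_two]⟩

lemma eeM_val {R : Type} [CommRing R] (r : R) : (eeM r).1 = !![1, r; 0, 1] := rfl
lemma ffM_val {R : Type} [CommRing R] (r : R) : (ffM r).1 = !![1, 0; r, 1] := rfl
lemma slmul_val {R : Type} [CommRing R] (g h : Matrix.SpecialLinearGroup (Fin 2) R)
    (i j : Fin 2) : (g * h).1 i j = g.1 i 0 * h.1 0 j + g.1 i 1 * h.1 1 j := by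
  rw [Matrix.SpecialLinearGroup.coe_mul, Matrix.mul_apply, Fin.sum_univ_two]

lemma eeM_add {R : Type} [CommRing R] (r s : R) : eeM (r + s) = eeM r * eeM s := by
  ext i j; fin_cases i <;> fin_cases j <;>
    simp [eeM_val, slmul_val, add_comm]
lemma ffM_add {R : Type} [CommRing R] (r s : R) : ffM (r + s) = ffM r * ffM s := by
  ext i j; fin_cases i <;> fin_cases j <;>
    simp [ffM_val, slmul_val]
lemma eeM_zero {R : Type} [CommRing R] : eeM (0 : R) = 1 := by
  ext i j; fin_cases i <;> fin_cases j <;> simp [eeM]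
lemma ffM_zero {R : Type} [CommRing R] : ffM (0 : R) = 1 := by
  ext i j; fin_cases i <;> fin_cases j <;> simp [ffM]
lemma eeM_neg {R : Type} [CommRing R] (r : R) : eeM (-r) = (eeM r)⁻¹ :=
  eq_inv_of_mul_eq_one_left (by rw [← eeM_add]; simp [eeM_zero])
lemma ffM_neg {R : Type} [CommRing R] (r : R) : ffM (-r) = (ffM r)⁻¹ :=
  eq_inv_of_mul_eq_one_left (by rw [← ffM_add]; simp [ffM_zero])

/-- The group `SL₂(F[X])`. -/
abbrev SLX (F : Type) [Field F] := Matrix.SpecialLinearGroup (Fin 2) (Polynomial F)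

def gcol (g : SLX F) (j : Fin 2) : PVec F := (g.1 0 j, g.1 1 j)

lemma gcol_ne (g : SLX F) (j : Fin 2) : gcol g j ≠ 0 := by
  intro h
  have h1 : g.1 0 j = 0 := congrArg Prod.fst h
  have h2 : g.1 1 j = 0 := congrArg Prod.snd h
  have hd := g.2
  rw [Matrix.det_fin_two] at hd
  fin_cases j <;> simp_all

def Bc (c : F × F) : SLX F := eeM (C c.1) * ffM (C c.2 * X)

lemma gcol_Bc (c : F × F) (g : SLX F) (j : Fin 2) :
    gcol ((Bc c)⁻¹ * g) j = vstep c (gcol g j) := by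
  rw [Bc, mul_inv_rev, ← eeM_neg, ← ffM_neg]
  apply Prod.ext
  · simp [gcol, vstep, eeM_val, ffM_val, slmul_val]; ring
  · simp [gcol, vstep, eeM_val, ffM_val, slmul_val]; ring

def gD (g : SLX F) : ℕ := max (vD (gcol g 0)) (vD (gcol g 1))

lemma gD_entry (g : SLX F) (i j : Fin 2) : (g.1 i j).natDegree ≤ gD g := by
  fin_cases i <;> fin_cases j <;> simp [gD, vD, gcol]

lemma gD_le (g : SLX F) (d : ℕ) (h : ∀ i j, (g.1 i j).natDegree ≤ d) : gD g ≤ d := by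
  simp [gD, vD, gcol, h]

lemma gD_mul_ee (g : SLX F) (c : F) : gD (g * eeM (C c)) ≤ gD g := by
  apply gD_le
  have hm : ∀ i, (g.1 i 0 * C c + g.1 i 1).natDegree ≤ gD g := fun i =>
    natDegree_add_le_of_degree_le ((natDegree_mul_C_le _ _).trans (gD_entry g i 0))
      (gD_entry g i 1)
  intro i j
  fin_cases j
  · simpa [eeM_val, slmul_val] using gD_entry g i 0
  · simpa [eeM_val, slmul_val] using hm i

lemma gD_mul_ee_eq (g : SLX F) (c : F) : gD (g * eeM (C c)) = gD g := by
  refine le_antisymm (gD_mul_ee g c) ?_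
  have := gD_mul_ee (g * eeM (C c)) (-c)
  rwa [mul_assoc, ← eeM_add, ← C_add, add_neg_cancel, C_0, eeM_zero, mul_one] at this

lemma vD_vstep_le (c : F × F) (v : PVec F) : vD v ≤ vD (vstep c v) + 1 := by
  by_cases hv : v = 0
  · simp [hv, vD]
  · obtain ⟨α, β, h⟩ := vstep_bound v hv
    exact (h c).1

/-- Word generating elements of the group algebra. -/
def b1X : MonoidAlgebra ℂ (SLX F) := ∑ c : F, MonoidAlgebra.single (eeM (C c)) 1
def b2X : MonoidAlgebra ℂ (SLX F) := ∑ c : F, MonoidAlgebra.single (ffM (C c * X)) 1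

lemma b12X : (b1X * b2X : MonoidAlgebra ℂ (SLX F)) =
    ∑ c : F × F, MonoidAlgebra.single (Bc c) 1 := by
  rw [b1X, b2X, Finset.sum_mul_sum, Fintype.sum_prod_type]
  simp [Bc, MonoidAlgebra.single_mul_single]

lemma coeff_bk_succ (k : ℕ) (g : SLX F) : ((b1X * b2X : MonoidAlgebra ℂ (SLX F)) ^ (k+1)).coeff g
    = ∑ c : F × F, ((b1X * b2X : MonoidAlgebra ℂ (SLX F)) ^ k).coeff ((Bc c)⁻¹ * g) := by
  rw [pow_succ']
  conv_lhs => rw [b12X, Finset.sum_mul]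
  simp only [MonoidAlgebra.coeff_sum, Finsupp.coe_finsetSum, Finset.sum_apply,
    MonoidAlgebra.coeff_single_mul_apply, one_mul, b12X]

lemma bk_bound (k : ℕ) : ∀ (g : SLX F) (j : Fin 2),
    ‖((b1X * b2X : MonoidAlgebra ℂ (SLX F)) ^ k).coeff g‖ ≤
    (4 * Fintype.card F : ℝ) ^ k * ((Fintype.card F : ℝ))⁻¹ ^ (vD (gcol g j)) := by
  induction k with
  | zero =>
    intro g j
    by_cases h : g = 1
    · subst h
      have : vD (gcol (1 : SLX F) j) = 0 := by fin_cases j <;> simp [vD, gcol]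
      simp [this, MonoidAlgebra.one_def]
    · simp only [pow_zero, MonoidAlgebra.one_def, MonoidAlgebra.coeff_single]
      rw [Finsupp.single_eq_of_ne h]
      simp only [norm_zero]; positivity
  | succ k ih =>
    intro g j
    rw [coeff_bk_succ]
    calc _ ≤ ∑ c : F × F, ‖((b1X * b2X : MonoidAlgebra ℂ (SLX F)) ^ k).coeff ((Bc c)⁻¹ * g)‖ :=
          norm_sum_le _ _
      _ ≤ ∑ c : F × F, (4 * Fintype.card F : ℝ) ^ k *
          ((Fintype.card F : ℝ))⁻¹ ^ (vD (vstep c (gcol g j))) := by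
        refine Finset.sum_le_sum fun c _ => ?_
        rw [← gcol_Bc]; exact ih _ j
      _ = (4 * Fintype.card F : ℝ) ^ k * ∑ c : F × F,
          ((Fintype.card F : ℝ))⁻¹ ^ (vD (vstep c (gcol g j))) := by rw [Finset.mul_sum]
      _ ≤ (4 * Fintype.card F : ℝ) ^ k * (4 * Fintype.card F *
            ((Fintype.card F : ℝ))⁻¹ ^ (vD (gcol g j))) := by
        gcongr
        exact vstep_sum _ (gcol_ne g j)
      _ = _ := by ring

lemma bk_supp (k : ℕ) : ∀ (g : SLX F),
    ((b1X * b2X : MonoidAlgebra ℂ (SLX F)) ^ k).coeff g ≠ 0 → gD g ≤ k := by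
  induction k with
  | zero =>
    intro g hg
    by_cases h : g = 1
    · subst h; apply gD_le; intro i j; fin_cases i <;> fin_cases j <;> simp
    · exfalso; apply hg
      simp only [pow_zero, MonoidAlgebra.one_def, MonoidAlgebra.coeff_single]
      rw [Finsupp.single_eq_of_ne h]
  | succ k ih =>
    intro g hg
    rw [coeff_bk_succ] at hg
    obtain ⟨c, -, hc⟩ := Finset.exists_ne_zero_of_sum_ne_zero hg
    have := ih _ hc
    rw [gD, gcol_Bc, gcol_Bc] at this
    have h0 := vD_vstep_le c (gcol g 0)
    have h1 := vD_vstep_le c (gcol g 1)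
    rw [gD]
    omega

lemma bk1_coeff (k : ℕ) (g : SLX F) :
    ((b1X * b2X : MonoidAlgebra ℂ (SLX F)) ^ k * b1X).coeff g =
    ∑ c : F, ((b1X * b2X : MonoidAlgebra ℂ (SLX F)) ^ k).coeff (g * eeM (C (-c))) := by
  conv_lhs => rw [b1X, Finset.mul_sum]
  simp only [MonoidAlgebra.coeff_sum, Finsupp.coe_finsetSum, Finset.sum_apply,
    MonoidAlgebra.coeff_mul_single_apply, mul_one, b1X, C_neg, eeM_neg]

lemma bk1_bound (k : ℕ) (g : SLX F) :
    ‖((b1X * b2X : MonoidAlgebra ℂ (SLX F)) ^ k * b1X).coeff g‖ ≤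
    Fintype.card F * ((4 * Fintype.card F : ℝ) ^ k * ((Fintype.card F : ℝ))⁻¹ ^ (gD g)) := by
  rw [bk1_coeff]
  refine (norm_sum_le _ _).trans ?_
  rw [← nsmul_eq_mul, ← Finset.card_univ]
  refine Finset.sum_le_card_nsmul _ _ _ fun c _ => ?_
  rw [← gD_mul_ee_eq g (-c)]
  rcases max_choice (vD (gcol (g * eeM (C (-c))) 0)) (vD (gcol (g * eeM (C (-c))) 1)) with h | h
  · rw [gD, h]; exact bk_bound k _ 0
  · rw [gD, h]; exact bk_bound k _ 1

lemma bk1_supp (k : ℕ) (g : SLX F)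
    (h : ((b1X * b2X : MonoidAlgebra ℂ (SLX F)) ^ k * b1X).coeff g ≠ 0) : gD g ≤ k := by
  rw [bk1_coeff] at h
  obtain ⟨c, -, hc⟩ := Finset.exists_ne_zero_of_sum_ne_zero h
  rw [← gD_mul_ee_eq g (-c)]
  exact bk_supp k _ hc
end Counting

section Counting2
open Polynomial
variable {F : Type} [Field F] [Fintype F]

/-- Polynomials of degree at most `D` divisible by `X ^ m`. -/
def polD (F : Type) [Field F] (D m : ℕ) : Set (Polynomial F) :=
  {p | p.natDegree ≤ D ∧ X ^ m ∣ p}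

def polEnc (D m : ℕ) (p : Polynomial F) : Fin (D + 1 - m) → F := fun i => p.coeff (m + i)

lemma polEnc_inj (D m : ℕ) : InjOn (polEnc (F := F) D m) (polD F D m) := by
  intro p hp r hr h
  ext i
  by_cases h1 : i < m
  · rw [X_pow_dvd_iff.mp hp.2 i h1, X_pow_dvd_iff.mp hr.2 i h1]
  · by_cases h2 : i ≤ D
    · have := congrFun h ⟨i - m, by omega⟩
      simp only [polEnc] at this
      rwa [show m + (i - m) = i by omega] at this
    · rw [coeff_eq_zero_of_natDegree_lt (by have := hp.1; omega),
        coeff_eq_zero_of_natDegree_lt (by have := hr.1; omega)]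

lemma polD_finite (D m : ℕ) : (polD F D m).Finite :=
  Set.Finite.of_injOn (t := univ) (fun _ _ => mem_univ _) (polEnc_inj D m) finite_univ

lemma polD_card (D m : ℕ) : (polD F D m).ncard ≤ Fintype.card F ^ (D + 1 - m) := by
  have := Set.ncard_le_ncard_of_injOn (t := univ) (polEnc (F := F) D m) (fun _ _ => mem_univ _)
    (polEnc_inj D m) finite_univ
  simpa [Set.ncard_univ] using this

lemma divisors_bound (N : Polynomial F) : N ≠ 0 →
    {b | b ∣ N}.Finite ∧ {b | b ∣ N}.ncard ≤ Fintype.card F * 2 ^ N.natDegree := by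
  induction N using UniqueFactorizationMonoid.induction_on_prime with
  | h₁ => intro h; exact absurd rfl h
  | h₂ x hx =>
    intro _
    have hsub : {b | b ∣ x} ⊆ (fun c : F => C c) '' univ := by
      intro b hb
      have hb' : IsUnit b := isUnit_of_dvd_unit hb hx
      obtain ⟨c, _, rfl⟩ := Polynomial.isUnit_iff.mp hb'
      exact ⟨c, mem_univ _, rfl⟩
    have hf : ((fun c : F => C c) '' univ).Finite := finite_univ.image _
    refine ⟨hf.subset hsub, ?_⟩
    rw [natDegree_eq_zero_of_isUnit hx, pow_zero, mul_one]
    refine (Set.ncard_le_ncard hsub hf).trans ?_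
    refine (Set.ncard_image_le finite_univ).trans ?_
    simp [Set.ncard_univ]
  | h₃ a p ha hp ih =>
    intro _
    obtain ⟨hf, hc⟩ := ih ha
    have hsub : {b | b ∣ p * a} ⊆ {b | b ∣ a} ∪ (fun b => p * b) '' {b | b ∣ a} := by
      intro b hb
      by_cases hpb : p ∣ b
      · obtain ⟨b', rfl⟩ := hpb
        exact Or.inr ⟨b', (mul_dvd_mul_iff_left hp.ne_zero).mp hb, rfl⟩
      · left
        have : IsCoprime b p := ((hp.irreducible.coprime_iff_not_dvd).mpr hpb).symm
        exact this.dvd_of_dvd_mul_left hb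
    have hf2 := hf.union (hf.image (fun b => p * b))
    refine ⟨hf2.subset hsub, ?_⟩
    have hdeg : a.natDegree + 1 ≤ (p * a).natDegree := by
      rw [natDegree_mul hp.ne_zero ha]
      have := hp.irreducible.natDegree_pos
      omega
    calc _ ≤ _ := Set.ncard_le_ncard hsub hf2
      _ ≤ _ := Set.ncard_union_le _ _
      _ ≤ {b | b ∣ a}.ncard + {b | b ∣ a}.ncard := by
        exact Nat.add_le_add_left (Set.ncard_image_le hf) _
      _ ≤ Fintype.card F * 2 ^ (a.natDegree + 1) := by rw [pow_succ]; linarith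
      _ ≤ _ := by gcongr; norm_num

/-- Elements of the congruence subgroup of bounded degree. -/
def congD (F : Type) [Field F] (n D : ℕ) : Set (SLX F) :=
  {g | gD g ≤ D ∧ X ^ n ∣ g.1 0 0 - 1 ∧ X ^ n ∣ g.1 1 1 - 1 ∧ X ^ n ∣ g.1 0 1 ∧ X ^ n ∣ g.1 1 0}

lemma slx_ext {R : Type} [CommRing R] {g h : Matrix.SpecialLinearGroup (Fin 2) R}
    (h00 : g.1 0 0 = h.1 0 0) (h01 : g.1 0 1 = h.1 0 1)
    (h10 : g.1 1 0 = h.1 1 0) (h11 : g.1 1 1 = h.1 1 1) : g = h := by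
  ext i j; fin_cases i <;> fin_cases j <;> assumption

lemma sl_det {R : Type} [CommRing R] (g : Matrix.SpecialLinearGroup (Fin 2) R) :
    g.1 0 0 * g.1 1 1 - g.1 0 1 * g.1 1 0 = 1 := by
  have := g.2; rwa [Matrix.det_fin_two] at this

lemma congD_finite (n D : ℕ) : (congD F n D).Finite := by
  have hP := polD_finite (F := F) D 0
  refine Set.Finite.of_injOn (t := (polD F D 0) ×ˢ (polD F D 0) ×ˢ (polD F D 0) ×ˢ (polD F D 0))
    (f := fun g : SLX F => (g.1 0 0, g.1 0 1, g.1 1 0, g.1 1 1)) ?_ ?_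
    (hP.prod (hP.prod (hP.prod hP)))
  · intro g hg
    have : ∀ i j, g.1 i j ∈ polD F D 0 := fun i j =>
      ⟨(gD_entry g i j).trans hg.1, by simp⟩
    exact ⟨this _ _, this _ _, this _ _, this _ _⟩
  · intro g _ h _ e
    simp only [Prod.mk.injEq] at e
    exact slx_ext e.1 e.2.1 e.2.2.1 e.2.2.2

lemma congD_card0 (n D : ℕ) (hn : 1 ≤ n) :
    {g ∈ congD F n D | g.1 0 1 * g.1 1 0 = 0}.ncard ≤ 2 * Fintype.card F ^ (D + 1 - n) := by
  have key : ∀ g ∈ congD F n D, g.1 0 1 * g.1 1 0 = 0 → g.1 0 0 = 1 ∧ g.1 1 1 = 1 := by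
    intro g hg h0
    have hd := sl_det g
    rw [h0, sub_zero] at hd
    have hu : IsUnit (g.1 0 0) := IsUnit.of_mul_eq_one _ hd
    obtain ⟨c, _, hc⟩ := Polynomial.isUnit_iff.mp hu
    have h1 : g.1 0 0 = 1 := by
      have h2 := X_pow_dvd_iff.mp hg.2.1 0 (by omega)
      rw [← hc] at h2 ⊢
      simp only [coeff_sub, coeff_C_zero, coeff_one_zero, sub_eq_zero] at h2
      rw [h2, C_1]
    exact ⟨h1, by rwa [h1, one_mul] at hd⟩
  have hP := polD_finite (F := F) D n
  have hsub : {g ∈ congD F n D | g.1 0 1 * g.1 1 0 = 0} ⊆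
      (fun p => eeM p) '' (polD F D n) ∪ (fun p => ffM p) '' (polD F D n) := by
    rintro g ⟨hg, h0⟩
    obtain ⟨h1, h2⟩ := key g hg h0
    rcases mul_eq_zero.mp h0 with h | h
    · right
      refine ⟨g.1 1 0, ⟨(gD_entry g _ _).trans hg.1, hg.2.2.2.2⟩, ?_⟩
      apply slx_ext <;> simp [ffM_val, h1, h2, h]
    · left
      refine ⟨g.1 0 1, ⟨(gD_entry g _ _).trans hg.1, hg.2.2.2.1⟩, ?_⟩
      apply slx_ext <;> simp [eeM_val, h1, h2, h]
  have h1 := Set.ncard_le_ncard hsub ((hP.image _).union (hP.image _))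
  have h2 := Set.ncard_union_le ((fun p => eeM p) '' (polD F D n)) ((fun p => ffM p) '' (polD F D n))
  have h3 := Set.ncard_image_le (f := fun p => eeM p) hP
  have h4 := Set.ncard_image_le (f := fun p => ffM p) hP
  have h5 := polD_card (F := F) D n
  omega

lemma congD_card1 (n D : ℕ) :
    {g ∈ congD F n D | g.1 0 1 * g.1 1 0 ≠ 0}.ncard ≤
      Fintype.card F * 4 ^ D * (Fintype.card F ^ (D + 1 - n) * Fintype.card F ^ (D + 1 - 2 * n)) := by
  set S := {g ∈ congD F n D | g.1 0 1 * g.1 1 0 ≠ 0} with hS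
  have hSf : S.Finite := (congD_finite n D).subset fun g hg => hg.1
  have hP1 := polD_finite (F := F) D n
  have hP2 := polD_finite (F := F) D (2 * n)
  let f : SLX F → Polynomial F × Polynomial F := fun g => (g.1 0 0 - 1, g.1 0 0 + g.1 1 1 - 2)
  have himg : f '' S ⊆ polD F D n ×ˢ polD F D (2 * n) := by
    rintro _ ⟨g, ⟨hg, -⟩, rfl⟩
    have c2 : (2 : Polynomial F).natDegree ≤ D := by
      rw [show (2 : Polynomial F) = C 2 from (map_ofNat C 2).symm, natDegree_C]; exact Nat.zero_le _
    refine ⟨⟨?_, hg.2.1⟩, ?_, ?_⟩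
    · exact (natDegree_sub_le _ _).trans (max_le ((gD_entry g _ _).trans hg.1) (by simp))
    · exact (natDegree_sub_le _ _).trans (max_le (natDegree_add_le_of_degree_le
        ((gD_entry g _ _).trans hg.1) ((gD_entry g _ _).trans hg.1)) c2)
    · have : g.1 0 0 + g.1 1 1 - 2 = g.1 0 1 * g.1 1 0 - (g.1 0 0 - 1) * (g.1 1 1 - 1) := by
        linear_combination sl_det g
      simp only [f]
      rw [this, two_mul, pow_add]
      exact dvd_sub (mul_dvd_mul hg.2.2.2.1 hg.2.2.2.2) (mul_dvd_mul hg.2.1 hg.2.2.1)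
  have hcard := Finset.card_le_mul_card_image (f := f) hSf.toFinset
    (Fintype.card F * 4 ^ D) (by
      intro y hy
      obtain ⟨g0, hg0, rfl⟩ := Finset.mem_image.mp hy
      rw [Set.Finite.mem_toFinset] at hg0
      obtain ⟨hfin, hb⟩ := divisors_bound (g0.1 0 1 * g0.1 1 0) hg0.2
      have hdeg : (g0.1 0 1 * g0.1 1 0).natDegree ≤ 2 * D := by
        refine natDegree_mul_le.trans ?_
        have h1 := (gD_entry g0 0 1).trans hg0.1.1
        have h2 := (gD_entry g0 1 0).trans hg0.1.1
        omega
      have hfib : ∀ g : SLX F, f g = f g0 → g.1 0 0 = g0.1 0 0 ∧ g.1 1 1 = g0.1 1 1 ∧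
          g.1 0 1 * g.1 1 0 = g0.1 0 1 * g0.1 1 0 := by
        intro g hg
        simp only [f, Prod.mk.injEq] at hg
        have h1 : g.1 0 0 = g0.1 0 0 := by linear_combination hg.1
        have h2 : g.1 1 1 = g0.1 1 1 := by linear_combination hg.2 - hg.1
        refine ⟨h1, h2, ?_⟩
        have e1 := sl_det g
        have e2 := sl_det g0
        rw [h1, h2] at e1
        linear_combination e2 - e1
      have hle : (Finset.filter (fun x => f x = f g0) hSf.toFinset).card ≤
          hfin.toFinset.card := by
        apply Finset.card_le_card_of_injOn (fun g => g.1 0 1)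
        · intro g hg
          simp only [Finset.coe_filter, Set.Finite.mem_toFinset, mem_ofPred_eq] at hg
          simp only [Set.Finite.coe_toFinset, mem_ofPred_eq]
          rw [← (hfib g hg.2).2.2]
          exact dvd_mul_right _ _
        · intro g hg h hh e
          simp only [Finset.coe_filter, Set.Finite.mem_toFinset, mem_ofPred_eq] at hg hh
          obtain ⟨a1, a2, a3⟩ := hfib g hg.2
          obtain ⟨b1, b2, b3⟩ := hfib h hh.2
          simp only at e
          refine slx_ext (a1.trans b1.symm) e ?_ (a2.trans b2.symm)
          have hne : g.1 0 1 ≠ 0 := left_ne_zero_of_mul hg.1.2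
          apply mul_left_cancel₀ hne
          rw [a3, e, b3]
      rw [← Set.ncard_eq_toFinset_card _ hfin] at hle
      refine hle.trans (hb.trans ?_)
      have : (4:ℕ) ^ D = 2 ^ (2 * D) := by rw [pow_mul]; norm_num
      rw [this]
      gcongr; norm_num)
  rw [← Set.ncard_eq_toFinset_card _ hSf] at hcard
  refine hcard.trans ?_
  gcongr
  have e : (Finset.image f hSf.toFinset).card = (f '' S).ncard := by
    rw [← Set.ncard_coe_finset]; simp
  rw [e]
  refine (Set.ncard_le_ncard himg (hP1.prod hP2)).trans ?_
  rw [Set.ncard_prod]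
  exact Nat.mul_le_mul (polD_card D n) (polD_card D (2 * n))

lemma congD_card (n D : ℕ) (hn : 1 ≤ n) :
    (congD F n D).ncard ≤ 3 * (Fintype.card F * 4 ^ D *
      (Fintype.card F ^ (D + 1 - n) * Fintype.card F ^ (D + 1 - 2 * n))) := by
  have e : congD F n D = {g ∈ congD F n D | g.1 0 1 * g.1 1 0 = 0} ∪
      {g ∈ congD F n D | g.1 0 1 * g.1 1 0 ≠ 0} := by
    ext g; simp only [mem_union, mem_ofPred_eq]; tauto
  have h1 := Set.ncard_union_le {g ∈ congD F n D | g.1 0 1 * g.1 1 0 = 0}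
      {g ∈ congD F n D | g.1 0 1 * g.1 1 0 ≠ 0}
  rw [← e] at h1
  have h2 := congD_card0 (F := F) n D hn
  have h3 := congD_card1 (F := F) n D
  have hq : 1 ≤ Fintype.card F := Fintype.card_pos
  have h4 : Fintype.card F ^ (D + 1 - n) ≤ Fintype.card F * 4 ^ D *
      (Fintype.card F ^ (D + 1 - n) * Fintype.card F ^ (D + 1 - 2 * n)) := by
    have a1 : 1 ≤ Fintype.card F * 4 ^ D := Nat.succ_le_of_lt (by positivity)
    have a2 : 1 ≤ Fintype.card F ^ (D + 1 - 2 * n) := Nat.succ_le_of_lt (by positivity)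
    calc Fintype.card F ^ (D + 1 - n) = 1 * (Fintype.card F ^ (D + 1 - n) * 1) := by ring
      _ ≤ _ := by gcongr
  omega


lemma return_bound (n : ℕ) (hn : 1 ≤ n) (A : Finset (SLX F))
    (hA : ∀ g ∈ A, g ∈ congD F n (4 * n)) :
    ∑ g ∈ A, ‖((b1X * b2X : MonoidAlgebra ℂ (SLX F)) ^ (4 * n) * b1X).coeff g‖ ≤
      3 * (4 * n + 1) * (Fintype.card F : ℝ) ^ (5 * n + 4) * 4 ^ (8 * n) := by
  set q : ℝ := (Fintype.card F : ℝ) with hq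
  have hq1 : 1 ≤ q := by
    have : 0 < Fintype.card F := Fintype.card_pos
    rw [hq]; exact_mod_cast this
  have hq0 : 0 < q := by linarith
  have hA2 : ∑ g ∈ A, q⁻¹ ^ (gD g) ≤ (4 * n + 1) * (3 * q ^ (n + 3) * 4 ^ (4 * n)) := by
    have hmap : ∀ g ∈ A, gD g ∈ Finset.range (4 * n + 1) := fun g hg =>
      Finset.mem_range.mpr (Nat.lt_succ_of_le (hA g hg).1)
    rw [← Finset.sum_fiberwise_of_maps_to hmap]
    have : ∀ D ∈ Finset.range (4 * n + 1), ∑ g ∈ A with gD g = D, q⁻¹ ^ (gD g) ≤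
        3 * q ^ (n + 3) * 4 ^ (4 * n) := by
      intro D hD
      have hD' : D ≤ 4 * n := by have := Finset.mem_range.mp hD; omega
      have h1 : ∑ g ∈ A with gD g = D, q⁻¹ ^ (gD g) =
          (Finset.card {g ∈ A | gD g = D} : ℝ) * q⁻¹ ^ D := by
        rw [← nsmul_eq_mul, ← Finset.sum_const]
        refine Finset.sum_congr rfl fun g hg => ?_
        rw [(Finset.mem_filter.mp hg).2]
      have h2 : Finset.card {g ∈ A | gD g = D} ≤ (congD F n D).ncard := by
        rw [← Set.ncard_coe_finset]
        refine Set.ncard_le_ncard ?_ (congD_finite n D)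
        intro g hg
        have hg' := Finset.mem_filter.mp (Finset.mem_coe.mp hg)
        exact ⟨hg'.2.le, (hA g hg'.1).2⟩
      have h3 := h2.trans (congD_card n D hn)
      have h4 : (Finset.card {g ∈ A | gD g = D} : ℝ) ≤
          3 * (q * 4 ^ D * (q ^ (D + 1 - n) * q ^ (D + 1 - 2 * n))) := by
        rw [hq]; exact_mod_cast h3
      rw [h1]
      calc _ ≤ 3 * (q * 4 ^ D * (q ^ (D + 1 - n) * q ^ (D + 1 - 2 * n))) * q⁻¹ ^ D := by gcongr
        _ = 3 * (q * 4 ^ D) * (q ^ ((D + 1 - n) + (D + 1 - 2 * n)) * q⁻¹ ^ D) := by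
          rw [pow_add]; ring
        _ ≤ 3 * (q * 4 ^ (4 * n)) * (q ^ (D + (n + 2)) * q⁻¹ ^ D) := by
          have e1 : q ^ ((D + 1 - n) + (D + 1 - 2 * n)) ≤ q ^ (D + (n + 2)) :=
            pow_le_pow_right₀ hq1 (by omega)
          have e2 : (4:ℝ) ^ D ≤ 4 ^ (4 * n) := pow_le_pow_right₀ (by norm_num) hD'
          gcongr
        _ = 3 * q ^ (n + 3) * 4 ^ (4 * n) := by
          rw [pow_add q D, inv_pow]; field_simp; ring
    refine (Finset.sum_le_sum this).trans ?_
    rw [Finset.sum_const, nsmul_eq_mul, Finset.card_range]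
    push_cast; exact le_refl _
  calc _ ≤ ∑ g ∈ A, q * ((4 * q) ^ (4 * n) * q⁻¹ ^ (gD g)) :=
        Finset.sum_le_sum fun g _ => bk1_bound _ g
    _ = q * (4 * q) ^ (4 * n) * ∑ g ∈ A, q⁻¹ ^ (gD g) := by
      rw [Finset.mul_sum]; exact Finset.sum_congr rfl fun g _ => by ring
    _ ≤ q * (4 * q) ^ (4 * n) * ((4 * n + 1) * (3 * q ^ (n + 3) * 4 ^ (4 * n))) := by gcongr
    _ = _ := by
      rw [mul_pow, show 5 * n + 4 = 4 * n + (n + 3) + 1 by ring, show 8 * n = 4 * n + 4 * n by ring,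
        pow_add, pow_add, pow_add, pow_add]
      ring
end Counting2

section Spectral
variable {S : Type} [Fintype S]

/-- Inner product of functions on a finite set. -/
def ipF (f g : S → ℂ) : ℂ := ∑ s, starRingEnd ℂ (f s) * g s

def IsSymF (T : Module.End ℂ (S → ℂ)) : Prop := ∀ f g, ipF (T f) g = ipF f (T g)

def toE (f : S → ℂ) : EuclideanSpace ℂ S := WithLp.toLp 2 f

lemma inner_toE (f g : S → ℂ) : inner ℂ (toE f) (toE g) = ipF f g := by
  simp [toE, ipF, PiLp.inner_apply, mul_comm]

lemma ipF_self (f : S → ℂ) : ipF f f = ((∑ s, ‖f s‖ ^ 2 : ℝ) : ℂ) := by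
  simp [ipF, Complex.conj_mul']

lemma norm_toE_sq (f : S → ℂ) : ‖toE f‖ ^ 2 = ∑ s, ‖f s‖ ^ 2 := by
  simp [toE, EuclideanSpace.norm_sq_eq]

def dl (s : S) : S → ℂ := Pi.single s 1

lemma ipF_dl (s : S) (f : S → ℂ) : ipF (dl s) f = f s := by
  simp [ipF, dl, Pi.single_apply]

lemma isSymF_pow (T : Module.End ℂ (S → ℂ)) (hT : IsSymF T) (l : ℕ) : IsSymF (T ^ l) := by
  induction l with
  | zero => intro f g; simp
  | succ l ih =>
    intro f g
    rw [pow_succ', Module.End.mul_apply, hT, ih, ← Module.End.mul_apply, ← pow_succ, pow_succ']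

lemma pow_eig (T : Module.End ℂ (S → ℂ)) (μ : ℝ) (v : S → ℂ) (hv : T v = (μ : ℂ) • v) (l : ℕ) :
    (T ^ l) v = ((μ ^ l : ℝ) : ℂ) • v := by
  induction l with
  | zero => simp
  | succ l ih =>
    rw [pow_succ, Module.End.mul_apply, hv, map_smul, ih, smul_smul]
    congr 1; push_cast; ring

/-- Multiplicity bound. -/
lemma mult_bound {J : Type} [Fintype J] (T : Module.End ℂ (S → ℂ)) (hT : IsSymF T)
    (μ : ℝ) (w : J → S → ℂ) (hw0 : ∀ j, w j ≠ 0) (horth : ∀ i j, i ≠ j → ipF (w i) (w j) = 0)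
    (hw : ∀ j, T (w j) = (μ : ℂ) • w j) (l : ℕ) :
    Fintype.card J * μ ^ (2 * l) ≤ ∑ s, (((T ^ (2 * l)) (dl s)) s).re := by
  let e : J → EuclideanSpace ℂ S := fun j => ((‖toE (w j)‖⁻¹ : ℝ) : ℂ) • toE (w j)
  have hpos : ∀ j, 0 < ‖toE (w j)‖ := by
    intro j
    rw [norm_pos_iff]
    intro h
    exact hw0 j (by simpa [toE] using h)
  have he : Orthonormal ℂ e := by
    constructor
    · intro j
      simp only [e, norm_smul, Complex.norm_real, norm_inv, norm_norm]
      exact inv_mul_cancel₀ (hpos j).ne'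
    · intro i j hij
      simp only [e, inner_smul_left, inner_smul_right, inner_toE, horth i j hij, mul_zero]
  have hsT := isSymF_pow T hT l
  have h1 : ∀ s, (((T ^ (2 * l)) (dl s)) s).re = ‖toE ((T ^ l) (dl s))‖ ^ 2 := by
    intro s
    have : ((T ^ (2 * l)) (dl s)) s = ipF ((T ^ l) (dl s)) ((T ^ l) (dl s)) := by
      rw [hsT, ipF_dl, two_mul, pow_add, Module.End.mul_apply]
    rw [this, ipF_self, norm_toE_sq, Complex.ofReal_re]
  have h2 : ∀ s, ∑ j, ‖inner ℂ (e j) (toE ((T ^ l) (dl s)))‖ ^ 2 ≤ ‖toE ((T ^ l) (dl s))‖ ^ 2 :=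
    fun s => Orthonormal.sum_inner_products_le (toE ((T ^ l) (dl s))) he (s := Finset.univ)
  have h3 : ∀ j s, ‖inner ℂ (e j) (toE ((T ^ l) (dl s)))‖ ^ 2 =
      (‖toE (w j)‖⁻¹) ^ 2 * (μ ^ (2 * l) * ‖w j s‖ ^ 2) := by
    intro j s
    have : ‖inner ℂ (toE (w j)) (toE ((T ^ l) (dl s)))‖ = |μ| ^ l * ‖w j s‖ := by
      rw [← norm_inner_symm, inner_toE, hsT, ipF_dl, pow_eig T μ _ (hw j)]
      simp
    simp only [e, inner_smul_left, norm_mul, this]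
    rw [mul_pow, mul_pow, ← pow_mul, mul_comm l 2, pow_mul |μ|, sq_abs, pow_mul]
    simp
  have h4 : ∀ j, ∑ s, ‖inner ℂ (e j) (toE ((T ^ l) (dl s)))‖ ^ 2 = μ ^ (2 * l) := by
    intro j
    simp only [h3, ← Finset.mul_sum]
    rw [← norm_toE_sq]
    have := (hpos j).ne'
    field_simp
  calc (Fintype.card J : ℝ) * μ ^ (2 * l) = ∑ j : J, μ ^ (2 * l) := by simp
    _ = ∑ j, ∑ s, ‖inner ℂ (e j) (toE ((T ^ l) (dl s)))‖ ^ 2 := by simp only [h4]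
    _ = ∑ s, ∑ j, ‖inner ℂ (e j) (toE ((T ^ l) (dl s)))‖ ^ 2 := Finset.sum_comm
    _ ≤ ∑ s, ‖toE ((T ^ l) (dl s))‖ ^ 2 := Finset.sum_le_sum fun s _ => h2 s
    _ = _ := by simp only [h1]

lemma finite_eigs (T : Module.End ℂ (S → ℂ)) :
    {μ : ℝ | ∃ v : S → ℂ, v ≠ 0 ∧ T v = (μ : ℂ) • v}.Finite := by
  have h := Module.End.finite_hasEigenvalue T
  refine Set.Finite.of_injOn (f := fun μ : ℝ => (μ : ℂ)) ?_
    (Complex.ofReal_injective.injOn) h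
  rintro μ ⟨v, hv, hT⟩
  exact Module.End.hasEigenvalue_of_hasEigenvector ⟨Module.End.mem_eigenspace_iff.mpr hT, hv⟩

lemma norm_bound_of_eig (T : Module.End ℂ (S → ℂ)) (hT : IsSymF T) (lam : ℝ) (hl : 0 ≤ lam)
    (ξ : S → ℂ) (h : ∀ (μ : ℝ) (v : S → ℂ), T v = (μ : ℂ) • v → lam < |μ| → ipF v ξ = 0) :
    ∑ s, ‖T ξ s‖ ^ 2 ≤ lam ^ 2 * ∑ s, ‖ξ s‖ ^ 2 := by
  let L := WithLp.linearEquiv 2 ℂ (S → ℂ)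
  let T' : EuclideanSpace ℂ S →ₗ[ℂ] EuclideanSpace ℂ S := L.symm.toLinearMap ∘ₗ T ∘ₗ L.toLinearMap
  have hT'e : ∀ f : S → ℂ, T' (toE f) = toE (T f) := fun f => rfl
  have hsurj : ∀ x : EuclideanSpace ℂ S, x = toE (L x) := fun x => rfl
  have hsym : T'.IsSymmetric := by
    intro x y
    rw [hsurj x, hsurj y, hT'e, hT'e, inner_toE, inner_toE]
    exact hT _ _
  let b := hsym.eigenvectorBasis (n := Module.finrank ℂ (EuclideanSpace ℂ S)) rfl
  have hb : ∀ i, T' (b i) = ((hsym.eigenvalues rfl i : ℝ) : ℂ) • b i := fun i =>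
    hsym.apply_eigenvectorBasis rfl i
  rw [← norm_toE_sq, ← norm_toE_sq, ← hT'e, ← b.sum_sq_norm_inner_right (T' (toE ξ)),
    ← b.sum_sq_norm_inner_right (toE ξ), Finset.mul_sum]
  refine Finset.sum_le_sum fun i _ => ?_
  rw [← hsym, hb, inner_smul_left, norm_mul, mul_pow]
  by_cases hi : lam < |hsym.eigenvalues rfl i|
  · have : inner ℂ (b i) (toE ξ) = 0 := by
      rw [hsurj (b i), inner_toE]
      refine h (hsym.eigenvalues rfl i) _ ?_ hi
      have := hb i
      rw [hsurj (b i), hT'e] at this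
      exact congrArg L this
    rw [this]; simp
  · gcongr
    simpa using not_lt.mp hi
end Spectral

section LRep
variable {Γ S H : Type} [Group Γ] [Group S] [Group H] [Fintype H]

/-- Left translation representation on functions. -/
def LtrHom (S : Type) [Group S] : S →* Module.End ℂ (S → ℂ) where
  toFun s := { toFun := fun f y => f (s⁻¹ * y), map_add' := fun _ _ => rfl,
               map_smul' := fun _ _ => rfl }
  map_one' := by ext f y; simp
  map_mul' s t := by ext f y; simp [mul_assoc]

lemma LtrHom_apply (s : S) (f : S → ℂ) (y : S) : LtrHom S s f y = f (s⁻¹ * y) := rfl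

def Lrep (φ : Γ →* S) : MonoidAlgebra ℂ Γ →ₐ[ℂ] Module.End ℂ (S → ℂ) :=
  MonoidAlgebra.lift ℂ (Module.End ℂ (S → ℂ)) Γ ((LtrHom S).comp φ)

lemma Lrep_single (φ : Γ →* S) (γ : Γ) (r : ℂ) (f : S → ℂ) (y : S) :
    Lrep φ (MonoidAlgebra.single γ r) f y = r * f ((φ γ)⁻¹ * y) := by
  simp [Lrep, MonoidAlgebra.lift_single, LtrHom_apply]

lemma Lrep_apply (φ : Γ →* S) (c : MonoidAlgebra ℂ Γ) (f : S → ℂ) (y : S) :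
    Lrep φ c f y = ∑ γ ∈ c.coeff.support, c.coeff γ * f ((φ γ)⁻¹ * y) := by
  rw [Lrep, MonoidAlgebra.lift_apply, Finsupp.sum, LinearMap.sum_apply, Finset.sum_apply]
  rfl

def Rtr (s : S) (f : S → ℂ) : S → ℂ := fun y => f (y * s)

lemma Lrep_Rtr (φ : Γ →* S) (c : MonoidAlgebra ℂ Γ) (s : S) (f : S → ℂ) :
    Lrep φ c (Rtr s f) = Rtr s (Lrep φ c f) := by
  ext y; simp [Lrep_apply, Rtr, mul_assoc]

lemma Rtr_Rtr (s t : S) (f : S → ℂ) : Rtr s (Rtr t f) = Rtr (s * t) f := by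
  ext y; simp [Rtr, mul_assoc]

lemma ipF_Rtr [Fintype S] (s : S) (f g : S → ℂ) : ipF (Rtr s f) (Rtr s g) = ipF f g := by
  simp only [ipF, Rtr]
  exact Fintype.sum_equiv (Equiv.mulRight s) _ _ fun y => rfl

lemma ipF_Ltr [Fintype S] (s : S) (f g : S → ℂ) :
    ipF (LtrHom S s f) g = ipF f (LtrHom S s⁻¹ g) := by
  simp only [ipF, LtrHom_apply]
  exact Fintype.sum_equiv (Equiv.mulLeft s⁻¹) _ _ fun y => by simp

lemma Rtr_smul (s : S) (c : ℂ) (f : S → ℂ) : Rtr s (c • f) = c • Rtr s f := rfl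

/-- Averaging element of a finite subgroup. -/
def avg (h : H →* Γ) : MonoidAlgebra ℂ Γ :=
  ((Fintype.card H : ℂ)⁻¹) • ∑ x : H, MonoidAlgebra.single (h x) 1

lemma single_mul_avg (h : H →* Γ) (x : H) : MonoidAlgebra.single (h x) 1 * avg h = avg h := by
  rw [avg, mul_smul_comm, Finset.mul_sum]
  congr 1
  simp only [MonoidAlgebra.single_mul_single, mul_one, ← map_mul]
  exact Fintype.sum_equiv (Equiv.mulLeft x) _ _ fun y => rfl

lemma avg_mul_avg (h : H →* Γ) : avg h * avg h = avg h := by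
  conv_lhs => lhs; rw [avg]
  rw [smul_mul_assoc, Finset.sum_mul]
  simp only [single_mul_avg, Finset.sum_const, Finset.card_univ]
  rw [← Nat.cast_smul_eq_nsmul ℂ, smul_smul, inv_mul_cancel₀, one_smul]
  exact_mod_cast Fintype.card_ne_zero

lemma Lrep_avg (φ : Γ →* S) (h : H →* Γ) (f : S → ℂ) :
    Lrep φ (avg h) f = ((Fintype.card H : ℂ)⁻¹) • ∑ x : H, LtrHom S (φ (h x)) f := by
  rw [avg, map_smul, map_sum, LinearMap.smul_apply, LinearMap.sum_apply]
  congr 1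
  refine Finset.sum_congr rfl fun x _ => ?_
  ext y
  rw [Lrep_single, one_mul, LtrHom_apply]

lemma Lrep_comp {Δ : Type} [Group Δ] (φ : Γ →* S) (ψ : Δ →* Γ) (h : H →* Δ) :
    Lrep (φ.comp ψ) (avg h) = Lrep φ (avg (ψ.comp h)) := by
  ext1 f
  simp only [Lrep_avg]; rfl

lemma ipF_smul_left [Fintype S] (c : ℂ) (f g : S → ℂ) :
    ipF (c • f) g = starRingEnd ℂ c * ipF f g := by
  simp [ipF, Finset.mul_sum, mul_assoc]
lemma ipF_smul_right [Fintype S] (c : ℂ) (f g : S → ℂ) : ipF f (c • g) = c * ipF f g := by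
  simp only [ipF, Finset.mul_sum, Pi.smul_apply, smul_eq_mul]
  exact Finset.sum_congr rfl fun _ _ => by ring
lemma ipF_sum_left [Fintype S] {ι : Type} (s : Finset ι) (f : ι → S → ℂ) (g : S → ℂ) :
    ipF (∑ i ∈ s, f i) g = ∑ i ∈ s, ipF (f i) g := by
  simp only [ipF, Finset.sum_apply, map_sum, Finset.sum_mul]; rw [Finset.sum_comm]
lemma ipF_sum_right [Fintype S] {ι : Type} (s : Finset ι) (f : ι → S → ℂ) (g : S → ℂ) :
    ipF g (∑ i ∈ s, f i) = ∑ i ∈ s, ipF g (f i) := by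
  simp only [ipF, Finset.sum_apply, Finset.mul_sum]; rw [Finset.sum_comm]
lemma ipF_sub_right [Fintype S] (f g h : S → ℂ) : ipF f (g - h) = ipF f g - ipF f h := by
  simp [ipF, mul_sub, Finset.sum_sub_distrib]
lemma ipF_conj [Fintype S] (f g : S → ℂ) : starRingEnd ℂ (ipF f g) = ipF g f := by
  simp [ipF, mul_comm]

lemma avg_sym [Fintype S] (φ : Γ →* S) (h : H →* Γ) : IsSymF (Lrep φ (avg h)) := by
  intro f g
  rw [Lrep_avg, Lrep_avg, ipF_smul_left, ipF_smul_right, ipF_sum_left, ipF_sum_right]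
  congr 1
  · simp
  · simp only [ipF_Ltr]
    exact Fintype.sum_equiv (Equiv.inv H) _ _ fun y => by simp

/-- squared norm -/
def n2 [Fintype S] (f : S → ℂ) : ℝ := ∑ s, ‖f s‖ ^ 2

lemma n2_nonneg [Fintype S] (f : S → ℂ) : 0 ≤ n2 f := Finset.sum_nonneg fun _ _ => by positivity

lemma n2_eq_zero [Fintype S] {f : S → ℂ} (h : n2 f = 0) : f = 0 := by
  rw [n2, Finset.sum_eq_zero_iff_of_nonneg (fun _ _ => by positivity)] at h
  ext s; simpa using h s (Finset.mem_univ s)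

lemma avg_pyth [Fintype S] (φ : Γ →* S) (h : H →* Γ) (f : S → ℂ) :
    n2 f = n2 (Lrep φ (avg h) f) + n2 (f - Lrep φ (avg h) f) := by
  set P := Lrep φ (avg h) with hP
  have hPP : ∀ g, P (P g) = P g := fun g => by
    rw [← Module.End.mul_apply, hP, ← map_mul, avg_mul_avg]
  have h0 : ipF (P f) (f - P f) = 0 := by
    rw [avg_sym φ h, map_sub, hPP, sub_self]; simp [ipF]
  have hn : ∀ g : S → ℂ, (n2 g : ℂ) = ipF g g := fun g => (ipF_self g).symm
  have h1 : ipF (f - P f) (P f) = 0 := by rw [← ipF_conj, h0, map_zero]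
  have : (n2 f : ℂ) = (n2 (P f) : ℂ) + n2 (f - P f) := by
    rw [hn, hn, hn]
    have e1 : ipF (f - P f) f = ipF (f - P f) (f - P f) := by
      rw [ipF_sub_right, h1, sub_zero]
    have e2 : ipF (P f) f = ipF (P f) (P f) := by
      rw [ipF_sub_right, sub_eq_zero] at h0; exact h0
    rw [← e1, ← e2]
    simp [ipF, ← Finset.sum_add_distrib, ← add_mul]
  exact_mod_cast this

lemma avg_fix [Fintype S] (φ : Γ →* S) (h : H →* Γ) (f : S → ℂ) (hf : Lrep φ (avg h) f = f)
    (x : H) : LtrHom S (φ (h x)) f = f := by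
  have : LtrHom S (φ (h x)) (Lrep φ (avg h) f) = Lrep φ (avg h) f := by
    have e : Lrep φ (MonoidAlgebra.single (h x) 1) = LtrHom S (φ (h x)) := by
      refine LinearMap.ext fun f => ?_
      ext y; rw [Lrep_single, one_mul, LtrHom_apply]
    rw [← e, ← Module.End.mul_apply, ← map_mul, single_mul_avg]
  rwa [hf] at this

variable {H' : Type} [Group H'] [Fintype H']

def aOf (h : H →* Γ) (h' : H' →* Γ) : MonoidAlgebra ℂ Γ := avg h * avg h' * avg h

lemma aOf_sym [Fintype S] (φ : Γ →* S) (h : H →* Γ) (h' : H' →* Γ) :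
    IsSymF (Lrep φ (aOf h h')) := by
  intro f g
  simp only [aOf, map_mul, Module.End.mul_apply]
  rw [avg_sym, avg_sym, avg_sym]

lemma aOf_comp {Δ : Type} [Group Δ] (φ : Γ →* S) (ψ : Δ →* Γ) (h : H →* Δ) (h' : H' →* Δ) :
    Lrep (φ.comp ψ) (aOf h h') = Lrep φ (aOf (ψ.comp h) (ψ.comp h')) := by
  simp only [aOf, map_mul, Lrep_comp]

lemma aOf_pow (h : H →* Γ) (h' : H' →* Γ) (l : ℕ) (hl : l ≠ 0) :
    aOf h h' ^ l = (avg h * avg h') ^ l * avg h := by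
  obtain ⟨l, rfl⟩ := Nat.exists_eq_succ_of_ne_zero hl
  induction l with
  | zero => simp [aOf]
  | succ l ih =>
    rw [pow_succ, ih (Nat.succ_ne_zero l), pow_succ _ (l+1), aOf]
    have := avg_mul_avg h
    simp only [mul_assoc]
    rw [← mul_assoc (avg h) (avg h), this]

lemma aOf_contr [Fintype S] (φ : Γ →* S) (h : H →* Γ) (h' : H' →* Γ) (v : S → ℂ) :
    n2 (Lrep φ (aOf h h') v) ≤ n2 v := by
  simp only [aOf, map_mul, Module.End.mul_apply]
  have a1 := avg_pyth φ h v
  have a2 := avg_pyth φ h' (Lrep φ (avg h) v)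
  have a3 := avg_pyth φ h (Lrep φ (avg h') (Lrep φ (avg h) v))
  have b1 := n2_nonneg (v - Lrep φ (avg h) v)
  have b2 := n2_nonneg (Lrep φ (avg h) v - Lrep φ (avg h') (Lrep φ (avg h) v))
  have b3 := n2_nonneg (Lrep φ (avg h') (Lrep φ (avg h) v) -
    Lrep φ (avg h) (Lrep φ (avg h') (Lrep φ (avg h) v)))
  linarith

lemma aOf_inv [Fintype S] (φ : Γ →* S) (h : H →* Γ) (h' : H' →* Γ) (v : S → ℂ)
    (hv : n2 v ≤ n2 (Lrep φ (aOf h h') v)) :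
    (∀ x, LtrHom S (φ (h x)) v = v) ∧ (∀ x, LtrHom S (φ (h' x)) v = v) := by
  simp only [aOf, map_mul, Module.End.mul_apply] at hv
  have a1 := avg_pyth φ h v
  have a2 := avg_pyth φ h' (Lrep φ (avg h) v)
  have a3 := avg_pyth φ h (Lrep φ (avg h') (Lrep φ (avg h) v))
  have b1 := n2_nonneg (v - Lrep φ (avg h) v)
  have b2 := n2_nonneg (Lrep φ (avg h) v - Lrep φ (avg h') (Lrep φ (avg h) v))
  have b3 := n2_nonneg (Lrep φ (avg h') (Lrep φ (avg h) v) -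
    Lrep φ (avg h) (Lrep φ (avg h') (Lrep φ (avg h) v)))
  have c1 : Lrep φ (avg h) v = v :=
    (sub_eq_zero.mp (n2_eq_zero (le_antisymm (by linarith) b1))).symm
  have c2 := (sub_eq_zero.mp (n2_eq_zero (le_antisymm (by linarith) b2))).symm
  rw [c1] at c2
  exact ⟨avg_fix φ h v c1, avg_fix φ h' v c2⟩

lemma n2_smul [Fintype S] (c : ℂ) (v : S → ℂ) : n2 (c • v) = ‖c‖ ^ 2 * n2 v := by
  simp [n2, mul_pow, Finset.mul_sum]
end LRep

section Levels
open Polynomial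
variable {F : Type} [Field F] [Fintype F]

/-- The truncated polynomial ring `F[X]/(X^n)`. -/
abbrev OO (F : Type) [Field F] (n : ℕ) : Type := AdjoinRoot (X ^ n : F[X])

abbrev mkO (F : Type) [Field F] (n : ℕ) : F[X] →+* OO F n := AdjoinRoot.mk (X ^ n : F[X])

abbrev SO (F : Type) [Field F] (n : ℕ) : Type := Matrix.SpecialLinearGroup (Fin 2) (OO F n)

instance oo_finite (n : ℕ) : Finite (OO F n) := by
  have pb := AdjoinRoot.powerBasis (K := F) (f := X ^ n) (pow_ne_zero n X_ne_zero)
  have : Module.Finite F (OO F n) := pb.finite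
  exact Module.finite_of_finite F

instance oo_fintype (n : ℕ) : Fintype (OO F n) := Fintype.ofFinite _

lemma oo_card (n : ℕ) : Fintype.card (OO F n) = Fintype.card F ^ n := by
  have hb := AdjoinRoot.powerBasis (K := F) (f := X ^ n) (pow_ne_zero n X_ne_zero)
  have : Module.finrank F (OO F n) = n := by
    rw [(AdjoinRoot.powerBasis (K := F) (f := X ^ n) (pow_ne_zero n X_ne_zero)).finrank]
    simp
  rw [Module.card_eq_pow_finrank (K := F), this]

lemma oo_unit (n : ℕ) (p : F[X]) (hp : p.coeff 0 ≠ 0) : IsUnit (mkO F n p) := by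
  have h1 : IsCoprime (X : F[X]) p := by
    rw [Polynomial.irreducible_X.coprime_iff_not_dvd, Polynomial.X_dvd_iff]; exact hp
  obtain ⟨a, b, hab⟩ := h1.pow_left (m := n)
  refine IsUnit.of_mul_eq_one (mkO F n b) ?_
  rw [← map_mul, ← map_one (mkO F n), AdjoinRoot.mk_eq_mk, mul_comm p b, ← hab]
  exact ⟨-a, by ring⟩

def ev0 (F : Type) [Field F] (m : ℕ) : OO F (m + 1) →+* F :=
  AdjoinRoot.lift (RingHom.id F) 0 (by simp)

lemma ev0_mk (m : ℕ) (p : F[X]) : ev0 F m (mkO F (m+1) p) = p.coeff 0 := by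
  rw [ev0, AdjoinRoot.lift_mk, Polynomial.coeff_zero_eq_eval_zero]; rfl

lemma oo_unit' (m : ℕ) (a : OO F (m+1)) (ha : ev0 F m a ≠ 0) : IsUnit a := by
  obtain ⟨p, rfl⟩ := AdjoinRoot.mk_surjective a
  exact oo_unit _ _ (by rwa [ev0_mk] at ha)

lemma oo_socle (m : ℕ) (r : OO F (m+1)) (hr : r ≠ 0) (c : F) :
    ∃ y, r * y = mkO F (m+1) (C c * X ^ m) := by
  obtain ⟨p, rfl⟩ := AdjoinRoot.mk_surjective r
  have hp : ¬ X ^ (m+1) ∣ p := fun h => hr (AdjoinRoot.mk_eq_zero.mpr h)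
  have hp0 : p ≠ 0 := by rintro rfl; exact hp (dvd_zero _)
  have hfm : FiniteMultiplicity (X : F[X]) p := ⟨m, hp⟩
  obtain ⟨p', hp', hnd⟩ := hfm.exists_eq_pow_mul_and_not_dvd
  set k := multiplicity X p
  have hk : k ≤ m := by
    by_contra h
    exact hp (hp' ▸ Dvd.dvd.mul_right (pow_dvd_pow _ (by omega)) _)
  obtain ⟨u, hu⟩ := oo_unit (m+1) p' (by rwa [Polynomial.X_dvd_iff] at hnd)
  refine ⟨(↑u⁻¹ : OO F (m+1)) * mkO F (m+1) (C c * X ^ (m-k)), ?_⟩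
  have e : (mkO F (m+1)) p = mkO F (m+1) (X^k) * (u : OO F (m+1)) := by
    rw [hu, ← map_mul, ← hp']
  rw [show (AdjoinRoot.mk (X^(m+1))) p = _ from e, mul_assoc, Units.mul_inv_cancel_left, ← map_mul]
  congr 1
  rw [mul_left_comm, ← pow_add, Nat.add_sub_cancel' hk]

instance so_finite (n : ℕ) : Finite (SO F n) := by unfold SO; infer_instance
instance so_fintype (n : ℕ) : Fintype (SO F n) := Fintype.ofFinite _

lemma so_card (m : ℕ) : Fintype.card (SO F (m+1)) ≤ 2 * Fintype.card F ^ (3 * (m+1)) := by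
  let R := OO F (m+1)
  let f : SO F (m+1) → (R × R × R) ⊕ (R × R × R) := fun g =>
    if ev0 F m (g.1 0 0) ≠ 0 then Sum.inl (g.1 0 0, g.1 0 1, g.1 1 0)
    else Sum.inr (g.1 0 0, g.1 0 1, g.1 1 1)
  have hf : Injective f := by
    intro g h hgh
    have dg := sl_det g
    have dh := sl_det h
    simp only [f] at hgh
    by_cases h1 : ev0 F m (g.1 0 0) ≠ 0 <;> by_cases h2 : ev0 F m (h.1 0 0) ≠ 0
    · rw [if_pos h1, if_pos h2] at hgh
      simp only [Sum.inl.injEq, Prod.mk.injEq] at hgh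
      obtain ⟨e1, e2, e3⟩ := hgh
      refine slx_ext e1 e2 e3 ?_
      have hu := oo_unit' m _ h1
      refine hu.mul_left_cancel ?_
      rw [← e1, ← e2, ← e3] at dh
      linear_combination dg - dh
    · rw [if_pos h1, if_neg h2] at hgh; cases hgh
    · rw [if_neg h1, if_pos h2] at hgh; cases hgh
    · rw [if_neg h1, if_neg h2] at hgh
      simp only [Sum.inr.injEq, Prod.mk.injEq] at hgh
      obtain ⟨e1, e2, e3⟩ := hgh
      refine slx_ext e1 e2 ?_ e3
      have hu : IsUnit (g.1 0 1) := by
        apply oo_unit' m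
        intro h0
        push Not at h1
        have := congrArg (ev0 F m) dg
        rw [map_sub, map_mul, map_mul, h1, h0, map_one] at this
        simp at this
      refine hu.mul_left_cancel ?_
      rw [← e1, ← e2, ← e3] at dh
      linear_combination dh - dg
  have := Fintype.card_le_of_injective f hf
  simp only [Fintype.card_sum, Fintype.card_prod, R, oo_card] at this
  calc _ ≤ _ := this
    _ = _ := by ring

/-- Reduction of the polynomial group. -/
def redO (F : Type) [Field F] (n : ℕ) : SLX F →* SO F n := Matrix.SpecialLinearGroup.map (mkO F n)

lemma redO_apply (n : ℕ) (g : SLX F) (i j : Fin 2) : (redO F n g).1 i j = mkO F n (g.1 i j) := rfl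

lemma redO_eq_one (n : ℕ) (g : SLX F) : redO F n g = 1 ↔
    X ^ n ∣ g.1 0 0 - 1 ∧ X ^ n ∣ g.1 1 1 - 1 ∧ X ^ n ∣ g.1 0 1 ∧ X ^ n ∣ g.1 1 0 := by
  have e : ∀ p : F[X], mkO F n p = 0 ↔ X ^ n ∣ p := fun p => AdjoinRoot.mk_eq_zero
  have e1 : ∀ p : F[X], mkO F n p = 1 ↔ X ^ n ∣ p - 1 := fun p => by
    rw [← map_one (mkO F n)]; exact AdjoinRoot.mk_eq_mk
  rw [← e1, ← e1, ← e (g.1 0 1), ← e (g.1 1 0)]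
  constructor
  · intro h
    have := fun i j => redO_apply n g i j
    rw [h] at this
    refine ⟨(this 0 0).symm, (this 1 1).symm, (this 0 1).symm, (this 1 0).symm⟩
  · rintro ⟨h1, h2, h3, h4⟩
    exact slx_ext h1 h3 h4 h2

/-- Transition maps. -/
def trO (F : Type) [Field F] (n : ℕ) : OO F (n+1) →+* OO F n :=
  Ideal.Quotient.lift _ (mkO F n) (fun a ha => by
    rw [Ideal.mem_span_singleton] at ha
    exact AdjoinRoot.mk_eq_zero.mpr ((pow_dvd_pow X (Nat.le_succ n)).trans ha))

lemma trO_mk (n : ℕ) (p : F[X]) : trO F n (mkO F (n+1) p) = mkO F n p := rfl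

def trS (F : Type) [Field F] (n : ℕ) : SO F (n+1) →* SO F n := Matrix.SpecialLinearGroup.map (trO F n)

lemma trS_red (n : ℕ) (g : SLX F) : trS F n (redO F (n+1) g) = redO F n g := by
  ext i j; rfl

lemma trO_ker (n : ℕ) (a : OO F (n+1)) (ha : trO F n a = 0) : ∃ c : F, a = mkO F (n+1) (C c * X ^ n) := by
  obtain ⟨p, rfl⟩ := AdjoinRoot.mk_surjective a
  obtain ⟨s, rfl⟩ := AdjoinRoot.mk_eq_zero.mp (show mkO F n p = 0 from ha)
  refine ⟨s.coeff 0, ?_⟩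
  rw [AdjoinRoot.mk_eq_mk]
  have : X ∣ s - C (s.coeff 0) := by rw [Polynomial.X_dvd_iff]; simp
  obtain ⟨u, hu⟩ := this
  exact ⟨u, by rw [pow_succ]; linear_combination X ^ n * hu⟩

/-- The two unipotent subgroups. -/
def h1X (F : Type) [Field F] : Multiplicative F →* SLX F where
  toFun c := eeM (C c.toAdd)
  map_one' := by rw [toAdd_one, map_zero, eeM_zero]
  map_mul' a b := by rw [toAdd_mul, map_add, eeM_add]

def h2X (F : Type) [Field F] : Multiplicative F →* SLX F where
  toFun c := ffM (C c.toAdd * X)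
  map_one' := by rw [toAdd_one, map_zero, zero_mul, ffM_zero]
  map_mul' a b := by rw [toAdd_mul, map_add, add_mul, ffM_add]

lemma b1X_avg : avg (h1X F) = ((Fintype.card F : ℂ)⁻¹) • (b1X : MonoidAlgebra ℂ (SLX F)) := by
  rw [avg, b1X, Fintype.card_multiplicative]
  congr 1
  exact Fintype.sum_equiv Multiplicative.toAdd _ _ fun _ => rfl

lemma b2X_avg : avg (h2X F) = ((Fintype.card F : ℂ)⁻¹) • (b2X : MonoidAlgebra ℂ (SLX F)) := by
  rw [avg, b2X, Fintype.card_multiplicative]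
  congr 1
  exact Fintype.sum_equiv Multiplicative.toAdd _ _ fun _ => rfl

lemma aOf_bX (l : ℕ) (hl : l ≠ 0) : aOf (h1X F) (h2X F) ^ l =
    ((Fintype.card F : ℂ)⁻¹) ^ (2 * l + 1) • ((b1X * b2X) ^ l * b1X) := by
  rw [aOf_pow _ _ l hl, b1X_avg, b2X_avg, smul_mul_smul_comm, _root_.smul_pow, smul_mul_smul_comm, ← pow_two, ← pow_mul, ← pow_succ]

lemma trace_bound (n : ℕ) (hn : 1 ≤ n) (s : SO F n) :
    (((Lrep (redO F n) (aOf (h1X F) (h2X F)) ^ (4 * n)) (dl s)) s).re ≤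
     ((Fintype.card F : ℝ)⁻¹) ^ (8 * n + 1) *
      (3 * (4 * n + 1) * (Fintype.card F : ℝ) ^ (5 * n + 4) * 4 ^ (8 * n)) := by
  refine (Complex.re_le_norm _).trans ?_
  rw [← map_pow, aOf_bX _ (by omega), map_smul, LinearMap.smul_apply, Pi.smul_apply, smul_eq_mul,
    norm_mul, norm_pow, norm_inv, Complex.norm_natCast, show 2 * (4 * n) + 1 = 8 * n + 1 by ring]
  refine mul_le_mul_of_nonneg_left ?_ (by positivity)
  rw [Lrep_apply]
  set c := ((b1X * b2X : MonoidAlgebra ℂ (SLX F)) ^ (4 * n) * b1X) with hc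
  have : ∀ γ : SLX F, c.coeff γ * dl s ((redO F n γ)⁻¹ * s) =
      if redO F n γ = 1 then c.coeff γ else 0 := by
    intro γ
    by_cases h : redO F n γ = 1
    · simp [h, dl]
    · have h' : (redO F n γ)⁻¹ * s ≠ s := by simpa using h
      rw [if_neg h]
      simp only [dl, Pi.single_apply, if_neg h', mul_zero]
  simp only [this]
  rw [← Finset.sum_filter]
  refine (norm_sum_le _ _).trans (return_bound n hn _ ?_)
  intro g hg
  rw [Finset.mem_filter, Finsupp.mem_support_iff, redO_eq_one] at hg
  exact ⟨bk1_supp _ _ hg.1, hg.2⟩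

lemma mult_bound' (m : ℕ) (μ : ℝ) {J : Type} [Fintype J] (w : J → SO F (m+1) → ℂ) (hw0 : ∀ j, w j ≠ 0)
    (horth : ∀ i j, i ≠ j → ipF (w i) (w j) = 0)
    (hw : ∀ j, Lrep (redO F (m+1)) (aOf (h1X F) (h2X F)) (w j) = (μ : ℂ) • w j)
    (hJ : Fintype.card J * Fintype.card F = Fintype.card F ^ (m+1)) :
    μ ^ (4 * (m+1)) ≤ 6 * (4 * (m+1) + 1) * (Fintype.card F : ℝ) ^ 4 *
      (4 ^ 8 / (Fintype.card F : ℝ)) ^ (m+1) := by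
  have h := mult_bound _ (aOf_sym (redO F (m+1)) (h1X F) (h2X F)) μ w hw0 horth hw (2 * (m+1))
  rw [show 2 * (2 * (m+1)) = 4 * (m+1) by ring] at h
  have h2 := Finset.sum_le_sum (fun s (_ : s ∈ Finset.univ) => trace_bound (F := F) (m+1) (by omega) s)
  rw [Finset.sum_const, nsmul_eq_mul, Finset.card_univ] at h2
  have hc : (Fintype.card (SO F (m+1)) : ℝ) ≤ 2 * (Fintype.card F : ℝ) ^ (3 * (m+1)) := by
    exact_mod_cast so_card m
  have hq0 : (0:ℝ) < Fintype.card F := by exact_mod_cast Fintype.card_pos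
  have hJ' : (Fintype.card J : ℝ) * Fintype.card F = (Fintype.card F : ℝ) ^ (m+1) := by
    exact_mod_cast hJ
  set q : ℝ := (Fintype.card F : ℝ)
  have h3 := (h.trans h2).trans (mul_le_mul_of_nonneg_right hc (by positivity))
  have h4 : q ^ (m+1) * μ ^ (4 * (m+1)) ≤ q * (2 * q ^ (3 * (m + 1)) *
      (q⁻¹ ^ (8 * (m + 1) + 1) *
        (3 * (4 * ((m + 1 : ℕ) : ℝ) + 1) * q ^ (5 * (m + 1) + 4) * 4 ^ (8 * (m + 1))))) := by
    calc _ = q * (Fintype.card J * μ ^ (4 * (m+1))) := by rw [← hJ']; ring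
      _ ≤ _ := mul_le_mul_of_nonneg_left h3 hq0.le
  have e : q * (2 * q ^ (3 * (m + 1)) *
      (q⁻¹ ^ (8 * (m + 1) + 1) *
        (3 * (4 * ((m + 1 : ℕ) : ℝ) + 1) * q ^ (5 * (m + 1) + 4) * 4 ^ (8 * (m + 1))))) =
      q ^ (m+1) * (6 * (4 * (m+1) + 1) * q ^ 4 * (4 ^ 8 / q) ^ (m+1)) := by
    rw [div_pow, inv_pow, ← pow_mul]
    have : q ^ (8 * (m + 1) + 1) ≠ 0 := by positivity
    push_cast
    field_simp
    ring
  rw [e] at h4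
  exact le_of_mul_le_mul_left h4 (by positivity)

lemma eig_small (hq : 4 ^ 9 < Fintype.card F) : ∃ n₀ : ℕ, 2 ≤ n₀ ∧ ∀ n ≥ n₀, ∀ μ : ℝ,
    μ ^ (4 * n) ≤ 6 * (4 * n + 1) * (Fintype.card F : ℝ) ^ 4 *
      (4 ^ 8 / (Fintype.card F : ℝ)) ^ n → μ ^ 4 ≤ 1 / 2 := by
  have hq' : (4:ℝ) ^ 9 < (Fintype.card F : ℝ) := by exact_mod_cast hq
  set q : ℝ := (Fintype.card F : ℝ)
  have hq0 : 0 < q := lt_trans (by positivity) hq'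
  have t1 : Filter.Tendsto (fun n : ℕ => (6 * q ^ 4 * 4) * ((n : ℝ) * (1/2 : ℝ) ^ n) + (6 * q ^ 4) * (1/2 : ℝ) ^ n)
      Filter.atTop (nhds ((6 * q ^ 4 * 4) * 0 + (6 * q ^ 4) * 0)) := by
    refine Filter.Tendsto.add (Filter.Tendsto.const_mul _ ?_) (Filter.Tendsto.const_mul _ ?_)
    · have := tendsto_pow_const_mul_const_pow_of_lt_one 1 (r := (1/2 : ℝ)) (by norm_num) (by norm_num)
      simpa using this
    · exact tendsto_pow_atTop_nhds_zero_of_lt_one (by norm_num) (by norm_num)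
  have t2 := t1.eventually (gt_mem_nhds (show _ < (1:ℝ) by norm_num))
  obtain ⟨N, hN⟩ := Filter.eventually_atTop.mp t2
  refine ⟨max N 2, le_max_right _ _, fun n hn μ h => ?_⟩
  have hNn := hN n ((le_max_left _ _).trans hn)
  have hn2 : 2 ≤ n := (le_max_right _ _).trans hn
  have h4 : (4 ^ 8 / q) ^ n ≤ (1/4 : ℝ) ^ n := by
    refine pow_le_pow_left₀ (by positivity) ?_ _
    rw [div_le_iff₀ hq0]; linarith [hq']
  have h5 : (1/4 : ℝ) ^ n = (1/2) ^ n * (1/2) ^ n := by rw [← mul_pow]; norm_num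
  have h6 : (μ ^ 4) ^ n ≤ (1/2 : ℝ) ^ n := by
    rw [← pow_mul]
    calc _ ≤ _ := h
      _ ≤ 6 * (4 * n + 1) * q ^ 4 * (1/4 : ℝ) ^ n := mul_le_mul_of_nonneg_left h4 (by positivity)
      _ = ((6 * q ^ 4 * 4) * ((n : ℝ) * (1/2 : ℝ) ^ n) + (6 * q ^ 4) * (1/2 : ℝ) ^ n) * (1/2) ^ n := by
        rw [h5]; ring
      _ ≤ 1 * (1/2) ^ n := mul_le_mul_of_nonneg_right hNn.le (by positivity)
      _ = _ := one_mul _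
  exact le_of_pow_le_pow_left₀ (by omega) (by norm_num) h6
end Levels

section EigStep
open Polynomial
variable {F : Type} [Field F] [Fintype F]

abbrev TT (F : Type) [Field F] [Fintype F] (n : ℕ) : Module.End ℂ (SO F n → ℂ) :=
  Lrep (redO F n) (aOf (h1X F) (h2X F))

/-- Fourier components along the upper unipotent group. -/
def vpsi {m : ℕ} (w : SO F (m+1) → ℂ) (ψ : AddChar (OO F (m+1)) ℂ) : SO F (m+1) → ℂ :=
  ∑ x, ψ (-x) • Rtr (eeM x) w

lemma Rtr_sum {S ι : Type} [Group S] (t : Finset ι) (s : S) (f : ι → S → ℂ) :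
    Rtr s (∑ i ∈ t, f i) = ∑ i ∈ t, Rtr s (f i) := by
  ext y; simp [Rtr]

lemma Rtr_vpsi {m : ℕ} (w : SO F (m+1) → ℂ) (ψ : AddChar (OO F (m+1)) ℂ) (y : OO F (m+1)) :
    Rtr (eeM y) (vpsi w ψ) = ψ y • vpsi w ψ := by
  rw [vpsi, Rtr_sum, Finset.smul_sum]
  refine Fintype.sum_equiv (Equiv.addLeft y) _ _ fun x => ?_
  rw [Rtr_smul, Rtr_Rtr, ← eeM_add, smul_smul, ← AddChar.map_add_eq_mul]
  simp

lemma T_vpsi {m : ℕ} (w : SO F (m+1) → ℂ) (ψ : AddChar (OO F (m+1)) ℂ) (μ : ℝ)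
    (hw : TT F (m+1) w = (μ : ℂ) • w) : TT F (m+1) (vpsi w ψ) = (μ : ℂ) • vpsi w ψ := by
  rw [vpsi, map_sum, Finset.smul_sum]
  refine Finset.sum_congr rfl fun x _ => ?_
  rw [map_smul, Lrep_Rtr, hw, Rtr_smul, smul_comm]

lemma sum_vpsi {m : ℕ} (w : SO F (m+1) → ℂ) :
    ∑ ψ, vpsi w ψ = (Fintype.card (OO F (m+1)) : ℂ) • w := by
  simp only [vpsi]
  rw [Finset.sum_comm]
  simp only [← Finset.sum_smul, AddChar.sum_apply_eq_ite]
  rw [Finset.sum_eq_single 0]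
  · rw [if_pos (by simp), eeM_zero]
    congr 1
    ext y; simp [Rtr]
  · intro b _ hb
    rw [if_neg (by simpa using hb), zero_smul]
  · simp

lemma exists_vpsi {m : ℕ} (w : SO F (m+1) → ℂ) (c : F)
    (h : Rtr (eeM (mkO F (m+1) (C c * X ^ m))) w ≠ w) :
    ∃ ψ, vpsi w ψ ≠ 0 ∧ ψ (mkO F (m+1) (C c * X ^ m)) ≠ 1 := by
  by_contra hcon
  push Not at hcon
  apply h
  have hc : (Fintype.card (OO F (m+1)) : ℂ) ≠ 0 := by exact_mod_cast Fintype.card_ne_zero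
  have e : w = (Fintype.card (OO F (m+1)) : ℂ)⁻¹ • ∑ ψ, vpsi w ψ := by
    rw [sum_vpsi, smul_smul, inv_mul_cancel₀ hc, one_smul]
  rw [e, Rtr_smul, Rtr_sum]
  congr 1
  refine Finset.sum_congr rfl fun ψ _ => ?_
  rw [Rtr_vpsi]
  by_cases h0 : vpsi w ψ = 0
  · rw [h0, smul_zero]
  · rw [hcon ψ h0, one_smul]

/-- Diagonal matrices. -/
def ddM {R : Type} [CommRing R] (a : Rˣ) : Matrix.SpecialLinearGroup (Fin 2) R :=
  ⟨!![(a : R), 0; 0, ((a⁻¹ : Rˣ) : R)], by simp [Matrix.det_fin_two]⟩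

lemma ee_dd {R : Type} [CommRing R] (a : Rˣ) (y : R) :
    eeM y * ddM a = ddM a * eeM (((a⁻¹ : Rˣ) : R) ^ 2 * y) := by
  apply Subtype.ext
  show (eeM y).1 * (ddM a).1 = (ddM a).1 * (eeM _).1
  rw [eeM_val, eeM_val]
  ext i j
  fin_cases i <;> fin_cases j <;> simp [ddM, Matrix.mul_apply, Fin.sum_univ_two]
  rw [pow_two, ← mul_assoc, ← mul_assoc, Units.mul_inv, one_mul, mul_comm]

lemma Rtr_ne {S : Type} [Group S] (s : S) (f : S → ℂ) (hf : f ≠ 0) : Rtr s f ≠ 0 := by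
  intro h
  apply hf
  ext y
  have := congrFun h (y * s⁻¹)
  simpa [Rtr] using this

lemma newcase (m : ℕ) (h2 : (2 : F) ≠ 0) (μ : ℝ) (w : SO F (m+1) → ℂ)
    (hw : TT F (m+1) w = (μ : ℂ) • w) (c : F) 
    (hc : Rtr (eeM (mkO F (m+1) (C c * X ^ m))) w ≠ w) :
    μ ^ (4 * (m+1)) ≤ 6 * (4 * (m+1) + 1) * (Fintype.card F : ℝ) ^ 4 *
      (4 ^ 8 / (Fintype.card F : ℝ)) ^ (m+1) := by
  obtain ⟨ψ, hψ0, hψ⟩ := exists_vpsi w c hc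
  let J := {a : OO F (m+1) // ev0 F m a = 1}
  have hJu : ∀ a : J, IsUnit a.1 := fun a => oo_unit' m _ (by rw [a.2]; exact one_ne_zero)
  let un : J → (OO F (m+1))ˣ := fun a => (hJu a).unit
  have hun : ∀ a, (un a : OO F (m+1)) = a.1 := fun a => rfl
  refine mult_bound' m μ (J := J) (fun a => Rtr (ddM (un a)) (vpsi w ψ)) (fun a => Rtr_ne _ _ hψ0)
    ?_ ?_ ?_
  · intro a b hab
    by_contra hne
    have hev : ∀ (a : J) (y : OO F (m+1)), Rtr (eeM y) (Rtr (ddM (un a)) (vpsi w ψ)) =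
        ψ ((((un a)⁻¹ : (OO F (m+1))ˣ) : OO F (m+1)) ^ 2 * y) • Rtr (ddM (un a)) (vpsi w ψ) := by
      intro a y
      rw [Rtr_Rtr, ee_dd, ← Rtr_Rtr, Rtr_vpsi, Rtr_smul]
    have key : ∀ y, ψ (((((un b)⁻¹ : (OO F (m+1))ˣ) : OO F (m+1)) ^ 2 -
        (((un a)⁻¹ : (OO F (m+1))ˣ) : OO F (m+1)) ^ 2) * y) = 1 := by
      intro y
      have e := ipF_Rtr (eeM y) (Rtr (ddM (un a)) (vpsi w ψ)) (Rtr (ddM (un b)) (vpsi w ψ))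
      rw [hev, hev, ipF_smul_left, ipF_smul_right, ← mul_assoc] at e
      have e2 := mul_right_cancel₀ hne (e.trans (one_mul _).symm)
      rw [← AddChar.map_neg_eq_conj, ← AddChar.map_add_eq_mul] at e2
      rw [← e2]; congr 1; ring
    have hr : ((((un b)⁻¹ : (OO F (m+1))ˣ) : OO F (m+1)) ^ 2 -
        (((un a)⁻¹ : (OO F (m+1))ˣ) : OO F (m+1)) ^ 2) ≠ 0 := by
      intro h0
      apply hab
      have h3 : (a.1 - b.1) * (a.1 + b.1) = 0 := by
        have ea : (((un a)⁻¹ : (OO F (m+1))ˣ) : OO F (m+1)) * a.1 = 1 := by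
          rw [← hun a]; exact Units.inv_mul _
        have eb : (((un b)⁻¹ : (OO F (m+1))ˣ) : OO F (m+1)) * b.1 = 1 := by
          rw [← hun b]; exact Units.inv_mul _
        set x := (((un a)⁻¹ : (OO F (m+1))ˣ) : OO F (m+1))
        set y := (((un b)⁻¹ : (OO F (m+1))ˣ) : OO F (m+1))
        have hxy : y ^ 2 = x ^ 2 := sub_eq_zero.mp h0
        have ea2 : x ^ 2 * a.1 ^ 2 = 1 := by rw [← mul_pow, ea, one_pow]
        have eb2 : x ^ 2 * b.1 ^ 2 = 1 := by rw [← hxy, ← mul_pow, eb, one_pow]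
        linear_combination b.1 ^ 2 * ea2 - a.1 ^ 2 * eb2
      have hu : IsUnit (a.1 + b.1) := oo_unit' m _ (by
        rw [map_add, a.2, b.2, one_add_one_eq_two]; exact h2)
      exact Subtype.ext (sub_eq_zero.mp (hu.mul_left_eq_zero.mp h3))
    obtain ⟨y, hy⟩ := oo_socle m _ hr c
    exact hψ (hy ▸ key y)
  · intro a
    have := T_vpsi w ψ μ hw
    show TT F (m+1) _ = _
    rw [Lrep_Rtr, this, Rtr_smul]
  · have h1 : ∀ x : F, Fintype.card {a : OO F (m+1) // ev0 F m a = x} = Fintype.card J := by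
      intro x
      refine Fintype.card_congr
        { toFun := fun a => ⟨a.1 + mkO F (m+1) (C (1 - x)), by rw [map_add, a.2, ev0_mk]; simp⟩
          invFun := fun a => ⟨a.1 - mkO F (m+1) (C (1 - x)), by rw [map_sub, a.2, ev0_mk]; simp⟩
          left_inv := fun a => by simp
          right_inv := fun a => by simp }
    have h3 := Fintype.card_congr (Equiv.sigmaFiberEquiv (ev0 F m))
    rw [Fintype.card_sigma, oo_card] at h3
    rw [← h3]
    simp only [h1, Finset.sum_const, Finset.card_univ, smul_eq_mul, mul_comm]

lemma ker_decomp {R : Type} [CommRing R] (x y z : R) (d : R) (g : Matrix.SpecialLinearGroup (Fin 2) R)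
    (hxx : x * x = 0) (hxy : x * y = 0) (hxz : x * z = 0) (hyz : y * z = 0) (hxd : x * d = 0) (hyd : y * d = 0) (hzd : z * d = 0)
    (h00 : g.1 0 0 = 1 - x) (h01 : g.1 0 1 = y) (h10 : g.1 1 0 = z) (h11 : g.1 1 1 = 1 + d)  :
    g = eeM (y - x) * ffM (z + x) * (ffM 1 * eeM x * (ffM 1)⁻¹) := by
  have hd := sl_det g
  rw [h00, h01, h10, h11] at hd
  have hdx : d = x := by linear_combination hd + hxd + hyz
  subst hdx
  rw [← ffM_neg]
  refine slx_ext ?_ ?_ ?_ ?_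
  · rw [h00]; simp only [slmul_val, eeM_val, ffM_val]; simp
    grind
  · rw [h01]; simp only [slmul_val, eeM_val, ffM_val]; simp
    grind
  · rw [h10]; simp only [slmul_val, eeM_val, ffM_val]; simp
    grind
  · rw [h11]; simp only [slmul_val, eeM_val, ffM_val]; simp
    grind

lemma oo_nil (m : ℕ) (hm : 1 ≤ m) (c c' : F) :
    mkO F (m+1) (C c * X ^ m) * mkO F (m+1) (C c' * X ^ m) = 0 := by
  rw [← map_mul, AdjoinRoot.mk_eq_zero, mul_mul_mul_comm, ← pow_add]
  exact Dvd.dvd.mul_left (pow_dvd_pow _ (by omega)) _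

def wwM {R : Type} [CommRing R] : Matrix.SpecialLinearGroup (Fin 2) R :=
  ⟨!![0, 1; -1, 0], by simp [Matrix.det_fin_two]⟩

lemma ww_ee {R : Type} [CommRing R] (r : R) : wwM * eeM r = ffM (-r) * wwM := by
  refine slx_ext ?_ ?_ ?_ ?_ <;>
    (simp only [slmul_val, eeM_val, ffM_val]; simp [wwM])

/-- Old eigenvalues come from the previous level. -/
lemma oldcase (m : ℕ) (hm : 1 ≤ m) (μ : ℝ)
    (hinv : ∀ w, TT F (m+1) w = (μ : ℂ) • w → ∀ c, Rtr (eeM (mkO F (m+1) (C c * X ^ m))) w = w)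
    (v : SO F (m+1) → ℂ) (hv : TT F (m+1) v = (μ : ℂ) • v) (hv0 : v ≠ 0) :
    ∃ v' : SO F m → ℂ, v' ≠ 0 ∧ TT F m v' = (μ : ℂ) • v' := by
  have hconj : ∀ (s : SO F (m+1)) (c : F),
      Rtr (s * eeM (mkO F (m+1) (C c * X ^ m)) * s⁻¹) v = v := by
    intro s c
    have h1 : TT F (m+1) (Rtr s⁻¹ v) = (μ : ℂ) • Rtr s⁻¹ v := by
      rw [Lrep_Rtr, hv, Rtr_smul]
    have h2 := congrArg (Rtr s) (hinv _ h1 c)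
    rw [Rtr_Rtr, Rtr_Rtr, Rtr_Rtr, mul_inv_cancel, mul_assoc] at h2
    rw [mul_assoc, h2]
    ext y; simp [Rtr]
  have hff : ∀ c : F, Rtr (ffM (mkO F (m+1) (C c * X ^ m))) v = v := by
    intro c
    have := hconj wwM (-c)
    rw [ww_ee, mul_inv_cancel_right, ← map_neg] at this
    simpa using this
  have hee : ∀ c : F, Rtr (eeM (mkO F (m+1) (C c * X ^ m))) v = v := hinv v hv
  have hker : ∀ g : SO F (m+1), trS F m g = 1 → Rtr g v = v := by
    intro g hg
    have hent : ∀ i j, trO F m (g.1 i j) = (1 : SO F m).1 i j := fun i j => by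
      rw [← hg]; rfl
    obtain ⟨x, hx⟩ := trO_ker m (1 - g.1 0 0) (by rw [map_sub, hent, map_one]; exact sub_self _)
    obtain ⟨y, hy⟩ := trO_ker m (g.1 0 1) (hent 0 1)
    obtain ⟨z, hz⟩ := trO_ker m (g.1 1 0) (hent 1 0)
    obtain ⟨d, hd⟩ := trO_ker m (g.1 1 1 - 1) (by rw [map_sub, hent, map_one]; exact sub_self _)
    have e := ker_decomp (mkO F (m+1) (C x * X ^ m)) (mkO F (m+1) (C y * X ^ m))
      (mkO F (m+1) (C z * X ^ m)) (mkO F (m+1) (C d * X ^ m)) g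
      (oo_nil m hm _ _) (oo_nil m hm _ _) (oo_nil m hm _ _) (oo_nil m hm _ _) (oo_nil m hm _ _)
      (oo_nil m hm _ _) (oo_nil m hm _ _) (by rw [← hx]; ring) hy hz (by rw [← hd]; ring)
    rw [e, ← Rtr_Rtr, hconj, ← Rtr_Rtr]
    rw [← map_sub, ← map_add, ← sub_mul, ← add_mul, ← C_sub, ← C_add, hff, hee]
  have hwd : ∀ g h : SO F (m+1), trS F m g = trS F m h → v g = v h := by
    intro g h hgh
    have := congrFun (hker (h⁻¹ * g) (by rw [map_mul, map_inv, hgh, inv_mul_cancel])) h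
    rw [← this, Rtr, mul_inv_cancel_left]
  let v' : SO F m → ℂ := fun s => if h : ∃ g, trS F m g = s then v h.choose else 0
  have hv'1 : ∀ g, v' (trS F m g) = v g := by
    intro g
    have h : ∃ g', trS F m g' = trS F m g := ⟨g, rfl⟩
    simp only [v']
    rw [dif_pos h]
    exact hwd _ _ h.choose_spec
  have hv'2 : ∀ s, (¬ ∃ g, trS F m g = s) → v' s = 0 := fun s h => dif_neg h
  refine ⟨v', ?_, ?_⟩
  · intro h0
    apply hv0
    ext g
    rw [← hv'1, h0]; rfl
  · ext s
    rw [Lrep_apply]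
    by_cases hs : ∃ g, trS F m g = s
    · obtain ⟨g, rfl⟩ := hs
      have := congrFun hv g
      rw [Lrep_apply] at this
      rw [Pi.smul_apply, hv'1, ← Pi.smul_apply, ← this]
      refine Finset.sum_congr rfl fun γ _ => ?_
      rw [← hv'1, map_mul, map_inv, trS_red]
    · rw [Pi.smul_apply, hv'2 s hs, smul_zero]
      refine Finset.sum_eq_zero fun γ _ => ?_
      rw [hv'2, mul_zero]
      rintro ⟨g, hg⟩
      exact hs ⟨redO F (m+1) γ * g, by rw [map_mul, hg, trS_red, mul_inv_cancel_left]⟩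

lemma eig_levels (hq : 4 ^ 9 < Fintype.card F) (h2 : (2 : F) ≠ 0) : ∃ n₀ : ℕ, 2 ≤ n₀ ∧ 
    ∀ (k : ℕ) (μ : ℝ) (v : SO F (n₀ + k) → ℂ), v ≠ 0 → TT F (n₀ + k) v = (μ : ℂ) • v →
    μ ^ 4 ≤ 1 / 2 ∨ ∃ v' : SO F n₀ → ℂ, v' ≠ 0 ∧ TT F n₀ v' = (μ : ℂ) • v' := by
  obtain ⟨n₀, hn2, hn⟩ := eig_small hq
  refine ⟨n₀, hn2, fun k => ?_⟩
  induction k with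
  | zero => intro μ v h0 hv; exact Or.inr ⟨v, h0, hv⟩
  | succ k ih =>
    intro μ v h0 hv
    by_cases hinv : ∀ w, TT F (n₀+k+1) w = (μ : ℂ) • w →
        ∀ c, Rtr (eeM (mkO F (n₀+k+1) (C c * X ^ (n₀+k)))) w = w
    · obtain ⟨v', hv'0, hv'⟩ := oldcase (n₀+k) (by omega) μ hinv v hv h0
      exact ih μ v' hv'0 hv'
    · push Not at hinv
      obtain ⟨w, hw, c, hc⟩ := hinv
      left
      refine hn (n₀+k+1) (by omega) μ ?_
      have := newcase (n₀+k) h2 μ w hw c hc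
      push_cast at this ⊢
      exact this

/-- The spectral gap for all levels. -/
theorem gap_levels (hq : 4 ^ 9 < Fintype.card F) (h2 : (2 : F) ≠ 0) : ∃ n₀ : ℕ, 2 ≤ n₀ ∧ 
    ∃ lam : ℝ, 0 ≤ lam ∧ lam < 1 ∧ ∀ (k : ℕ) (ξ : SO F (n₀ + k) → ℂ),
      (∀ v : SO F (n₀ + k) → ℂ, (∀ x, LtrHom _ (redO F (n₀ + k) (h1X F x)) v = v) →
        (∀ x, LtrHom _ (redO F (n₀ + k) (h2X F x)) v = v) → ipF v ξ = 0) →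
      n2 (TT F (n₀ + k) ξ) ≤ lam ^ 2 * n2 ξ := by
  obtain ⟨n₀, hn2, hn⟩ := eig_levels hq h2
  refine ⟨n₀, hn2, ?_⟩
  have hfin := finite_eigs (TT F n₀)
  have hfin2 : ({x : ℝ | x = 0 ∨ x ^ 4 = 1 / 2 ∧ 0 ≤ x ∨
      (∃ μ ∈ {μ : ℝ | ∃ v : SO F n₀ → ℂ, v ≠ 0 ∧ TT F n₀ v = (μ : ℂ) • v}, x = |μ|) ∧ x < 1}).Finite := by
    have h1 : ({x : ℝ | x ^ 4 = 1 / 2 ∧ 0 ≤ x}).Subsingleton := by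
      intro a ha b hb
      exact (pow_left_inj₀ ha.2 hb.2 (by norm_num)).mp (ha.1.trans hb.1.symm)
    refine Set.Finite.subset ((Set.finite_singleton (0:ℝ)).union
      (h1.finite.union (hfin.image (fun x => |x|)))) ?_
    rintro x (h | h | ⟨⟨μ, hμ, rfl⟩, -⟩)
    · exact Or.inl h
    · exact Or.inr (Or.inl h)
    · exact Or.inr (Or.inr ⟨μ, hμ, rfl⟩)
  obtain ⟨lam, hlam, hmax⟩ := Set.exists_max_image _ id hfin2 ⟨0, Or.inl rfl⟩
  have hlam0 : 0 ≤ lam := hmax 0 (Or.inl rfl)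
  refine ⟨lam, hlam0, ?_, ?_⟩
  · rcases hlam with h | h | h
    · rw [h]; norm_num
    · by_contra hc
      push Not at hc
      have := one_le_pow₀ hc (n := 4)
      linarith [h.1]
    · exact h.2
  · intro k ξ hξ
    refine norm_bound_of_eig _ (aOf_sym _ _ _) lam hlam0 ξ ?_
    intro μ v hv hμ
    by_cases hv0 : v = 0
    · simp [hv0, ipF]
    have h1 : 1 ≤ |μ| := by
      by_contra hlt
      push Not at hlt
      rcases hn k μ v hv0 hv with h | ⟨v', hv'0, hv'⟩
      · have e : ((1 / 2 : ℝ) ^ (1 / 4 : ℝ)) ^ 4 = 1 / 2 := by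
          rw [← Real.rpow_natCast, ← Real.rpow_mul (by norm_num)]; norm_num
        have h3 := hmax ((1 / 2 : ℝ) ^ (1 / 4 : ℝ)) (Or.inr (Or.inl ⟨e, by positivity⟩))
        simp only [id] at h3
        have h4 : |μ| ^ 4 ≤ ((1 / 2 : ℝ) ^ (1 / 4 : ℝ)) ^ 4 := by
          rw [e, show |μ| ^ 4 = μ ^ 4 from Even.pow_abs (by decide) μ]; exact h
        have h5 := le_of_pow_le_pow_left₀ (by norm_num) (by positivity) h4
        linarith
      · have h3 := hmax |μ| (Or.inr (Or.inr ⟨⟨μ, ⟨v', hv'0, hv'⟩, rfl⟩, hlt⟩))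
        simp only [id] at h3
        linarith
    have h4 : n2 v ≤ n2 (TT F (n₀ + k) v) := by
      rw [hv, n2_smul, Complex.norm_real, Real.norm_eq_abs]
      have := one_le_pow₀ h1 (n := 2)
      nlinarith [n2_nonneg v]
    obtain ⟨a, b⟩ := aOf_inv _ _ _ v h4
    exact hξ v a b
end EigStep

/-- The boundary of a `1`-chain on a group: `(a,b) ↦ b - a`. -/
def bdE (Γ : Type) : (Γ × Γ →₀ ℤ) →+ (Γ →₀ ℤ) :=
  Finsupp.mapDomain.addMonoidHom Prod.snd - Finsupp.mapDomain.addMonoidHom Prod.fst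

/-- Right translation of `1`-chains. -/
def shE {Γ : Type} [Group Γ] (g : Γ) : (Γ × Γ →₀ ℤ) →+ (Γ × Γ →₀ ℤ) :=
  Finsupp.mapDomain.addMonoidHom (fun p => (p.1 * g, p.2 * g))

lemma bdE_single {Γ : Type} (a b : Γ) (r : ℤ) : bdE Γ (Finsupp.single (a, b) r) =
    Finsupp.single b r - Finsupp.single a r := by
  simp [bdE, Finsupp.mapDomain_single]

lemma shE_single {Γ : Type} [Group Γ] (g a b : Γ) (r : ℤ) : shE g (Finsupp.single (a, b) r) =
    Finsupp.single (a * g, b * g) r := by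
  simp [shE, Finsupp.mapDomain_single]

lemma shE_mul {Γ : Type} [Group Γ] (g h : Γ) (x : Γ × Γ →₀ ℤ) :
    shE g (shE h x) = shE (h * g) x := by
  simp only [shE, Finsupp.mapDomain.addMonoidHom_apply, ← Finsupp.mapDomain_comp]
  congr 1
  ext p <;> simp [mul_assoc]

lemma shE_one {Γ : Type} [Group Γ] (x : Γ × Γ →₀ ℤ) : shE 1 x = x := by
  simp only [shE, Finsupp.mapDomain.addMonoidHom_apply, mul_one]
  exact Finsupp.mapDomain_id

lemma bdE_shE {Γ : Type} [Group Γ] (g : Γ) (x : Γ × Γ →₀ ℤ) :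
    bdE Γ (shE g x) = Finsupp.mapDomain (· * g) (bdE Γ x) := by
  simp only [shE, bdE, AddMonoidHom.sub_apply, Finsupp.mapDomain.addMonoidHom_apply,
    ← Finsupp.mapDomain_comp]
  have := (Finsupp.mapDomain.addMonoidHom (M := ℤ) (fun x : Γ => x * g)).map_sub
    (Finsupp.mapDomain Prod.snd x) (Finsupp.mapDomain Prod.fst x)
  simp only [Finsupp.mapDomain.addMonoidHom_apply, ← Finsupp.mapDomain_comp] at this
  rw [this]; rfl

/-- The tower of finite quotients with a spectral gap and an equivariant potential. -/
structure Tower where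
  Γ : Type
  grp : Group Γ
  cnt : Countable Γ
  Q : ℕ → Type
  grpQ : ∀ n, Group (Q n)
  finQ : ∀ n, Fintype (Q n)
  φ : ∀ n, Γ →* Q n
  φ_surj : ∀ n, Surjective (φ n)
  π : ∀ n, Q (n+1) →* Q n
  π_φ : ∀ n γ, π n (φ (n+1) γ) = φ n γ
  faithful : ∀ γ : Γ, γ ≠ 1 → ∃ n, φ n γ ≠ 1
  inf : Infinite Γ
  P : Γ → Q 0 → (Γ × Γ →₀ ℤ)
  P_bd : ∀ γ y, bdE Γ (P γ y) = Finsupp.single γ 1 - Finsupp.single 1 1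
  P_coc : ∀ γ g y, P (γ * g) y = P g y + shE g (P γ (φ 0 g * y))
  a : MonoidAlgebra ℂ Γ
  a_star : ∀ γ, a.coeff γ⁻¹ = starRingEnd ℂ (a.coeff γ)
  a_sym : ∀ n, IsSymF (Lrep (φ n) a)
  a_one : ∀ n, Lrep (φ n) a (fun _ => 1) = fun _ => 1
  a_contr : ∀ n η, n2 (Lrep (φ n) a η) ≤ n2 η
  lam : ℝ
  lam0 : 0 ≤ lam
  lam1 : lam < 1
  gap : ∀ n (η : Q n → ℂ), ∑ y, η y = 0 → n2 (Lrep (φ n) a η) ≤ lam ^ 2 * n2 η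

section Potential
variable {F Q : Type} [Group F] [Group Q]

lemma exists_equivariant (j : F →* Q) (hj : Injective j) :
    ∃ o : Q → F, ∀ h y, o (j h * y) = h * o y := by
  let s : Setoid Q := QuotientGroup.rightRel j.range
  have key : ∀ y : Q, ∃ h : F, j h * (Quotient.mk s y).out = y := by
    intro y
    have h1 : s (Quotient.mk s y).out y := Quotient.mk_out y
    obtain ⟨h, hh⟩ := QuotientGroup.rightRel_apply.mp h1
    exact ⟨h, by rw [hh]; group⟩
  choose o ho using key
  refine ⟨o, fun h y => ?_⟩
  apply hj
  have e : Quotient.mk s (j h * y) = Quotient.mk s y := by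
    apply Quotient.sound
    refine QuotientGroup.rightRel_apply.mpr ⟨h⁻¹, ?_⟩
    simp
  have h1 := ho (j h * y)
  have h2 := ho y
  rw [e] at h1
  rw [map_mul]
  apply mul_right_cancel (b := (Quotient.mk s y).out)
  rw [h1, mul_assoc, h2]

abbrev FP (F : Type) [Group F] : Type := Monoid.CoprodI (fun _ : Bool => F)

/-- twisted translation -/
def twA (φ : FP F →* Q) (g : FP F) (f : Q → (FP F × FP F →₀ ℤ)) : Q → (FP F × FP F →₀ ℤ) :=
  fun y => shE g (f (φ g * y))

lemma exists_potential (φ : FP F →* Q)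
    (hφ : ∀ b : Bool, Injective fun x : F => φ (Monoid.CoprodI.of (i := b) x)) :
    ∃ P : FP F → Q → (FP F × FP F →₀ ℤ),
      (∀ γ y, bdE _ (P γ y) = Finsupp.single γ 1 - Finsupp.single 1 1) ∧
      ∀ γ g y, P (γ * g) y = P g y + shE g (P γ (φ g * y)) := by
  have hex : ∀ b : Bool, ∃ o : Q → F, ∀ h y, o (φ (Monoid.CoprodI.of (i := b) h) * y) = h * o y :=
    fun b => exists_equivariant (φ.comp (Monoid.CoprodI.of (M := fun _ : Bool => F) (i := b))) (hφ b)
  choose o ho using hex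
  let of' : ∀ b : Bool, F →* FP F := fun b => Monoid.CoprodI.of (M := fun _ : Bool => F) (i := b)
  let c : Bool → F → Q → (FP F × FP F →₀ ℤ) := fun b h y =>
    Finsupp.single ((of' b (o b y))⁻¹, of' b h) 1 - Finsupp.single ((of' b (o b y))⁻¹, 1) 1
  have hc1 : ∀ b, c b 1 = 0 := fun b => by ext1 y; simp [c]
  have hcm : ∀ b h h' y, c b (h * h') y = c b h' y + shE (of' b h') (c b h (φ (of' b h') * y)) := by
    intro b h h' y
    simp only [c, map_sub, shE_single, of']
    rw [ho, map_mul, map_mul, mul_inv_rev, inv_mul_cancel_right, one_mul]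
    abel
  let M := FP F × (Q → (FP F × FP F →₀ ℤ))
  let Φi : ∀ b : Bool, F →* Function.End M := fun b =>
    { toFun := fun h p => (of' b h * p.1, p.2 + twA φ p.1 (c b h))
      map_one' := by
        funext p
        refine Prod.ext ?_ ?_
        · show of' b 1 * p.1 = p.1; rw [map_one, one_mul]
        · show p.2 + twA φ p.1 (c b 1) = p.2
          rw [hc1]; ext1 y; simp [twA]
      map_mul' := by
        intro h h'
        funext p
        refine Prod.ext ?_ ?_
        · show of' b (h * h') * p.1 = of' b h * (of' b h' * p.1); rw [map_mul, mul_assoc]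
        · show p.2 + twA φ p.1 (c b (h * h')) =
            p.2 + twA φ p.1 (c b h') + twA φ (of' b h' * p.1) (c b h)
          funext y
          simp only [Pi.add_apply, twA, hcm, map_add, shE_mul, map_mul, mul_assoc, add_assoc] }
  let Φ : FP F →* Function.End M := Monoid.CoprodI.lift Φi
  have hΦof : ∀ b h, Φ (of' b h) = Φi b h := fun b h => Monoid.CoprodI.lift_of Φi h
  have key : ∀ γ : FP F, ∀ p : M, Φ γ p = (γ * p.1, p.2 + twA φ p.1 ((Φ γ (1, 0)).2)) := by
    intro γ
    induction γ using Monoid.CoprodI.induction_on with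
    | one =>
      intro p
      rw [map_one]
      refine Prod.ext (one_mul _).symm ?_
      show p.2 = p.2 + twA φ p.1 0
      funext y; simp [twA]
    | of b h =>
      intro p
      have := hΦof b h
      simp only [of'] at this
      rw [this]
      refine Prod.ext rfl ?_
      show p.2 + twA φ p.1 (c b h) = p.2 + twA φ p.1 (0 + twA φ 1 (c b h))
      congr 2
      funext y
      simp [twA, shE_one]
    | mul x y hx hy =>
      intro p
      rw [map_mul]
      show Φ x (Φ y p) = (_, _ + twA φ p.1 (Φ x (Φ y (1, 0))).2)
      rw [hx, hy, hx (Φ y (1, 0)), hy (1, 0)]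
      refine Prod.ext (mul_assoc _ _ _).symm ?_
      funext z
      simp only [Pi.add_apply, twA, map_add, shE_mul, map_mul, mul_assoc, add_assoc, mul_one, map_one, shE_one,
        one_mul, Pi.zero_apply, map_zero, zero_add]
  let P : FP F → Q → (FP F × FP F →₀ ℤ) := fun γ => (Φ γ (1, 0)).2
  have hcoc : ∀ γ g y, P (γ * g) y = P g y + shE g (P γ (φ g * y)) := by
    intro γ g y
    show (Φ (γ * g) (1, 0)).2 y = _
    rw [map_mul]
    show (Φ γ (Φ g (1, 0))).2 y = _
    rw [key γ (Φ g (1, 0))]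
    have : (Φ g (1, 0)).1 = g := by rw [key g]; simp
    simp only [Pi.add_apply, twA, this]
    rfl
  refine ⟨P, ?_, hcoc⟩
  intro γ
  induction γ using Monoid.CoprodI.induction_on with
  | one =>
    intro y
    show bdE _ ((Φ 1 (1, 0)).2 y) = _
    rw [map_one, sub_self]
    exact map_zero _
  | of b h =>
    intro y
    show bdE _ ((Φ (of' b h) (1, 0)).2 y) = _
    rw [hΦof]
    show bdE _ ((0 + twA φ 1 (c b h)) y) = _
    rw [zero_add]
    simp only [twA, shE_one, c, map_sub, bdE_single, of']
    abel
  | mul x y hx hy =>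
    intro z
    rw [hcoc, map_add, hy, bdE_shE, hx]
    have := (Finsupp.mapDomain.addMonoidHom (M := ℤ) (fun u : FP F => u * y)).map_sub
      (Finsupp.single x 1) (Finsupp.single 1 1)
    simp only [Finsupp.mapDomain.addMonoidHom_apply, Finsupp.mapDomain_single, one_mul] at this
    rw [this]; abel
end Potential

section MkTower
open Polynomial
variable {F : Type} [Field F] [Fintype F]

lemma aOf_star {H H' Γ : Type} [Group H] [Group H'] [Group Γ] [Fintype H] [Fintype H']
    (h : H →* Γ) (h' : H' →* Γ) (γ : Γ) :
    (aOf h h').coeff γ⁻¹ = starRingEnd ℂ ((aOf h h').coeff γ) := by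
  have key : ∀ γ : Γ, (aOf h h').coeff γ =
      ((Fintype.card H : ℂ)⁻¹ * (Fintype.card H' : ℂ)⁻¹ * (Fintype.card H : ℂ)⁻¹) *
        ∑ x : H, ∑ y : H', ∑ z : H, if h x * h' y * h z = γ then (1:ℂ) else 0 := by
    intro γ
    have e : aOf h h' = ((Fintype.card H : ℂ)⁻¹ * (Fintype.card H' : ℂ)⁻¹ * (Fintype.card H : ℂ)⁻¹) •
        ∑ x : H, ∑ y : H', ∑ z : H, MonoidAlgebra.single (h x * h' y * h z) (1:ℂ) := by
      simp only [aOf, avg, smul_mul_smul_comm, Finset.sum_mul]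
      congr 1
      refine Finset.sum_congr rfl fun x _ => ?_
      simp only [Finset.mul_sum, Finset.sum_mul, MonoidAlgebra.single_mul_single, mul_one]
      exact Finset.sum_comm
    rw [e]
    simp only [MonoidAlgebra.coeff_smul, MonoidAlgebra.coeff_sum, Finsupp.coe_smul, Pi.smul_apply,
      Finsupp.coe_finsetSum, Finset.sum_apply, MonoidAlgebra.coeff_single, Finsupp.single_apply, smul_eq_mul]
  rw [key, key]
  simp only [map_mul, map_inv₀, map_natCast, map_sum, apply_ite (starRingEnd ℂ), map_one, map_zero]
  congr 1
  rw [← Equiv.sum_comp (Equiv.inv H)]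
  have : ∀ x : H, ∀ y : H', ∀ z : H, (h x⁻¹ * h' y⁻¹ * h z⁻¹ = γ⁻¹) ↔ (h z * h' y * h x = γ) := by
    intro x y z
    rw [← inv_inj]
    simp [mul_assoc]
  calc _ = ∑ x : H, ∑ y : H', ∑ z : H, if h x⁻¹ * h' y⁻¹ * h z⁻¹ = γ⁻¹ then (1:ℂ) else 0 := by
        refine Finset.sum_congr rfl fun x _ => ?_
        rw [← Equiv.sum_comp (Equiv.inv H')]
        refine Finset.sum_congr rfl fun y _ => ?_
        rw [← Equiv.sum_comp (Equiv.inv H)]; rfl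
    _ = _ := by
        simp only [this]
        rw [Finset.sum_comm]
        rw [Finset.sum_comm (s := (Finset.univ : Finset H)) (t := (Finset.univ : Finset H'))]
        refine Finset.sum_congr rfl fun y _ => ?_
        exact Finset.sum_comm

lemma aOf_one {H H' Γ S : Type} [Group H] [Group H'] [Group Γ] [Group S] [Fintype H] [Fintype H']
    (φ : Γ →* S) (h : H →* Γ) (h' : H' →* Γ) :
    Lrep φ (aOf h h') (fun _ => 1) = fun _ => 1 := by
  have k : ∀ {H : Type} [Group H] [Fintype H] (h : H →* Γ),
      Lrep φ (avg h) (fun _ => 1) = fun _ => 1 := by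
    intro H _ _ h
    rw [Lrep_avg]
    ext y
    simp [LtrHom_apply]
  simp only [aOf, map_mul, Module.End.mul_apply, k]

abbrev GG (F : Type) [Field F] : Type := FP (Multiplicative F)

def ofG (b : Bool) : Multiplicative F →* GG F :=
  Monoid.CoprodI.of (M := fun _ : Bool => Multiplicative F) (i := b)

def hbX (F : Type) [Field F] (b : Bool) : Multiplicative F →* SLX F := if b then h1X F else h2X F

def iotaG (F : Type) [Field F] : GG F →* SLX F := Monoid.CoprodI.lift (hbX F)

lemma iotaG_of (b : Bool) (x : Multiplicative F) : iotaG F (ofG b x) = hbX F b x :=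
  Monoid.CoprodI.lift_of _ _

lemma h1X_mul (c : Multiplicative F) (g : SLX F) (j : Fin 2) :
    (h1X F c * g).1 0 j = g.1 0 j + C c.toAdd * g.1 1 j ∧ (h1X F c * g).1 1 j = g.1 1 j := by
  have : (h1X F c * g).1 = !![1, C c.toAdd; 0, 1] * g.1 := rfl
  rw [this]
  constructor <;> simp [Matrix.mul_apply, Fin.sum_univ_two]

lemma h2X_mul (c : Multiplicative F) (g : SLX F) (j : Fin 2) :
    (h2X F c * g).1 0 j = g.1 0 j ∧ (h2X F c * g).1 1 j = g.1 1 j + C c.toAdd * X * g.1 0 j := by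
  have : (h2X F c * g).1 = !![1, 0; C c.toAdd * X, 1] * g.1 := rfl
  rw [this]
  constructor <;> simp [Matrix.mul_apply, Fin.sum_univ_two, add_comm]

lemma iotaG_inj (hF : 3 ≤ Fintype.card F) : Injective (iotaG F) := by
  let Xs : Bool → Set (SLX F) := fun b => if b then {g | (g.1 1 0).degree ≤ (g.1 0 0).degree}
    else {g | (g.1 0 0).degree < (g.1 1 0).degree}
  refine Monoid.CoprodI.lift_injective_of_ping_pong (α := SLX F) (hbX F) (Or.inr ⟨true, ?_⟩) Xs ?_ ?_ ?_
  · rw [Cardinal.mk_fintype]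
    have : Fintype.card (Multiplicative F) = Fintype.card F := Fintype.card_congr Multiplicative.toAdd
    rw [this]; exact_mod_cast hF
  · rintro (_|_)
    · exact ⟨h2X F (Multiplicative.ofAdd 1), by
        have h := h2X_mul (Multiplicative.ofAdd (1:F)) 1 0
        rw [mul_one] at h
        have h3 : ((h2X F (Multiplicative.ofAdd (1:F))).1 0 0).degree < ((h2X F (Multiplicative.ofAdd (1:F))).1 1 0).degree := by
          rw [h.1, h.2]; simp
        exact h3⟩
    · exact ⟨1, by simp [Xs]⟩
  · rintro (_|_) (_|_) h
    · exact absurd rfl h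
    · simp only [Xs, Function.onFun]; rw [Set.disjoint_left]; intro g h1 h2
      simp at h1 h2; exact absurd h1 (not_lt.2 h2)
    · simp only [Xs, Function.onFun]; rw [Set.disjoint_left]; intro g h1 h2
      simp at h1 h2; exact absurd h2 (not_lt.2 h1)
    · exact absurd rfl h
  · rintro (_|_) (_|_) h x hx
    · exact absurd rfl h
    · rintro _ ⟨g, hg, rfl⟩
      have hx' : x.toAdd ≠ 0 := fun h0 => hx h0
      simp only [Xs, if_true, Set.mem_ofPred_eq] at hg
      show h2X F x * g ∈ {g : SLX F | (g.1 0 0).degree < (g.1 1 0).degree}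
      rw [Set.mem_ofPred_eq, (h2X_mul x g 0).1, (h2X_mul x g 0).2]
      have h00 : g.1 0 0 ≠ 0 := by
        intro h0
        rw [h0, degree_zero, le_bot_iff, degree_eq_bot] at hg
        have := g.2
        rw [Matrix.det_fin_two, h0, hg] at this
        simp at this
      have hd : (C x.toAdd * X * g.1 0 0).degree = 1 + (g.1 0 0).degree := by
        rw [degree_mul, degree_mul, degree_C hx', degree_X, zero_add]
      have hlt : (g.1 0 0).degree < 1 + (g.1 0 0).degree := by
        rw [degree_eq_natDegree h00]
        exact_mod_cast (by omega : (g.1 0 0).natDegree < 1 + (g.1 0 0).natDegree)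
      rw [degree_add_eq_right_of_degree_lt, hd]
      · exact hlt
      · rw [hd]; exact lt_of_le_of_lt hg hlt
    · rintro _ ⟨g, hg, rfl⟩
      have hx' : x.toAdd ≠ 0 := fun h0 => hx h0
      simp only [Xs, Set.mem_ofPred_eq, Bool.false_eq_true, if_false] at hg
      show h1X F x * g ∈ {g : SLX F | (g.1 1 0).degree ≤ (g.1 0 0).degree}
      rw [Set.mem_ofPred_eq, (h1X_mul x g 0).1, (h1X_mul x g 0).2]
      have hd : (C x.toAdd * g.1 1 0).degree = (g.1 1 0).degree := by
        rw [degree_mul, degree_C hx', zero_add]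
      rw [degree_add_eq_right_of_degree_lt, hd]
      rw [hd]; exact hg
    · exact absurd rfl h

instance polyCountable : Countable F[X] := by
  have h : Injective fun p : F[X] => p.toFinsupp.coeff := by
    intro p q h
    ext n
    exact DFunLike.congr_fun h n
  exact h.countable

lemma GG_countable (hF : 3 ≤ Fintype.card F) : Countable (GG F) := by
  have : Countable (Matrix (Fin 2) (Fin 2) F[X]) := by unfold Matrix; infer_instance
  have : Countable (SLX F) := Subtype.countable
  exact (iotaG_inj hF).countable

lemma GG_infinite : Infinite (GG F) := by
  let s : GG F := ofG true (Multiplicative.ofAdd 1) * ofG false (Multiplicative.ofAdd 1)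
  have hs : ∀ g : SLX F, (iotaG F s * g).1 0 0 = X * g.1 0 0 + (g.1 0 0 + g.1 1 0) ∧
      (iotaG F s * g).1 1 0 = X * g.1 0 0 + g.1 1 0 := by
    intro g
    simp only [s, map_mul, iotaG_of, hbX, if_true, Bool.false_eq_true, if_false]
    rw [mul_assoc, (h1X_mul _ _ 0).1, (h1X_mul _ _ 0).2, (h2X_mul _ _ 0).1, (h2X_mul _ _ 0).2]
    simp only [toAdd_ofAdd, map_one]
    constructor <;> ring
  have key : ∀ k : ℕ, ((iotaG F (s ^ k)).1 0 0).degree = k ∧ ((iotaG F (s ^ k)).1 1 0).degree ≤ k := by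
    intro k
    induction k with
    | zero => simp
    | succ k ih =>
      rw [pow_succ', map_mul, (hs _).1, (hs _).2]
      have e : (X * (iotaG F (s ^ k)).1 0 0).degree = ((k + 1 : ℕ) : WithBot ℕ) := by
        rw [degree_mul, ih.1, degree_X, add_comm]; rfl
      have hlt : ((k:ℕ) : WithBot ℕ) < ((k + 1 : ℕ) : WithBot ℕ) := by exact_mod_cast Nat.lt_succ_self k
      constructor
      · rw [degree_add_eq_left_of_degree_lt, e]
        rw [e]
        refine lt_of_le_of_lt (degree_add_le _ _) (lt_of_le_of_lt (max_le ih.1.le ih.2) hlt)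
      · refine (degree_add_le _ _).trans (max_le e.le (ih.2.trans hlt.le))
  refine Infinite.of_injective (fun k : ℕ => s ^ k) fun a b hab => ?_
  have h1 := (key a).1
  have hab' : s ^ a = s ^ b := hab
  rw [hab', (key b).1] at h1
  exact_mod_cast h1.symm

lemma iotaG_faithful (hF : 3 ≤ Fintype.card F) (n₀ : ℕ) (γ : GG F) (h : γ ≠ 1) :
    ∃ n, redO F (n₀ + n) (iotaG F γ) ≠ 1 := by
  by_contra! hn
  apply h
  apply iotaG_inj hF
  rw [map_one]
  have hz : ∀ p : F[X], (∀ n, X ^ (n₀ + n) ∣ p) → p = 0 := by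
    intro p hp
    by_contra h0
    have := natDegree_le_of_dvd (hp (p.natDegree + 1)) h0
    rw [natDegree_X_pow] at this
    omega
  have k := fun n => (redO_eq_one (n₀ + n) (iotaG F γ)).1 (hn n)
  have a := sub_eq_zero.1 (hz _ fun n => (k n).1)
  have b := sub_eq_zero.1 (hz _ fun n => (k n).2.1)
  have c := hz _ fun n => (k n).2.2.1
  have d := hz _ fun n => (k n).2.2.2
  apply Subtype.ext
  ext i j : 2
  fin_cases i <;> fin_cases j <;> simp [a, b, c, d]

lemma redO_of_inj (n : ℕ) (hn : 2 ≤ n) (b : Bool) (x : Multiplicative F)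
    (h : redO F n (hbX F b x) = 1) : x = 1 := by
  have k := (redO_eq_one n _).1 h
  have hd : ∀ c : F, (X ^ n ∣ C c ∨ X ^ n ∣ C c * X) → c = 0 := by
    intro c hc
    by_contra h0
    rcases hc with hc | hc
    · have := natDegree_le_of_dvd hc (by simpa using h0)
      rw [natDegree_X_pow, natDegree_C] at this; omega
    · have := natDegree_le_of_dvd hc (by simp [h0])
      rw [natDegree_X_pow, natDegree_C_mul_X _ h0] at this; omega
  apply Multiplicative.toAdd.injective
  cases b
  · exact hd x.toAdd (Or.inr k.2.2.2)
  · exact hd x.toAdd (Or.inl k.2.2.1)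


lemma lrep_range {Γ S : Type} [Group Γ] [Group S] (ψ : Γ →* S) (c : MonoidAlgebra ℂ Γ)
    (η : ψ.range → ℂ) (y : S) :
    Lrep ψ c (fun s => if h : s ∈ ψ.range then η ⟨s, h⟩ else 0) y =
      if h : y ∈ ψ.range then Lrep ψ.rangeRestrict c η ⟨y, h⟩ else 0 := by
  rw [Lrep_apply]
  split_ifs with h
  · rw [Lrep_apply]
    refine Finset.sum_congr rfl fun γ _ => ?_
    have : (ψ γ)⁻¹ * y ∈ ψ.range := mul_mem (inv_mem ⟨γ, rfl⟩) h
    rw [dif_pos this]; rfl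
  · refine Finset.sum_eq_zero fun γ _ => ?_
    have : ¬ (ψ γ)⁻¹ * y ∈ ψ.range := fun h' => h (by
      have := mul_mem (⟨γ, rfl⟩ : ψ γ ∈ ψ.range) h'
      simpa using this)
    rw [dif_neg this, mul_zero]

lemma sum_ext_sub {S M : Type} [Group S] [Fintype S] [AddCommMonoid M] (H : Subgroup S) [Fintype H]
    (η : H → M) : ∑ s, (if h : s ∈ H then η ⟨s, h⟩ else 0) = ∑ s, η s := by
  have : ∀ s : S, (if h : s ∈ H then η ⟨s, h⟩ else 0) = ∑ x : H, if x.1 = s then η x else 0 := by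
    intro s
    split_ifs with h
    · rw [Finset.sum_eq_single ⟨s, h⟩]
      · simp
      · intro x _ hx; rw [if_neg fun h' => hx (Subtype.ext h')]
      · simp
    · symm; refine Finset.sum_eq_zero fun x _ => if_neg ?_; rintro rfl; exact h x.2
  simp only [this]
  rw [Finset.sum_comm]
  simp

lemma n2_ext {S : Type} [Group S] [Fintype S] (H : Subgroup S) [Fintype H] (η : H → ℂ) :
    n2 (fun s => if h : s ∈ H then η ⟨s, h⟩ else 0) = n2 η := by
  unfold n2
  have : ∀ s : S, ‖(if h : s ∈ H then η ⟨s, h⟩ else 0 : ℂ)‖ ^ 2 =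
      if h : s ∈ H then ‖η ⟨s, h⟩‖ ^ 2 else 0 := by intro s; split_ifs <;> simp
  simp only [this]
  exact sum_ext_sub H fun x => ‖η x‖ ^ 2

theorem exists_tower_aux (hq : 4 ^ 9 < Fintype.card F) (h2 : (2:F) ≠ 0) : Nonempty Tower := by
  have hF : 3 ≤ Fintype.card F := by
    have : (4:ℕ) ^ 9 = 262144 := by norm_num
    omega
  obtain ⟨n₀, hn₀, lam, lam0, lam1, hgap⟩ := gap_levels hq h2
  let ψ : ∀ n, GG F →* SO F (n₀ + n) := fun n => (redO F (n₀ + n)).comp (iotaG F)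
  let φ : ∀ n, GG F →* (ψ n).range := fun n => (ψ n).rangeRestrict
  have hπ : ∀ n, ∀ x ∈ (ψ (n+1)).range, trS F (n₀ + n) x ∈ (ψ n).range := by
    rintro n _ ⟨γ, rfl⟩
    exact ⟨γ, (trS_red (n₀ + n) (iotaG F γ)).symm⟩
  let π : ∀ n, (ψ (n+1)).range →* (ψ n).range := fun n =>
    ((trS F (n₀ + n)).comp (ψ (n+1)).range.subtype).codRestrict _ (fun x => hπ n x.1 x.2)
  obtain ⟨P, hP1, hP2⟩ := exists_potential (F := Multiplicative F) (φ 0) (by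
    intro b
    let f : Multiplicative F →* (ψ 0).range := (φ 0).comp (ofG b)
    refine (injective_iff_map_eq_one f).2 fun x hx => ?_
    have h1 : redO F (n₀ + 0) (iotaG F (ofG b x)) = 1 := congrArg Subtype.val hx
    rw [iotaG_of] at h1
    exact redO_of_inj _ (by omega) b x h1)
  have e1 : (iotaG F).comp (ofG true) = h1X F := by
    refine MonoidHom.ext fun x => ?_; exact iotaG_of true x
  have e2 : (iotaG F).comp (ofG false) = h2X F := by
    refine MonoidHom.ext fun x => ?_; exact iotaG_of false x
  refine ⟨{ Γ := GG F, grp := inferInstance, cnt := GG_countable hF, Q := fun n => (ψ n).range,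
            grpQ := fun n => inferInstance, finQ := fun n => Fintype.ofFinite _, φ := φ,
            φ_surj := fun n => (ψ n).rangeRestrict_surjective, π := π,
            π_φ := fun n γ => Subtype.ext (trS_red (n₀ + n) (iotaG F γ)),
            faithful := ?_, inf := GG_infinite, P := P, P_bd := hP1, P_coc := hP2,
            a := aOf (ofG true) (ofG false), a_star := aOf_star _ _,
            a_sym := fun n => by
              let _ : Fintype (ψ n).range := Fintype.ofFinite _
              exact aOf_sym _ _ _
            a_one := fun n => aOf_one _ _ _,
            a_contr := fun n η => by
              let _ : Fintype (ψ n).range := Fintype.ofFinite _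
              exact aOf_contr _ _ _ _,
            lam := lam, lam0 := lam0, lam1 := lam1, gap := ?_ }⟩
  · intro γ hγ
    obtain ⟨n, hn⟩ := iotaG_faithful hF n₀ γ hγ
    exact ⟨n, fun h => hn (congrArg Subtype.val h)⟩
  · intro n η hη
    let _ : Fintype (ψ n).range := Fintype.ofFinite _
    let ξ : SO F (n₀ + n) → ℂ := fun s => if h : s ∈ (ψ n).range then η ⟨s, h⟩ else 0
    have hξ := hgap n ξ ?_
    · have a1 : n2 ξ = n2 η := n2_ext _ η
      have a2 : TT F (n₀ + n) ξ = fun s => if h : s ∈ (ψ n).range then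
          Lrep (φ n) (aOf (ofG true) (ofG false)) η ⟨s, h⟩ else 0 := by
        have : TT F (n₀ + n) = Lrep (ψ n) (aOf (ofG true) (ofG false)) := by
          rw [TT, ← e1, ← e2]
          exact (aOf_comp _ _ _ _).symm
        rw [this]
        funext y
        exact lrep_range _ _ _ _
      rw [a1, a2, n2_ext] at hξ
      exact hξ
    · intro v hv1 hv2
      have inv : ∀ γ : GG F, ∀ y, v (ψ n γ * y) = v y := by
        intro γ
        induction γ using Monoid.CoprodI.induction_on with
        | one => intro y; rw [map_one, one_mul]
        | of b x =>
          intro y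
          have h3 : LtrHom _ (ψ n (ofG b x)) v = v := by
            show LtrHom _ (redO F (n₀ + n) (iotaG F (ofG b x))) v = v
            rw [iotaG_of]
            cases b
            · exact hv2 x
            · exact hv1 x
          have := congrFun h3 (ψ n (ofG b x) * y)
          rw [LtrHom_apply, inv_mul_cancel_left] at this
          exact this.symm
        | mul x y hx hy =>
          intro z
          rw [map_mul, mul_assoc, hx, hy]
      have : ∀ s, starRingEnd ℂ (v s) * ξ s = starRingEnd ℂ (v 1) * (if h : s ∈ (ψ n).range then η ⟨s, h⟩ else 0) := by
        intro s
        simp only [ξ]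
        split_ifs with h
        · obtain ⟨γ, rfl⟩ := h
          have := inv γ 1
          rw [mul_one] at this
          rw [this]
        · simp
      show ∑ s, _ = _
      simp only [this]
      rw [← Finset.mul_sum, sum_ext_sub, hη, mul_zero]
end MkTower

theorem exists_tower : Nonempty Tower := by
  have : Fact (Nat.Prime 262147) := ⟨by norm_num⟩
  refine exists_tower_aux (F := ZMod 262147) (by rw [ZMod.card]; norm_num) ?_
  intro h
  have : ((2:ℕ) : ZMod 262147) = 0 := by exact_mod_cast h
  rw [ZMod.natCast_eq_zero_iff] at this
  exact absurd (Nat.le_of_dvd (by norm_num) this) (by norm_num)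

/-- Fixed point sets of group elements are open. -/
class OpenFix (Γ X : Type) [Group Γ] [TopologicalSpace X] [MulAction Γ X] : Prop where
  op : ∀ γ : Γ, IsOpen {x : X | γ • x = x}

/-- The orbit equivalence relation of an action. -/
def OG (Γ X : Type) [Group Γ] [MulAction Γ X] : Type := {p : X × X // ∃ γ : Γ, p.1 = γ • p.2}

namespace OG
section Basic
variable {Γ X : Type} [Group Γ] [MulAction Γ X]

def arr (γ : Γ) (x : X) : OG Γ X := ⟨(γ • x, x), γ, rfl⟩
def src (g : OG Γ X) : X := g.1.2
def rng (g : OG Γ X) : X := g.1.1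

@[simp] lemma src_arr (γ : Γ) (x : X) : src (arr γ x) = x := rfl
@[simp] lemma rng_arr (γ : Γ) (x : X) : rng (arr γ x) = γ • x := rfl

lemma ext' {g h : OG Γ X} (h1 : rng g = rng h) (h2 : src g = src h) : g = h :=
  Subtype.ext (Prod.ext h1 h2)

lemma exists_arr (g : OG Γ X) : ∃ γ : Γ, g = arr γ (src g) := by
  obtain ⟨γ, h⟩ := g.2
  exact ⟨γ, ext' h rfl⟩

lemma arr_eq_arr {γ δ : Γ} {x y : X} : arr γ x = arr δ y ↔ x = y ∧ γ • x = δ • x := by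
  constructor
  · intro h
    have h1 : x = y := congrArg src h
    subst h1
    exact ⟨rfl, congrArg rng h⟩
  · rintro ⟨rfl, h⟩; exact ext' h rfl

lemma arr_inj (γ : Γ) : Injective (arr (X := X) γ) := fun _ _ h => (arr_eq_arr.1 h).1

def gmul (g h : OG Γ X) (e : src g = rng h) : OG Γ X :=
  ⟨(rng g, src h), by
    obtain ⟨γ, hγ⟩ := g.2
    obtain ⟨δ, hδ⟩ := h.2
    refine ⟨γ * δ, ?_⟩
    have e' : g.1.2 = h.1.1 := e
    show g.1.1 = (γ * δ) • h.1.2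
    rw [mul_smul, ← hδ, hγ, e']⟩

def ginv (g : OG Γ X) : OG Γ X := ⟨(src g, rng g), by
  obtain ⟨γ, hγ⟩ := g.2
  exact ⟨γ⁻¹, by show g.1.2 = γ⁻¹ • g.1.1; rw [hγ, inv_smul_smul]⟩⟩

variable (Γ X) in
/-- The orbit equivalence groupoid. -/
def D : GroupoidData (OG Γ X) where
  unitSpace := Set.range (arr 1)
  source g := arr 1 (src g)
  range g := arr 1 (rng g)
  mul g h := if e : src g = rng h then gmul g h e else g
  inv := ginv

@[simp] lemma D_source (g : OG Γ X) : (D Γ X).source g = arr 1 (src g) := rfl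
@[simp] lemma D_range (g : OG Γ X) : (D Γ X).range g = arr 1 (rng g) := rfl
@[simp] lemma D_unitSpace : (D Γ X).unitSpace = Set.range (arr 1) := rfl
@[simp] lemma D_inv (g : OG Γ X) : (D Γ X).inv g = ginv g := rfl
lemma D_mul (g h : OG Γ X) (e : src g = rng h) : (D Γ X).mul g h = gmul g h e := dif_pos e
@[simp] lemma src_ginv (g : OG Γ X) : src (ginv g) = rng g := rfl
@[simp] lemma rng_ginv (g : OG Γ X) : rng (ginv g) = src g := rfl
@[simp] lemma src_gmul (g h : OG Γ X) (e) : src (gmul g h e) = src h := rfl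
@[simp] lemma rng_gmul (g h : OG Γ X) (e) : rng (gmul g h e) = rng g := rfl
lemma src_mul (g h : OG Γ X) (e : src g = rng h) : src ((D Γ X).mul g h) = src h := by rw [D_mul _ _ e, src_gmul]
lemma rng_mul (g h : OG Γ X) (e : src g = rng h) : rng ((D Γ X).mul g h) = rng g := by rw [D_mul _ _ e, rng_gmul]

lemma D_comp {g h : OG Γ X} : (D Γ X).source g = (D Γ X).range h ↔ src g = rng h :=
  ⟨fun e => arr_inj _ e, fun e => congrArg (arr 1) e⟩
end Basic

section Top
variable {Γ X : Type} [Group Γ] [Countable Γ] [TopologicalSpace X] [CompactSpace X] [T2Space X]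
  [TotallyDisconnectedSpace X] [SecondCountableTopology X] [MulAction Γ X] [ContinuousConstSMul Γ X]
  [OpenFix Γ X]

instance : TopologicalSpace (OG Γ X) := ⨆ γ : Γ, TopologicalSpace.coinduced (arr γ) inferInstance

lemma isOpen_iff {U : Set (OG Γ X)} : IsOpen U ↔ ∀ γ : Γ, IsOpen (arr γ ⁻¹' U) := by
  rw [isOpen_iSup_iff]; rfl

lemma continuous_dom {Y : Type*} [TopologicalSpace Y] {f : OG Γ X → Y} :
    Continuous f ↔ ∀ γ : Γ, Continuous (fun x => f (arr γ x)) := by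
  rw [continuous_iSup_dom]
  refine forall_congr' fun γ => ?_
  rw [continuous_coinduced_dom]; rfl

lemma arr_continuous (γ : Γ) : Continuous (arr (X := X) γ) :=
  continuous_dom.1 continuous_id γ

lemma open_coin (γ δ : Γ) : IsOpen {x : X | γ • x = δ • x} := by
  have := OpenFix.op (X := X) (δ⁻¹ * γ)
  convert this using 2
  ext x; rw [mul_smul, inv_smul_eq_iff]

lemma arr_isOpenMap (γ : Γ) : IsOpenMap (arr (X := X) γ) := by
  intro V hV
  rw [isOpen_iff]
  intro δ
  have : arr δ ⁻¹' (arr γ '' V) = V ∩ {x | γ • x = δ • x} := by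
    ext x
    simp only [Set.mem_preimage, Set.mem_image, Set.mem_inter_iff, Set.mem_ofPred_eq]
    constructor
    · rintro ⟨y, hy, h⟩
      obtain ⟨rfl, h'⟩ := arr_eq_arr.1 h
      exact ⟨hy, h'⟩
    · rintro ⟨hx, h⟩; exact ⟨x, hx, arr_eq_arr.2 ⟨rfl, h⟩⟩
  rw [this]
  exact hV.inter (open_coin _ _)

lemma arr_emb (γ : Γ) : Topology.IsOpenEmbedding (arr (X := X) γ) :=
  Topology.IsOpenEmbedding.of_continuous_injective_isOpenMap (arr_continuous γ) (arr_inj γ) (arr_isOpenMap γ)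

lemma src_cont : Continuous (src (Γ := Γ) (X := X)) := continuous_dom.2 fun _ => continuous_id
lemma rng_cont : Continuous (rng (Γ := Γ) (X := X)) := continuous_dom.2 fun γ => continuous_const_smul γ

instance : T2Space (OG Γ X) :=
  T2Space.of_injective_continuous (f := fun g : OG Γ X => (rng g, src g))
    (fun _ _ e => ext' (congrArg Prod.fst e) (congrArg Prod.snd e)) (rng_cont.prodMk src_cont)

lemma range_arr_nhds (γ : Γ) (g : OG Γ X) (hg : g = arr γ (src g)) : Set.range (arr γ) ∈ nhds g :=
  (arr_emb γ).isOpen_range.mem_nhds ⟨_, hg.symm⟩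

lemma range_arr_iff (γ : Γ) (g : OG Γ X) : g ∈ Set.range (arr γ) ↔ g = arr γ (src g) :=
  ⟨by rintro ⟨x, rfl⟩; rfl, fun h => ⟨_, h.symm⟩⟩

instance : LocallyCompactSpace (OG Γ X) := by
  have : WeaklyLocallyCompactSpace (OG Γ X) := ⟨fun g => by
    obtain ⟨γ, hγ⟩ := exists_arr g
    exact ⟨_, isCompact_range (arr_continuous γ), range_arr_nhds γ g hγ⟩⟩
  infer_instance

lemma localHomeo_of (f : OG Γ X → OG Γ X) (hf : Continuous f)
    (hi : ∀ γ, InjOn f (Set.range (arr γ))) (ho : ∀ γ, IsOpenMap fun x => f (arr γ x)) : IsLocalHomeomorph f := by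
  rw [isLocalHomeomorph_iff_isOpenEmbedding_restrict]
  intro g
  obtain ⟨γ, hγ⟩ := exists_arr g
  refine ⟨_, range_arr_nhds γ g hγ, ?_⟩
  refine Topology.IsOpenEmbedding.of_continuous_injective_isOpenMap (hf.comp continuous_subtype_val)
    (injOn_iff_injective.1 (hi γ)) ?_
  intro W hW
  obtain ⟨W', hW', rfl⟩ := hW
  have : (Set.range (arr γ)).domRestrict f '' (Subtype.val ⁻¹' W') = (fun x => f (arr γ x)) '' (arr γ ⁻¹' W') := by
    ext h
    constructor
    · rintro ⟨⟨_, x, rfl⟩, hx, rfl⟩; exact ⟨x, hx, rfl⟩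
    · rintro ⟨x, hx, rfl⟩; exact ⟨⟨_, x, rfl⟩, hx, rfl⟩
  rw [this]
  exact ho γ _ (hW'.preimage (arr_continuous γ))

lemma ginv_cont : Continuous (ginv (Γ := Γ) (X := X)) := by
  rw [continuous_dom]
  intro γ
  have : (fun x : X => ginv (arr γ x)) = fun x => arr γ⁻¹ (γ • x) := by
    funext x; exact ext' (by simp) (by simp)
  rw [this]
  exact (arr_continuous _).comp (continuous_const_smul γ)

lemma mul_cont : Continuous fun p : {p : OG Γ X × OG Γ X // (D Γ X).source p.1 = (D Γ X).range p.2} =>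
      (D Γ X).mul p.1.1 p.1.2 := by
  rw [continuous_iff_continuousAt]
  rintro ⟨⟨g, h⟩, e⟩
  obtain ⟨γ, hγ⟩ := exists_arr g
  obtain ⟨δ, hδ⟩ := exists_arr h
  have h1 : ∀ᶠ p : {p : OG Γ X × OG Γ X // (D Γ X).source p.1 = (D Γ X).range p.2} in nhds ⟨(g, h), e⟩,
      p.1.1 ∈ Set.range (arr γ) :=
    (continuous_fst.comp continuous_subtype_val).continuousAt.eventually (range_arr_nhds γ g hγ)
  have h2 : ∀ᶠ p : {p : OG Γ X × OG Γ X // (D Γ X).source p.1 = (D Γ X).range p.2} in nhds ⟨(g, h), e⟩,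
      p.1.2 ∈ Set.range (arr δ) :=
    (continuous_snd.comp continuous_subtype_val).continuousAt.eventually (range_arr_nhds δ h hδ)
  have hc : Continuous fun p : {p : OG Γ X × OG Γ X // (D Γ X).source p.1 = (D Γ X).range p.2} =>
      arr (γ * δ) (src p.1.2) :=
    (arr_continuous _).comp (src_cont.comp (continuous_snd.comp continuous_subtype_val))
  refine hc.continuousAt.congr ?_
  filter_upwards [h1, h2] with p hp1 hp2
  have e' := D_comp.1 p.2
  rw [range_arr_iff] at hp1 hp2
  rw [D_mul _ _ e']
  refine ext' ?_ rfl
  rw [rng_gmul, rng_arr, hp1, rng_arr, mul_smul, e', hp2]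
  simp

theorem D_ample : (D Γ X).IsAmpleGroupoid where
  t2 := inferInstance
  locallyCompact := inferInstance
  source_mem g := ⟨_, rfl⟩
  range_mem g := ⟨_, rfl⟩
  source_unit := by rintro _ ⟨x, rfl⟩; rfl
  range_unit := by rintro _ ⟨x, rfl⟩; simp
  source_mul g h e := by simp [src_mul g h (D_comp.1 e)]
  range_mul g h e := by simp [rng_mul g h (D_comp.1 e)]
  mul_assoc g h k e e' := by
    rw [D_comp] at e e'
    have e1 : src ((D Γ X).mul g h) = rng k := by rw [src_mul g h e, e']
    have e2 : src g = rng ((D Γ X).mul h k) := by rw [rng_mul h k e', e]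
    refine ext' ?_ ?_
    · rw [rng_mul _ _ e1, rng_mul _ _ e, rng_mul _ _ e2]
    · rw [src_mul _ _ e1, src_mul _ _ e2, src_mul _ _ e']
  source_inv g := rfl
  range_inv g := rfl
  inv_mul g := by
    rw [D_mul _ _ (by rfl)]; exact ext' (by simp) (by simp)
  mul_inv g := by
    rw [D_mul _ _ (by rfl)]; exact ext' (by simp) (by simp)
  unit_mul g := by
    rw [D_mul _ _ (by rfl)]; exact ext' (by simp) (by simp)
  mul_unit g := by
    rw [D_mul _ _ (by simp)]; exact ext' (by simp) (by simp)
  continuous_inv := ginv_cont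
  continuous_mul := mul_cont
  open_unitSpace := (arr_emb 1).isOpen_range
  etale_source := by
    refine localHomeo_of _ ((arr_continuous 1).comp src_cont) ?_ fun γ => arr_isOpenMap 1
    rintro γ _ ⟨x, rfl⟩ _ ⟨y, rfl⟩ h
    have := arr_inj _ h
    simp only [src_arr] at this
    rw [this]
  etale_range := by
    refine localHomeo_of _ ((arr_continuous 1).comp rng_cont) ?_ fun γ =>
      (arr_isOpenMap 1).comp (isOpenMap_smul γ)
    rintro γ _ ⟨x, rfl⟩ _ ⟨y, rfl⟩ h
    have := arr_inj _ h
    simp only [rng_arr, smul_left_cancel_iff] at this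
    rw [this]
  ample g U hU hg := by
    obtain ⟨γ, hγ⟩ := exists_arr g
    have hx : src g ∈ arr γ ⁻¹' U := by rw [Set.mem_preimage, ← hγ]; exact hg
    obtain ⟨V, hV, hxV, hVU⟩ := compact_exists_isClopen_in_isOpen (hU.preimage (arr_continuous γ)) hx
    refine ⟨arr γ '' V, ⟨_, hxV, hγ.symm⟩, Set.image_subset_iff.2 hVU, arr_isOpenMap γ _ hV.isOpen,
      hV.isClosed.isCompact.image (arr_continuous γ), ?_, ?_⟩
    · rintro _ ⟨x, _, rfl⟩ _ ⟨y, _, rfl⟩ h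
      have := arr_inj _ h
      simp only [src_arr] at this
      rw [this]
    · rintro _ ⟨x, _, rfl⟩ _ ⟨y, _, rfl⟩ h
      have := arr_inj _ h
      simp only [rng_arr, smul_left_cancel_iff] at this
      rw [this]

instance : SecondCountableTopology (OG Γ X) := by
  have : ∀ γ : Γ, SecondCountableTopology (Set.range (arr (X := X) γ)) := fun γ =>
    (arr_emb (X := X) γ).toIsEmbedding.toHomeomorph.symm.secondCountableTopology
  refine TopologicalSpace.secondCountableTopology_of_countable_cover (ι := Γ)
    (U := fun γ => Set.range (arr γ)) (fun γ => (arr_emb γ).isOpen_range) ?_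
  · rw [Set.eq_univ_iff_forall]
    intro g
    obtain ⟨γ, hγ⟩ := exists_arr g
    exact Set.mem_iUnion.2 ⟨γ, _, hγ.symm⟩

theorem D_principal : (D Γ X).IsPrincipal := by
  intro g h
  have h' : src g = rng g := arr_inj _ h
  exact ⟨src g, ext' (by simp [h']) rfl⟩
end Top
end OG

attribute [instance] Tower.grp Tower.cnt Tower.grpQ Tower.finQ Tower.inf

namespace Tower
variable (T : Tower)

/-- The compactified coset tree. -/
def X : Type := {z : ∀ n, Option (T.Q n) // z 0 ≠ none ∧ ∀ n y, z (n+1) = some y → z n = some (T.π n y)}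

instance optTop (n : ℕ) : TopologicalSpace (Option (T.Q n)) := ⊥
instance optDisc (n : ℕ) : DiscreteTopology (Option (T.Q n)) := ⟨rfl⟩

instance : TopologicalSpace T.X := inferInstanceAs (TopologicalSpace (Subtype _))

variable {T}
/-- coordinates -/
def co (x : T.X) (n : ℕ) : Option (T.Q n) := x.1 n

lemma X_ext {x y : T.X} (h : ∀ n, co x n = co y n) : x = y := Subtype.ext (funext h)

lemma co_cont (n : ℕ) : Continuous fun x : T.X => co x n :=
  (continuous_apply n).comp continuous_subtype_val

lemma cont_into {Y : Type*} [TopologicalSpace Y] {f : Y → T.X} (h : ∀ n, Continuous fun y => co (f y) n) :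
    Continuous f := Continuous.subtype_mk (continuous_pi h) fun y => (f y).2

lemma isClosed_X : IsClosed {z : ∀ n, Option (T.Q n) | z 0 ≠ none ∧ ∀ n y, z (n+1) = some y → z n = some (T.π n y)} := by
  have : {z : ∀ n, Option (T.Q n) | z 0 ≠ none ∧ ∀ n y, z (n+1) = some y → z n = some (T.π n y)} =
      {z | z 0 ≠ none} ∩ ⋂ n, ⋂ y, {z | z (n+1) = some y → z n = some (T.π n y)} := by
    ext z; simp
  rw [this]
  refine IsClosed.inter ?_ (isClosed_iInter fun n => isClosed_iInter fun y => ?_)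
  · exact (isClosed_discrete {o : Option (T.Q 0) | o ≠ none}).preimage
      (continuous_apply (A := fun n => Option (T.Q n)) 0)
  · exact (isClosed_discrete {o : Option (T.Q (n+1)) × Option (T.Q n) | o.1 = some y → o.2 = some (T.π n y)}).preimage
      ((continuous_apply (A := fun n => Option (T.Q n)) (n+1)).prodMk
        (continuous_apply (A := fun n => Option (T.Q n)) n))

instance : CompactSpace T.X := isCompact_iff_compactSpace.1 isClosed_X.isCompact
instance : T2Space T.X := inferInstanceAs (T2Space (Subtype _))
instance : TotallyDisconnectedSpace T.X := inferInstanceAs (TotallyDisconnectedSpace (Subtype _))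
instance optSC (n : ℕ) : SecondCountableTopology (Option (T.Q n)) := by
  have : Countable (Option (T.Q n)) := inferInstance
  infer_instance
instance : SecondCountableTopology T.X := by
  have : SecondCountableTopology (∀ n, Option (T.Q n)) := inferInstance
  exact Topology.IsEmbedding.subtypeVal.secondCountableTopology

instance : MulAction T.Γ T.X where
  smul γ x := ⟨fun n => (co x n).map (T.φ n γ * ·), by
    constructor
    · simpa using (show co x 0 ≠ none from x.2.1)
    · intro n y h
      simp only [Option.map_eq_some_iff] at h ⊢
      obtain ⟨a, ha, rfl⟩ := h
      exact ⟨_, x.2.2 n a ha, by rw [map_mul, T.π_φ]⟩⟩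
  one_smul x := X_ext fun n => by
    show (co x n).map (T.φ n 1 * ·) = _
    simp
  mul_smul γ δ x := X_ext fun n => by
    show (co x n).map (T.φ n (γ * δ) * ·) = ((co x n).map (T.φ n δ * ·)).map (T.φ n γ * ·)
    rw [Option.map_map]
    congr 1
    funext y
    simp [mul_assoc]

lemma co_smul (γ : T.Γ) (x : T.X) (n : ℕ) : co (γ • x) n = (co x n).map (T.φ n γ * ·) := rfl

lemma co_smul_none (γ : T.Γ) (x : T.X) (n : ℕ) : co (γ • x) n = none ↔ co x n = none := by
  rw [co_smul]; simp

instance : ContinuousConstSMul T.Γ T.X where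
  continuous_const_smul γ := cont_into fun n =>
    (continuous_of_discreteTopology (f := fun o : Option (T.Q n) => o.map (T.φ n γ * ·))).comp (co_cont n)

lemma co_zero (x : T.X) : co x 0 ≠ none := x.2.1

lemma co_succ (x : T.X) (n : ℕ) (y : T.Q (n+1)) (h : co x (n+1) = some y) : co x n = some (T.π n y) := x.2.2 n y h

lemma co_none_mono (x : T.X) {n m : ℕ} (h : n ≤ m) (hn : co x n = none) : co x m = none := by
  induction m, h using Nat.le_induction with
  | base => exact hn
  | succ m _ ih =>
    by_contra h
    obtain ⟨y, hy⟩ := Option.ne_none_iff_exists'.1 h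
    rw [co_succ x m y hy] at ih
    exact absurd ih (by simp)

lemma phi_one_mono (γ : T.Γ) {n m : ℕ} (h : n ≤ m) (hm : T.φ m γ = 1) : T.φ n γ = 1 := by
  induction m, h using Nat.le_induction with
  | base => exact hm
  | succ m _ ih => exact ih (by rw [← T.π_φ, hm, map_one])

lemma sep_one (γ : T.Γ) (h : γ ≠ 1) : ∃ N, ∀ x : T.X, γ • x = x ↔ co x N = none := by
  have hex := T.faithful γ h
  refine ⟨Nat.find hex, fun x => ⟨fun e => ?_, fun e => X_ext fun n => ?_⟩⟩
  · by_contra hn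
    obtain ⟨y, hy⟩ := Option.ne_none_iff_exists'.1 hn
    have := congrArg (fun z => co z (Nat.find hex)) e
    simp only [co_smul, hy, Option.map_some, Option.some.injEq, mul_eq_right] at this
    exact Nat.find_spec hex this
  · rw [co_smul]
    by_cases hlt : n < Nat.find hex
    · have := Nat.find_min hex hlt
      rw [not_not] at this
      simp [this]
    · rw [co_none_mono x (not_lt.1 hlt) e]; rfl

lemma sep (γ δ : T.Γ) (h : γ ≠ δ) : ∃ N, ∀ x : T.X, γ • x = δ • x ↔ co x N = none := by
  obtain ⟨N, hN⟩ := sep_one (δ⁻¹ * γ) (fun e => h (inv_mul_eq_one.1 e).symm)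
  refine ⟨N, fun x => ?_⟩
  rw [← hN x, mul_smul, inv_smul_eq_iff]

lemma low_clopen (N : ℕ) : IsClopen {x : T.X | co x N = none} :=
  (isClopen_discrete {o : Option (T.Q N) | o = none}).preimage (co_cont N)

instance : OpenFix T.Γ T.X := ⟨fun γ => by
  by_cases h : γ = 1
  · subst h; simp
  · obtain ⟨N, hN⟩ := sep_one γ h
    simp only [hN]
    exact (low_clopen N).isOpen⟩

lemma co_det (x y : T.X) (n : ℕ) (hx : co x n ≠ none) (h : co x n = co y n) :
    ∀ i ≤ n, co x i = co y i := by
  intro i hi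
  induction n, hi using Nat.le_induction with
  | base => exact h
  | succ m _ ih =>
    obtain ⟨z, hz⟩ := Option.ne_none_iff_exists'.1 hx
    have hz' := hz
    rw [h] at hz'
    have h1 := co_succ x m z hz
    have h2 := co_succ y m z hz'
    exact ih (by rw [h1]; simp) (by rw [h1, h2])

lemma low_finite (N : ℕ) : {x : T.X | co x N = none}.Finite := by
  have : ∀ x ∈ {x : T.X | co x N = none}, ∀ y ∈ {x : T.X | co x N = none},
      (fun i : Fin N => co x i) = (fun i : Fin N => co y i) → x = y := by
    intro x hx y hy h
    refine X_ext fun n => ?_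
    by_cases hn : n < N
    · exact congrFun h ⟨n, hn⟩
    · rw [co_none_mono x (not_lt.1 hn) hx, co_none_mono y (not_lt.1 hn) hy]
  exact Set.Finite.of_finite_image (f := fun x : T.X => fun i : Fin N => co x i) (Set.toFinite _) (fun x hx y hy h => this x hx y hy h)

/-- The points of level `n`. -/
def pt (n : ℕ) (γ : T.Γ) : T.X := ⟨fun i => if i ≤ n then some (T.φ i γ) else none, by
  constructor
  · simp
  · intro i y h
    show (if i ≤ n then some (T.φ i γ) else none) = _
    change (if i + 1 ≤ n then some (T.φ (i+1) γ) else none) = _ at h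
    split_ifs at h with hi
    simp only [Option.some.injEq] at h
    rw [if_pos (by omega), ← h, T.π_φ]⟩

lemma co_pt (n : ℕ) (γ : T.Γ) (i : ℕ) : co (pt n γ) i = if i ≤ n then some (T.φ i γ) else none := rfl

lemma smul_pt (n : ℕ) (γ δ : T.Γ) : γ • pt n δ = pt n (γ * δ) := X_ext fun i => by
  rw [co_smul, co_pt, co_pt]
  split_ifs <;> simp

lemma phi_mono {γ δ : T.Γ} {n m : ℕ} (h : n ≤ m) (hm : T.φ m γ = T.φ m δ) : T.φ n γ = T.φ n δ := by
  have := phi_one_mono (δ⁻¹ * γ) h (by rw [map_mul, hm, ← map_mul, inv_mul_cancel, map_one])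
  rw [map_mul, map_inv, inv_mul_eq_one] at this
  exact this.symm

lemma pt_eq (n : ℕ) (γ δ : T.Γ) : pt n γ = pt n δ ↔ T.φ n γ = T.φ n δ := by
  constructor
  · intro h
    have := congrArg (fun z => co z n) h
    simpa [co_pt] using this
  · intro h
    refine X_ext fun i => ?_
    rw [co_pt, co_pt]
    split_ifs with hi
    · rw [phi_mono hi h]
    · rfl

/-- Level `n` points indexed by the finite quotient. -/
def ptq (n : ℕ) (y : T.Q n) : T.X := pt n (surjInv (T.φ_surj n) y)

lemma ptq_phi (n : ℕ) (γ : T.Γ) : ptq n (T.φ n γ) = pt n γ := by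
  rw [ptq, pt_eq, surjInv_eq (T.φ_surj n)]

lemma co_ptq (n : ℕ) (y : T.Q n) : co (ptq n y) n = some y := by
  rw [ptq, co_pt, if_pos le_rfl, surjInv_eq (T.φ_surj n)]

lemma smul_ptq (n : ℕ) (γ : T.Γ) (y : T.Q n) : γ • ptq n y = ptq n (T.φ n γ * y) := by
  obtain ⟨δ, rfl⟩ := T.φ_surj n y
  rw [ptq_phi, smul_pt, ← map_mul, ptq_phi]

lemma ptq_inj (n : ℕ) : Injective (ptq (T := T) n) := fun x y h => by
  have := congrArg (fun z => co z n) h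
  simpa [co_ptq] using this

lemma eq_ptq (x : T.X) (n : ℕ) (y : T.Q n) (h : co x n = some y) (h' : co x (n+1) = none) : x = ptq n y := by
  have h1 : co x n = co (ptq n y) n := by rw [h, co_ptq]
  refine X_ext fun i => ?_
  by_cases hi : i ≤ n
  · exact co_det x _ n (by rw [h]; simp) h1 i hi
  · rw [co_none_mono x (by omega : n + 1 ≤ i) h', ptq, co_pt, if_neg hi]
end Tower

section Chains
variable {Γ M : Type} [AddCommGroup M]

variable (Γ M) in
/-- Homogeneous chains with `L` labels. -/
abbrev Ch (L : ℕ) : Type := (Fin L → Γ) →₀ M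

/-- A generator. -/
abbrev sg {L : ℕ} (g : Fin L → Γ) : M →+ Ch Γ M L := Finsupp.singleAddHom g

lemma ch_hom_ext {L : ℕ} {A : Type} [AddCommGroup A] {f f' : Ch Γ M L →+ A}
    (h : ∀ g m, f (sg g m) = f' (sg g m)) (c : Ch Γ M L) : f c = f' c :=
  DFunLike.congr_fun (Finsupp.addHom_ext h : f = f') c

/-- Simplicial boundary. -/
def bdC (L : ℕ) : Ch Γ M (L + 1) →+ Ch Γ M L :=
  Finsupp.liftAddHom fun g => ∑ i : Fin (L + 1), ((-1 : ℤ) ^ (i : ℕ)) • sg (fun j => g (i.succAbove j))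

lemma bdC_sg (L : ℕ) (g : Fin (L+1) → Γ) (m : M) :
    bdC L (sg g m) = ∑ i : Fin (L + 1), ((-1 : ℤ) ^ (i : ℕ)) • sg (fun j => g (i.succAbove j)) m := by
  simp [bdC, Finsupp.liftAddHom_apply_single, AddMonoidHom.finsetSum_apply]

lemma face_zero {L : ℕ} (a : Γ) (s : Fin (L+1) → Γ) :
    (fun j => (Fin.cons a s : Fin (L+2) → Γ) ((0 : Fin (L+2)).succAbove j)) = s := by
  funext j; simp

lemma face_succ {L : ℕ} (a : Γ) (s : Fin (L+1) → Γ) (i : Fin (L+1)) :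
    (fun j => (Fin.cons a s : Fin (L+2) → Γ) (i.succ.succAbove j)) =
      (Fin.cons a (fun j => s (i.succAbove j)) : Fin (L+1) → Γ) := by
  funext j
  refine Fin.cases ?_ (fun j => ?_) j
  · simp
  · simp [Fin.succ_succAbove_succ]

lemma bdC_cons (L : ℕ) (a : Γ) (s : Fin (L+1) → Γ) (m : M) :
    bdC (L+1) (sg (Fin.cons a s) m) = sg s m -
      ∑ i : Fin (L+1), ((-1 : ℤ) ^ (i : ℕ)) • sg (Fin.cons a (fun j => s (i.succAbove j)) : Fin (L+1) → Γ) m := by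
  rw [bdC_sg, Fin.sum_univ_succ, face_zero, sub_eq_add_neg, ← Finset.sum_neg_distrib]
  congr 1
  · simp
  · refine Finset.sum_congr rfl fun i _ => ?_
    rw [face_succ, Fin.val_succ, pow_succ]
    simp

/-- Insert an edge chain in front. -/
def edge {L : ℕ} (s : Fin L → Γ) (m : M) : (Γ × Γ →₀ ℤ) →+ Ch Γ M (L+2) :=
  Finsupp.liftAddHom fun p => (AddMonoidHom.mk' (fun r : ℤ => r • sg (Fin.cons p.1 (Fin.cons p.2 s)) m)
    (fun a b => add_smul _ _ _))

lemma edge_single {L : ℕ} (s : Fin L → Γ) (m : M) (p : Γ × Γ) (r : ℤ) :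
    edge s m (Finsupp.single p r) = r • sg (Fin.cons p.1 (Fin.cons p.2 s)) m := by
  simp [edge, Finsupp.liftAddHom_apply_single]

lemma edge_add {L : ℕ} (s : Fin L → Γ) (m m' : M) (q : Γ × Γ →₀ ℤ) :
    edge s (m + m') q = edge s m q + edge s m' q := by
  induction q using Finsupp.induction_linear with
  | zero => simp
  | add a b ha hb => rw [map_add, ha, hb, map_add, map_add]; abel
  | single p r => simp only [edge_single, map_add, smul_add]

variable (R : Γ → Γ → (Γ × Γ →₀ ℤ))

/-- The contraction. -/
def ctr (L : ℕ) : Ch Γ M (L + 2) →+ Ch Γ M (L + 3) :=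
  Finsupp.liftAddHom fun g => AddMonoidHom.mk' (fun m => edge (Fin.tail g) m (R (g 0) (g 1)))
    (fun a b => edge_add _ _ _ _)

lemma ctr_sg (L : ℕ) (g : Fin (L+2) → Γ) (m : M) :
    ctr R L (sg g m) = edge (Fin.tail g) m (R (g 0) (g 1)) := by
  show Finsupp.liftAddHom _ (Finsupp.single g m) = _
  rw [Finsupp.liftAddHom_apply_single]
  rfl

/-- put one label in front -/
def vtx {L : ℕ} (s : Fin L → Γ) (m : M) : (Γ →₀ ℤ) →+ Ch Γ M (L+1) :=
  Finsupp.liftAddHom fun p => (AddMonoidHom.mk' (fun r : ℤ => r • sg (Fin.cons p s) m)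
    (fun a b => add_smul _ _ _))

lemma vtx_single {L : ℕ} (s : Fin L → Γ) (m : M) (p : Γ) (r : ℤ) :
    vtx s m (Finsupp.single p r) = r • sg (Fin.cons p s) m := by
  simp [vtx, Finsupp.liftAddHom_apply_single]

lemma bd_edge (L : ℕ) (b : Γ) (s : Fin (L+1) → Γ) (m : M) (q : Γ × Γ →₀ ℤ) :
    bdC (L+3) (edge (Fin.cons b s : Fin (L+2) → Γ) m q) =
      vtx (Fin.cons b s : Fin (L+2) → Γ) m (bdE Γ q) + edge s m q -
      ∑ i : Fin (L+1), ((-1 : ℤ) ^ (i : ℕ)) •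
        edge (Fin.cons b (fun j => s (i.succAbove j)) : Fin (L+1) → Γ) m q := by
  induction q using Finsupp.induction_linear with
  | zero => simp
  | add x y hx hy =>
    rw [map_add, map_add, hx, hy, map_add, map_add, map_add]
    simp only [map_add, smul_add, Finset.sum_add_distrib]
    abel
  | single p r =>
    obtain ⟨a, c⟩ := p
    simp only [edge_single, bdE_single, map_sub, vtx_single, map_zsmul]
    rw [bdC_cons, Fin.sum_univ_succ]
    simp only [Fin.sum_univ_succ (n := L+1)]
    have e0 : (fun j => (Fin.cons c (Fin.cons b s) : Fin (L+3) → Γ) ((0 : Fin (L+3)).succAbove j)) =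
      Fin.cons b s := face_zero _ _
    have e1 : (fun j => (Fin.cons c (Fin.cons b s) : Fin (L+3) → Γ) ((Fin.succ (0 : Fin (L+2))).succAbove j)) =
      Fin.cons c s := by rw [face_succ, face_zero]
    have e2 : ∀ i : Fin (L+1), (fun j => (Fin.cons c (Fin.cons b s) : Fin (L+3) → Γ) (i.succ.succ.succAbove j)) =
      Fin.cons c (Fin.cons b (fun j => s (i.succAbove j))) := by
      intro i; rw [face_succ, face_succ]
    rw [e0, e1]
    simp only [e2, Fin.val_zero, Fin.val_succ, pow_zero, one_smul, zero_add, pow_one, neg_smul, smul_add,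
      smul_sub, pow_succ, mul_neg, mul_one, neg_neg, smul_neg, Finset.smul_sum]
    simp only [smul_comm r]
    abel

variable {R}
lemma ctr_homotopy (hR1 : ∀ a b, bdE Γ (R a b) = Finsupp.single a 1 - Finsupp.single b 1)
    (hR2 : ∀ a b c, R a b + R b c - R a c = Finsupp.single (b, b) 1) (L : ℕ) (c : Ch Γ M (L+3)) :
    bdC (L+3) (ctr R (L+1) c) + ctr R L (bdC (L+2) c) = c := by
  refine ch_hom_ext (f := (bdC (L+3)).comp (ctr R (L+1)) + (ctr R L).comp (bdC (L+2)))
    (f' := AddMonoidHom.id _) ?_ c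
  intro g m
  obtain ⟨a, b, s, rfl⟩ : ∃ a b s, g = (Fin.cons a (Fin.cons b s : Fin (L+2) → Γ) : Fin (L+3) → Γ) :=
    ⟨g 0, g 1, Fin.tail (Fin.tail g), by
      conv_lhs => rw [← Fin.cons_self_tail g, ← Fin.cons_self_tail (Fin.tail g)]
      rfl⟩
  simp only [AddMonoidHom.add_apply, AddMonoidHom.comp_apply, AddMonoidHom.id_apply]
  rw [ctr_sg, Fin.tail_cons, bd_edge, bdC_cons, Fin.sum_univ_succ (n := L+1), face_zero]
  have h1 : (Fin.cons a (Fin.cons b s : Fin (L+2) → Γ) : Fin (L+3) → Γ) 0 = a := rfl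
  have h2 : (Fin.cons a (Fin.cons b s : Fin (L+2) → Γ) : Fin (L+3) → Γ) 1 = b := rfl
  rw [h1, h2, hR1]
  simp only [face_succ, map_sub, map_add, map_sum, map_zsmul, vtx_single, ctr_sg, one_smul]
  have t1 : Fin.tail (Fin.cons b s : Fin (L+2) → Γ) = s := Fin.tail_cons _ _
  have t2 : Fin.tail (Fin.cons a s : Fin (L+2) → Γ) = s := Fin.tail_cons _ _
  have v1 : (Fin.cons b s : Fin (L+2) → Γ) 0 = b := rfl
  have v2 : (Fin.cons b s : Fin (L+2) → Γ) 1 = s 0 := rfl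
  have v3 : (Fin.cons a s : Fin (L+2) → Γ) 0 = a := rfl
  have v4 : (Fin.cons a s : Fin (L+2) → Γ) 1 = s 0 := rfl
  have v5 : ∀ i : Fin (L+1), (Fin.cons a (Fin.cons b (fun j => s (i.succAbove j)) : Fin (L+1) → Γ) : Fin (L+2) → Γ) 0 = a :=
    fun _ => rfl
  have v6 : ∀ i : Fin (L+1), (Fin.cons a (Fin.cons b (fun j => s (i.succAbove j)) : Fin (L+1) → Γ) : Fin (L+2) → Γ) 1 = b :=
    fun _ => rfl
  have t3 : ∀ i : Fin (L+1), Fin.tail (Fin.cons a (Fin.cons b (fun j => s (i.succAbove j)) : Fin (L+1) → Γ) : Fin (L+2) → Γ) =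
    Fin.cons b (fun j => s (i.succAbove j)) := fun _ => Fin.tail_cons _ _
  rw [t1, t2, v1, v2, v3, v4]
  simp only [v5, v6, t3, Fin.val_zero, Fin.val_succ, pow_zero, one_smul, pow_succ, mul_neg, mul_one, neg_smul,
    Finset.sum_neg_distrib]
  have key := congrArg (edge s m) (hR2 a b (s 0))
  rw [map_sub, map_add, edge_single, one_smul] at key
  simp only at key
  have : sg (Fin.cons a (Fin.cons b s) : Fin (L+3) → Γ) m - sg (Fin.cons b (Fin.cons b s) : Fin (L+3) → Γ) m +
     (edge s m (R a b) + edge s m (R b (s 0)) - edge s m (R a (s 0))) = sg (Fin.cons a (Fin.cons b s) : Fin (L+3) → Γ) m := by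
    rw [key]; abel
  refine Eq.trans ?_ this
  abel
end Chains

namespace OG
section Nerve
variable {Γ X : Type} [Group Γ] [MulAction Γ X]

lemma comps_iff {n : ℕ} (v : Fin (n+1) → OG Γ X) :
    v ∈ (D Γ X).Comps (n+1) ↔ ∀ j : Fin n, src (v j.castSucc) = rng (v j.succ) := by
  constructor
  · intro h j
    exact D_comp.1 (h j.castSucc (by simp))
  · intro h j hj
    have := h ⟨j, by omega⟩
    exact D_comp.2 this

/-- The composable tuple attached to labels and a base point. -/
def eC {n : ℕ} (g : Fin (n+2) → Γ) (x : X) : Fin (n+1) → OG Γ X := fun j =>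
  arr (g j.castSucc * (g j.succ)⁻¹) (g j.succ • x)

@[simp] lemma src_eC {n : ℕ} (g : Fin (n+2) → Γ) (x : X) (j : Fin (n+1)) : src (eC g x j) = g j.succ • x := rfl
@[simp] lemma rng_eC {n : ℕ} (g : Fin (n+2) → Γ) (x : X) (j : Fin (n+1)) : rng (eC g x j) = g j.castSucc • x := by
  simp [eC, mul_smul]

lemma eC_mem {n : ℕ} (g : Fin (n+2) → Γ) (x : X) : eC g x ∈ (D Γ X).Comps (n+1) := by
  rw [comps_iff]; intro j
  rw [src_eC, rng_eC]; rfl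

/-- base point of a tuple -/
def bp {n : ℕ} (g : Fin (n+2) → Γ) (v : Fin (n+1) → OG Γ X) : X := (g (Fin.last _))⁻¹ • src (v (Fin.last n))

@[simp] lemma bp_eC {n : ℕ} (g : Fin (n+2) → Γ) (x : X) : bp g (eC g x) = x := by
  rw [bp, src_eC, Fin.succ_last, inv_smul_smul]

lemma eC_inj {n : ℕ} (g : Fin (n+2) → Γ) : Injective (eC (X := X) g) := fun x y h => by
  rw [← bp_eC g x, h, bp_eC]

lemma eC_of_arr {n : ℕ} (g : Fin (n+2) → Γ) (v : Fin (n+1) → OG Γ X) (hv : v ∈ (D Γ X).Comps (n+1))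
    (h : ∀ j, v j ∈ Set.range (arr (X := X) (g j.castSucc * (g j.succ)⁻¹))) : eC g (bp g v) = v := by
  rw [comps_iff] at hv
  have hs : ∀ j : Fin (n+1), src (v j) = g j.succ • bp g v := by
    intro j
    induction j using Fin.reverseInduction with
    | last => rw [bp, Fin.succ_last, smul_inv_smul]
    | cast j ih =>
      rw [hv j]
      obtain ⟨y, hy⟩ := h j.succ
      rw [← hy, src_arr] at ih
      rw [← hy, rng_arr, ih, mul_smul, inv_smul_smul]; rfl
  funext j
  obtain ⟨y, hy⟩ := h j
  have := hs j
  rw [← hy, src_arr] at this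
  rw [← hy, this]; rfl

lemma exists_eC {n : ℕ} (v : Fin (n+1) → OG Γ X) (hv : v ∈ (D Γ X).Comps (n+1)) :
    ∃ (g : Fin (n+2) → Γ) (x : X), eC g x = v := by
  rw [comps_iff] at hv
  have hs : ∀ j : Fin (n+1), ∃ γ : Γ, src (v j) = γ • src (v (Fin.last n)) := by
    intro j
    induction j using Fin.reverseInduction with
    | last => exact ⟨1, (one_smul _ _).symm⟩
    | cast j ih =>
      obtain ⟨γ, hγ⟩ := ih
      obtain ⟨δ, hδ⟩ := exists_arr (v j.succ)
      refine ⟨δ * γ, ?_⟩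
      rw [hv j, hδ, rng_arr, hγ, mul_smul]
  have h0 : ∃ γ : Γ, rng (v 0) = γ • src (v (Fin.last n)) := by
    obtain ⟨γ, hγ⟩ := hs 0
    obtain ⟨δ, hδ⟩ := exists_arr (v 0)
    exact ⟨δ * γ, by rw [hδ, rng_arr, hγ, mul_smul]⟩
  choose γ hγ using hs
  obtain ⟨δ, hδ⟩ := h0
  refine ⟨Fin.cons δ γ, src (v (Fin.last n)), ?_⟩
  funext j
  apply ext'
  · rw [rng_eC]
    refine Fin.cases ?_ (fun i => ?_) j
    · exact hδ.symm
    · rw [← hv i, hγ i.castSucc]; rfl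
  · rw [src_eC, Fin.cons_succ, ← hγ]

lemma dface_eC {n : ℕ} (g : Fin (n+3) → Γ) (x : X) (i : Fin (n+3)) :
    (D Γ X).dface (n+1) i (eC g x) = eC (fun j => g (i.succAbove j)) x := by
  funext j
  have hval : ∀ k : Fin (n+2), ((i.succAbove k : Fin (n+3)) : ℕ) = if (k : ℕ) < i then (k:ℕ) else k + 1 := by
    intro k
    unfold Fin.succAbove
    simp only [Fin.lt_def, Fin.val_castSucc]
    split_ifs <;> simp
  have hg : ∀ a b : Fin (n+3), (a:ℕ) = b → g a • x = g b • x := by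
    intro a b h; rw [Fin.ext h]
  unfold GroupoidData.dface
  split_ifs with h1 h2
  · apply ext'
    · rw [rng_eC, rng_eC]; apply hg; rw [hval]; simp; omega
    · rw [src_eC, src_eC]; apply hg; rw [hval]; simp; omega
  · have e : src (eC g x j.castSucc) = rng (eC g x j.succ) := by rw [src_eC, rng_eC]; rfl
    apply ext'
    · rw [rng_mul _ _ e, rng_eC, rng_eC]; apply hg; rw [hval]; simp; omega
    · rw [src_mul _ _ e, src_eC, src_eC]; apply hg; rw [hval]; simp; omega
  · apply ext'
    · rw [rng_eC, rng_eC]; apply hg; rw [hval]; simp; omega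
    · rw [src_eC, src_eC]; apply hg; rw [hval]; simp; omega

variable [TopologicalSpace X]

/-- The function on tuples represented by a generator. -/
def Tg {n : ℕ} (g : Fin (n+2) → Γ) (m : C(X, ℤ)) (v : Fin (n+1) → OG Γ X) : ℤ :=
  if eC g (bp g v) = v then m (bp g v) else 0

lemma Tg_eC {n : ℕ} (g : Fin (n+2) → Γ) (m : C(X, ℤ)) (x : X) : Tg g m (eC g x) = m x := by
  simp [Tg]

lemma Tg_zero {n : ℕ} (g : Fin (n+2) → Γ) (m : C(X, ℤ)) (v : Fin (n+1) → OG Γ X) (h : ∀ x, eC g x ≠ v) :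
    Tg g m v = 0 := by
  rw [Tg, if_neg (h _)]

lemma Tg_ne {n : ℕ} {g : Fin (n+2) → Γ} {m : C(X, ℤ)} {v : Fin (n+1) → OG Γ X} (h : Tg g m v ≠ 0) :
    ∃ x, eC g x = v := by
  by_contra hc
  push Not at hc
  exact h (Tg_zero _ _ _ hc)

variable (Γ X) in
/-- The map from label chains to functions on composable tuples. -/
def Th (n : ℕ) : Ch Γ C(X, ℤ) (n+2) →+ (↥((D Γ X).Comps (n+1)) → ℤ) :=
  Finsupp.liftAddHom fun g => AddMonoidHom.mk' (fun m v => Tg g m v.1) (fun a b => by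
    funext v
    simp only [Tg, Pi.add_apply]
    split_ifs <;> simp)

lemma Th_sg {n : ℕ} (g : Fin (n+2) → Γ) (m : C(X, ℤ)) (v : ↥((D Γ X).Comps (n+1))) :
    Th Γ X n (sg g m) v = Tg g m v.1 := by
  have h : Th Γ X n (Finsupp.single g m) = fun v : ↥((D Γ X).Comps (n+1)) => Tg g m v.1 := by
    unfold Th
    rw [Finsupp.liftAddHom_apply_single]
    rfl
  exact congrFun h v

/-- a single face on chains -/
def fcC (n : ℕ) (i : Fin (n+3)) : Ch Γ C(X, ℤ) (n+3) →+ Ch Γ C(X, ℤ) (n+2) :=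
  Finsupp.liftAddHom fun g => sg (fun j => g (i.succAbove j))

lemma fcC_sg (n : ℕ) (i : Fin (n+3)) (g : Fin (n+3) → Γ) (m : C(X, ℤ)) :
    fcC n i (sg g m) = sg (fun j => g (i.succAbove j)) m := by
  show Finsupp.liftAddHom _ (Finsupp.single g m) = _
  rw [Finsupp.liftAddHom_apply_single]

lemma bdC_eq (n : ℕ) (c : Ch Γ C(X, ℤ) (n+3)) :
    bdC (n+2) c = ∑ i : Fin (n+3), ((-1 : ℤ) ^ (i : ℕ)) • fcC n i c := by
  have := ch_hom_ext (f := bdC (n+2)) (f' := ∑ i : Fin (n+3), ((-1 : ℤ) ^ (i : ℕ)) • fcC (Γ := Γ) (X := X) n i)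
    (fun g m => by
      rw [bdC_sg, AddMonoidHom.finsetSum_apply]
      refine Finset.sum_congr rfl fun i _ => ?_
      rw [AddMonoidHom.smul_apply, fcC_sg]) c
  rw [this, AddMonoidHom.finsetSum_apply]
  rfl

lemma push_Th (n : ℕ) (i : Fin (n+3)) (y : ↥((D Γ X).Comps (n+1))) (c : Ch Γ C(X, ℤ) (n+3)) :
    ({x : ↥((D Γ X).Comps (n + 2)) | (D Γ X).dface (n + 1) i x.1 = y.1} ∩ support (Th Γ X (n+1) c)).Finite ∧
    ∑ᶠ x ∈ {x : ↥((D Γ X).Comps (n + 2)) | (D Γ X).dface (n + 1) i x.1 = y.1}, Th Γ X (n+1) c x =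
      Th Γ X n (fcC n i c) y := by
  induction c using Finsupp.induction_linear with
  | zero => simp
  | add a b ha hb =>
    constructor
    · refine (ha.1.union hb.1).subset ?_
      rw [← Set.inter_union_distrib_left, map_add]
      exact Set.inter_subset_inter_right _ (Function.support_add _ _)
    · rw [map_add, map_add, map_add, Pi.add_apply, ← ha.2, ← hb.2, ← finsum_mem_add_distrib' ha.1 hb.1]
      rfl
  | single g m =>
    have key : ∀ x : ↥((D Γ X).Comps (n + 2)), (D Γ X).dface (n + 1) i x.1 = y.1 →
        Th Γ X (n+1) (sg g m) x ≠ 0 → x = ⟨eC g (bp (fun j => g (i.succAbove j)) y.1), eC_mem _ _⟩ := by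
      intro x hx hne
      rw [Th_sg] at hne
      obtain ⟨z, hz⟩ := Tg_ne hne
      rw [← hz, dface_eC] at hx
      apply Subtype.ext
      rw [← hx, bp_eC, ← hz]
    have h1 : (fcC n i (Finsupp.single g m)) = sg (fun j => g (i.succAbove j)) m := fcC_sg n i g m
    constructor
    · refine (Set.finite_singleton (⟨eC g (bp (fun j => g (i.succAbove j)) y.1), eC_mem _ _⟩ : ↥((D Γ X).Comps (n + 2)))).subset ?_
      rintro x ⟨hx, hne⟩
      exact key x hx hne
    · rw [h1, Th_sg]
      show ∑ᶠ x ∈ {x : ↥((D Γ X).Comps (n + 2)) | (D Γ X).dface (n + 1) i x.1 = y.1}, Th Γ X (n+1) (sg g m) x = _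
      by_cases hy : eC (fun j => g (i.succAbove j)) (bp (fun j => g (i.succAbove j)) y.1) = y.1
      · have hmem : (⟨eC g (bp (fun j => g (i.succAbove j)) y.1), eC_mem _ _⟩ : ↥((D Γ X).Comps (n + 2))) ∈
          {x : ↥((D Γ X).Comps (n + 2)) | (D Γ X).dface (n + 1) i x.1 = y.1} := by
          show (D Γ X).dface (n + 1) i _ = _
          rw [dface_eC, hy]
        rw [finsum_eq_single _ _ (fun x hne => ?_), finsum_eq_if, if_pos hmem, Th_sg, Tg_eC, Tg, if_pos hy]
        rw [finsum_eq_if]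
        split_ifs with hx
        · by_contra hc
          exact hne (key x hx hc)
        · rfl
      · rw [Tg, if_neg hy]
        apply finsum_mem_eq_zero_of_forall_eq_zero
        intro x hx
        by_contra hc
        apply hy
        have h2 := key x hx hc
        have h3 : (D Γ X).dface (n + 1) i x.1 = y.1 := hx
        rw [h2, dface_eC] at h3
        exact h3

lemma mBdry_Th (n : ℕ) (c : Ch Γ C(X, ℤ) (n+3)) :
    (D Γ X).mBdry (n+1) (Th Γ X (n+1) c) = Th Γ X n (bdC (n+2) c) := by
  funext y
  show ∑ i : Fin (n + 3), (-1 : ℤ) ^ (i : ℕ) *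
        ∑ᶠ x ∈ {x : ↥((D Γ X).Comps (n + 2)) | (D Γ X).dface (n + 1) i x.1 = y.1}, Th Γ X (n+1) c x = _
  rw [bdC_eq, map_sum]
  have : (∑ i : Fin (n+3), Th Γ X n (((-1 : ℤ) ^ (i : ℕ)) • fcC n i c)) y =
     ∑ i : Fin (n+3), Th Γ X n (((-1 : ℤ) ^ (i : ℕ)) • fcC n i c) y := Finset.sum_apply _ _ _
  rw [this]
  refine Finset.sum_congr rfl fun i _ => ?_
  rw [(push_Th n i y c).2, map_zsmul]
  have h2 : (((-1 : ℤ) ^ (i : ℕ)) • Th Γ X n (fcC n i c)) y = ((-1 : ℤ) ^ (i : ℕ)) • Th Γ X n (fcC n i c) y := rfl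
  rw [h2, smul_eq_mul]

end Nerve

section NerveTop
variable {Γ X : Type} [Group Γ] [Countable Γ] [TopologicalSpace X] [CompactSpace X] [T2Space X]
  [TotallyDisconnectedSpace X] [SecondCountableTopology X] [MulAction Γ X] [ContinuousConstSMul Γ X] [OpenFix Γ X]

lemma range_arr_clopen (γ : Γ) : IsClopen (Set.range (arr (X := X) γ)) :=
  ⟨(isCompact_range (arr_continuous γ)).isClosed, (arr_emb γ).isOpen_range⟩

lemma eC_cont {n : ℕ} (g : Fin (n+2) → Γ) : Continuous (eC (X := X) g) :=
  continuous_pi fun j => (arr_continuous _).comp (continuous_const_smul _)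

lemma bp_cont {n : ℕ} (g : Fin (n+2) → Γ) : Continuous (bp (X := X) g) :=
  (continuous_const_smul _).comp (src_cont.comp (continuous_apply _))

lemma eC_clopen {n : ℕ} (g : Fin (n+2) → Γ) :
    IsClopen {v : ↥((D Γ X).Comps (n+1)) | eC g (bp g v.1) = v.1} := by
  have : {v : ↥((D Γ X).Comps (n+1)) | eC g (bp g v.1) = v.1} =
      ⋂ j : Fin (n+1), (fun v : ↥((D Γ X).Comps (n+1)) => v.1 j) ⁻¹'
        Set.range (arr (X := X) (g j.castSucc * (g j.succ)⁻¹)) := by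
    ext v
    simp only [Set.mem_iInter, Set.mem_preimage]
    constructor
    · intro h j
      have h : eC g (bp g v.1) = v.1 := h
      rw [← h]; exact ⟨_, rfl⟩
    · intro h
      exact eC_of_arr g v.1 v.2 h
  rw [this]
  apply isClopen_iInter_of_finite
  intro j
  exact (range_arr_clopen _).preimage ((continuous_apply j).comp continuous_subtype_val)

lemma Tg_cc {n : ℕ} (g : Fin (n+2) → Γ) (m : C(X, ℤ)) :
    (fun v : ↥((D Γ X).Comps (n+1)) => Tg g m v.1) ∈ ccZ ↥((D Γ X).Comps (n+1)) := by
  constructor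
  · unfold Tg
    refine Continuous.if ?_ ?_ continuous_const
    · intro v hv
      rw [(eC_clopen g).frontier_eq] at hv
      exact absurd hv (Set.notMem_empty _)
    · exact m.continuous.comp ((bp_cont g).comp continuous_subtype_val)
  · refine HasCompactSupport.intro (K := Set.range fun x : X => (⟨eC g x, eC_mem g x⟩ : ↥((D Γ X).Comps (n+1)))) ?_ ?_
    · exact isCompact_range ((eC_cont g).subtype_mk _)
    · intro v hv
      apply Tg_zero
      intro x hx
      exact hv ⟨x, Subtype.ext hx⟩

lemma Th_cc {n : ℕ} (c : Ch Γ C(X, ℤ) (n+2)) : Th Γ X n c ∈ ccZ ↥((D Γ X).Comps (n+1)) := by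
  induction c using Finsupp.induction_linear with
  | zero => rw [map_zero]; exact (ccZSub _).zero_mem
  | add a b ha hb => rw [map_add]; exact (ccZSub _).add_mem ha hb
  | single g m =>
    have : Th Γ X n (Finsupp.single g m) = fun v : ↥((D Γ X).Comps (n+1)) => Tg g m v.1 := funext fun v => Th_sg g m v
    rw [this]; exact Tg_cc g m

lemma Th_surj_aux {n : ℕ} (s : Finset (Fin (n+2) → Γ)) : ∀ f ∈ ccZ ↥((D Γ X).Comps (n+1)),
    (∀ v, f v ≠ 0 → ∃ g ∈ s, ∃ x, eC g x = v.1) → ∃ c, Th Γ X n c = f := by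
  induction s using Finset.induction_on with
  | empty =>
    intro f _ h
    refine ⟨0, ?_⟩
    rw [map_zero]; funext v
    by_contra hc
    obtain ⟨g, hg, _⟩ := h v (Ne.symm hc)
    simp at hg
  | insert g s _ ih =>
    intro f hf h
    let m : C(X, ℤ) := ⟨fun x => f ⟨eC g x, eC_mem g x⟩, hf.1.comp ((eC_cont g).subtype_mk _)⟩
    obtain ⟨c, hc⟩ := ih (f - Th Γ X n (sg g m)) ((ccZSub _).sub_mem hf (Th_cc _)) (by
      intro v hv
      rw [Pi.sub_apply, Th_sg] at hv
      by_cases hx : ∃ x, eC g x = v.1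
      · obtain ⟨x, hx⟩ := hx
        exfalso; apply hv
        rw [← hx, Tg_eC]
        show f v - f ⟨eC g x, eC_mem g x⟩ = 0
        rw [show (⟨eC g x, eC_mem g x⟩ : ↥((D Γ X).Comps (n+1))) = v from Subtype.ext hx, sub_self]
      · push Not at hx
        rw [Tg_zero _ _ _ hx, sub_zero] at hv
        obtain ⟨g', hg', x, hx'⟩ := h v hv
        rcases Finset.mem_insert.1 hg' with rfl | h'
        · exact absurd hx' (hx x)
        · exact ⟨g', h', x, hx'⟩)
    exact ⟨c + sg g m, by rw [map_add, hc, sub_add_cancel]⟩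

lemma Th_surj {n : ℕ} (f : ↥((D Γ X).Comps (n+1)) → ℤ) (hf : f ∈ ccZ ↥((D Γ X).Comps (n+1))) :
    ∃ c, Th Γ X n c = f := by
  obtain ⟨s, hs⟩ := IsCompact.elim_finite_subcover (hf.2 : IsCompact (tsupport f))
    (fun g : Fin (n+2) → Γ => {v : ↥((D Γ X).Comps (n+1)) | eC g (bp g v.1) = v.1})
    (fun g => (eC_clopen g).isOpen) (by
      intro v _
      obtain ⟨g, x, hx⟩ := exists_eC v.1 v.2
      refine Set.mem_iUnion.2 ⟨g, ?_⟩
      show eC g (bp g v.1) = v.1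
      rw [← hx, bp_eC])
  refine Th_surj_aux s f hf fun v hv => ?_
  have := hs (subset_tsupport f hv)
  simp only [Set.mem_iUnion] at this
  obtain ⟨g, hg, h⟩ := this
  exact ⟨g, hg, _, h⟩

end NerveTop
end OG

namespace OG
section NF
variable {Γ X : Type} [Group Γ] [TopologicalSpace X] [MulAction Γ X] [ContinuousConstSMul Γ X]

/-- translate a function -/
def shm (h : Γ) : C(X, ℤ) →+ C(X, ℤ) where
  toFun m := m.comp ⟨fun x => h • x, continuous_const_smul h⟩
  map_zero' := rfl
  map_add' _ _ := rfl

@[simp] lemma shm_apply (h : Γ) (m : C(X, ℤ)) (x : X) : shm h m x = m (h • x) := rfl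

lemma Tg_shift {n : ℕ} (g : Fin (n+2) → Γ) (h : Γ) (m : C(X, ℤ)) (v : Fin (n+1) → OG Γ X) :
    Tg (fun j => g j * h) (shm h m) v = Tg g m v := by
  have h1 : bp (fun j => g j * h) v = h⁻¹ • bp g v := by
    simp [bp, mul_smul]
  have h2 : eC (fun j => g j * h) (h⁻¹ • bp g v) = eC g (bp g v) := by
    funext j
    apply ext'
    · simp [mul_smul]
    · simp [mul_smul]
  rw [Tg, Tg, h1, h2, shm_apply, smul_inv_smul]

lemma Th_shift {n : ℕ} (g : Fin (n+2) → Γ) (h : Γ) (m : C(X, ℤ)) :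
    Th Γ X n (sg (fun j => g j * h) (shm h m)) = Th Γ X n (sg g m) := by
  funext v; rw [Th_sg, Th_sg, Tg_shift]

/-- normal form -/
def nf (n : ℕ) : Ch Γ C(X, ℤ) (n+1) →+ Ch Γ C(X, ℤ) (n+1) :=
  Finsupp.liftAddHom fun g => (sg (fun j => g j * (g (Fin.last _))⁻¹)).comp (shm (g (Fin.last _))⁻¹)

lemma nf_sg {n : ℕ} (g : Fin (n+1) → Γ) (m : C(X, ℤ)) :
    nf n (sg g m) = sg (fun j => g j * (g (Fin.last _))⁻¹) (shm (g (Fin.last _))⁻¹ m) := by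
  show Finsupp.liftAddHom _ (Finsupp.single g m) = _
  rw [Finsupp.liftAddHom_apply_single]; rfl

lemma Th_nf {n : ℕ} (c : Ch Γ C(X, ℤ) (n+2)) : Th Γ X n (nf _ c) = Th Γ X n c :=
  ch_hom_ext (f := (Th Γ X n).comp (nf _)) (f' := Th Γ X n) (fun g m => by
    rw [AddMonoidHom.comp_apply, nf_sg, Th_shift]) c

lemma nf_last {n : ℕ} (c : Ch Γ C(X, ℤ) (n+1)) : ∀ g, nf n c g ≠ 0 → g (Fin.last _) = 1 := by
  induction c using Finsupp.induction_linear with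
  | zero => intro g h; rw [map_zero] at h; exact absurd rfl h
  | add a b ha hb =>
    intro g h
    rw [map_add, Finsupp.add_apply] at h
    by_cases h1 : nf n a g = 0
    · refine hb g fun h2 => h ?_
      rw [h1, h2, add_zero]
    · exact ha g h1
  | single g' m =>
    intro g h
    have e : nf n (Finsupp.single g' m) = _ := nf_sg g' m
    rw [e] at h
    by_contra hc
    apply h
    show Finsupp.single _ _ g = 0
    rw [Finsupp.single_eq_of_ne]
    rintro rfl
    simp at hc

/-- multiply coefficients -/
def mulF (L : ℕ) (w : C(X, ℤ)) : Ch Γ C(X, ℤ) L →+ Ch Γ C(X, ℤ) L :=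
  Finsupp.mapRange.addMonoidHom (AddMonoidHom.mulLeft w)

lemma mulF_sg {L : ℕ} (w : C(X, ℤ)) (g : Fin L → Γ) (m : C(X, ℤ)) : mulF L w (sg g m) = sg g (w * m) := by
  simp [mulF]

lemma mulF_bdC {L : ℕ} (w : C(X, ℤ)) (c : Ch Γ C(X, ℤ) (L+1)) : bdC L (mulF _ w c) = mulF _ w (bdC L c) :=
  ch_hom_ext (f := (bdC L).comp (mulF _ w)) (f' := (mulF _ w).comp (bdC L)) (fun g m => by
    simp only [AddMonoidHom.comp_apply]
    rw [mulF_sg, bdC_sg, bdC_sg, map_sum]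
    refine Finset.sum_congr rfl fun i _ => ?_
    rw [map_zsmul, mulF_sg]) c

lemma mulF_nf {n : ℕ} (w : C(X, ℤ)) (hw : ∀ h : Γ, shm h w = w) (c : Ch Γ C(X, ℤ) (n+1)) :
    nf n (mulF _ w c) = mulF _ w (nf n c) :=
  ch_hom_ext (f := (nf n).comp (mulF _ w)) (f' := (mulF _ w).comp (nf n)) (fun g m => by
    simp only [AddMonoidHom.comp_apply]
    rw [mulF_sg, nf_sg, nf_sg, mulF_sg]
    congr 1
    conv_rhs => rw [← hw (g (Fin.last _))⁻¹]
    rfl) c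

lemma mulF_sum {L : ℕ} {ι : Type} (s : Finset ι) (w : ι → C(X, ℤ)) (c : Ch Γ C(X, ℤ) L) :
    ∑ i ∈ s, mulF L (w i) c = mulF L (∑ i ∈ s, w i) c := by
  ext g x
  simp [mulF, Finset.sum_mul]

lemma mulF_one {L : ℕ} (c : Ch Γ C(X, ℤ) L) : mulF L 1 c = c := by
  ext g x
  simp [mulF]

lemma Th_apply {n : ℕ} (c : Ch Γ C(X, ℤ) (n+2)) (v : ↥((D Γ X).Comps (n+1))) :
    Th Γ X n c v = ∑ g ∈ c.support, Tg g (c g) v.1 := by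
  have : c = ∑ g ∈ c.support, sg g (c g) := (Finsupp.sum_single c).symm
  conv_lhs => rw [this, map_sum]
  have h2 : (∑ g ∈ c.support, Th Γ X n (sg g (c g))) v = ∑ g ∈ c.support, Th Γ X n (sg g (c g)) v := Finset.sum_apply _ _ _
  rw [h2]
  exact Finset.sum_congr rfl fun g _ => Th_sg _ _ _

lemma eC_last_inj {n : ℕ} {g g' : Fin (n+2) → Γ} (h : g (Fin.last _) = 1) (h' : g' (Fin.last _) = 1) {x y : X}
    (e : eC g x = eC g' y) : x = y ∧ ∀ j, g j • x = g' j • x := by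
  have e1 : x = y := by
    have := congrArg (bp g) e
    rw [bp_eC] at this
    rw [this, bp, src_eC, Fin.succ_last, h, h']; simp
  subst e1
  refine ⟨rfl, fun j => ?_⟩
  refine Fin.lastCases ?_ (fun j => ?_) j
  · rw [h, h']
  · rw [← rng_eC, e, rng_eC]

lemma sg_coeff {n : ℕ} (c : Ch Γ C(X, ℤ) (n+2)) (hl : ∀ g, c g ≠ 0 → g (Fin.last _) = 1) (hT : Th Γ X n c = 0)
    (x : X) (hx : ∀ g g', c g ≠ 0 → c g' ≠ 0 → (∀ j, g j • x = g' j • x) → g = g')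
    (g : Fin (n+2) → Γ) : c g x = 0 := by
  by_cases hg : c g = 0
  · rw [hg]; rfl
  have h1 := congrFun hT ⟨eC g x, eC_mem g x⟩
  rw [Th_apply, Finset.sum_eq_single g] at h1
  · rw [Tg_eC] at h1; exact h1
  · intro g' hg' hne
    apply Tg_zero
    intro y hy
    have hg'' : c g' ≠ 0 := Finsupp.mem_support_iff.1 hg'
    obtain ⟨rfl, h3⟩ := eC_last_inj (hl g' hg'') (hl g hg) hy
    exact hne (hx g' g hg'' hg h3)
  · intro h
    exact absurd (Finsupp.notMem_support_iff.1 h) hg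

/-- cone -/
def cone (L : ℕ) (a : Γ) : Ch Γ C(X, ℤ) L →+ Ch Γ C(X, ℤ) (L+1) :=
  Finsupp.liftAddHom fun g => sg (Fin.cons a g)

lemma cone_sg {L : ℕ} (a : Γ) (g : Fin L → Γ) (m : C(X, ℤ)) : cone L a (sg g m) = sg (Fin.cons a g) m := by
  show Finsupp.liftAddHom _ (Finsupp.single g m) = _
  rw [Finsupp.liftAddHom_apply_single]

lemma bd_cone {L : ℕ} (a : Γ) (c : Ch Γ C(X, ℤ) (L+1)) : bdC (L+1) (cone _ a c) + cone _ a (bdC L c) = c :=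
  ch_hom_ext (f := (bdC (L+1)).comp (cone _ a) + (cone _ a).comp (bdC L)) (f' := AddMonoidHom.id _) (fun g m => by
    simp only [AddMonoidHom.comp_apply, AddMonoidHom.add_apply, AddMonoidHom.id_apply]
    rw [cone_sg, bdC_cons, bdC_sg, map_sum]
    simp only [map_zsmul, cone_sg]
    abel) c

/-- indicator of a clopen set -/
def ind (V : Set X) : C(X, ℤ) := if h : IsClopen V then ⟨fun x => if x ∈ V then 1 else 0,
    Continuous.if (by
      intro x hx
      have hx : x ∈ frontier V := hx
      rw [h.frontier_eq] at hx
      exact absurd hx (Set.notMem_empty _)) continuous_const continuous_const⟩ else 0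

lemma ind_apply {V : Set X} (h : IsClopen V) (x : X) : ind V x = if x ∈ V then 1 else 0 := by
  rw [ind, dif_pos h]; rfl

/-- orbit representative -/
def orep (x : X) : X := Quotient.out (Quotient.mk (MulAction.orbitRel Γ X) x)

variable (Γ) in
lemma orep_smul (γ : Γ) (x : X) : orep (Γ := Γ) (γ • x) = orep (Γ := Γ) x := by
  unfold orep
  congr 1
  exact Quotient.sound ⟨γ, rfl⟩

variable (Γ) in
lemma exists_om (x : X) : ∃ ω : Γ, ω • x = orep (Γ := Γ) x := by
  have : (MulAction.orbitRel Γ X) (orep (Γ := Γ) x) x := Quotient.mk_out (s := MulAction.orbitRel Γ X) x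
  exact this

/-- element moving a point to its representative -/
def om (x : X) : Γ := (exists_om Γ x).choose
lemma om_smul (x : X) : (om x : Γ) • x = orep (Γ := Γ) x := (exists_om Γ x).choose_spec

/-- cone operator over finitely many isolated points -/
def Hl (L : ℕ) (S : Finset X) : Ch Γ C(X, ℤ) L →+ Ch Γ C(X, ℤ) (L+1) :=
  ∑ x ∈ S, (cone L (om x)).comp (mulF L (ind {x}))

lemma Hl_apply (L : ℕ) (S : Finset X) (c : Ch Γ C(X, ℤ) L) :
    Hl L S c = ∑ x ∈ S, cone L (om x) (mulF L (ind {x}) c) := by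
  simp [Hl, AddMonoidHom.finsetSum_apply]

lemma bd_Hl {L : ℕ} (S : Finset X) (c : Ch Γ C(X, ℤ) (L+1)) :
    bdC (L+1) (Hl _ S c) + Hl _ S (bdC L c) = mulF _ (∑ x ∈ S, ind {x}) c := by
  rw [Hl_apply, Hl_apply, map_sum, ← Finset.sum_add_distrib, ← mulF_sum]
  refine Finset.sum_congr rfl fun x _ => ?_
  rw [← mulF_bdC, bd_cone]

lemma Th_Hl {n : ℕ} (S : Finset X) (hS : ∀ x ∈ S, IsClopen ({x} : Set X)) (hinv : ∀ (γ : Γ) (x : X), γ • x ∈ S ↔ x ∈ S)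
    (c : Ch Γ C(X, ℤ) (n+2)) (v : ↥((D Γ X).Comps (n+2))) (w : ↥((D Γ X).Comps (n+1)))
    (hw : w.1 = fun j => v.1 j.succ) :
    Th Γ X (n+1) (Hl _ S c) v = if src (v.1 (Fin.last _)) ∈ S ∧ rng (v.1 0) = orep (Γ := Γ) (src (v.1 (Fin.last _)))
      then Th Γ X n c w else 0 := by
  induction c using Finsupp.induction_linear with
  | zero => simp
  | add a b ha hb =>
    rw [map_add, map_add, Pi.add_apply, ha, hb, map_add, Pi.add_apply]
    split_ifs <;> simp
  | single g m =>
    show Th Γ X (n+1) (Hl _ S (sg g m)) v = if _ then Th Γ X n (sg g m) w else 0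
    rw [Hl_apply, map_sum]
    have h2 : (∑ x ∈ S, Th Γ X (n+1) (cone _ (om x) (mulF _ (ind {x}) (sg g m)))) v =
      ∑ x ∈ S, Th Γ X (n+1) (cone _ (om x) (mulF _ (ind {x}) (sg g m))) v := Finset.sum_apply _ _ _
    rw [h2]
    simp only [mulF_sg, cone_sg, Th_sg]
    have hb : ∀ a : Γ, bp (Fin.cons a g : Fin (n+3) → Γ) v.1 = bp g w.1 := by
      intro a
      simp only [bp, hw, Fin.succ_last]
      rfl
    set b := bp g w.1 with hbdef
    have hsl : src (v.1 (Fin.last _)) = g (Fin.last _) • b := by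
      rw [hbdef, bp, smul_inv_smul, hw]; rfl
    have hsb : src (v.1 (Fin.last _)) ∈ S ↔ b ∈ S := by rw [hsl, hinv]
    have hob : orep (Γ := Γ) (src (v.1 (Fin.last _))) = orep (Γ := Γ) b := by rw [hsl, orep_smul]
    simp only [hsb, hob]
    by_cases hbS : b ∈ S
    · rw [Finset.sum_eq_single b]
      · have key : eC (Fin.cons (om b) g : Fin (n+3) → Γ) b = v.1 ↔
            rng (v.1 0) = orep (Γ := Γ) b ∧ eC g b = w.1 := by
          constructor
          · intro h
            refine ⟨?_, ?_⟩
            · rw [← h, rng_eC, ← om_smul]; rfl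
            · rw [hw]; funext j
              rw [← h]; rfl
          · rintro ⟨h1, h3⟩
            funext j
            refine Fin.cases ?_ (fun j => ?_) j
            · apply ext'
              · rw [rng_eC, h1, ← om_smul]; rfl
              · rw [src_eC]
                have := (comps_iff v.1).1 v.2 0
                have h4 : v.1 (0 : Fin (n+1)).succ = w.1 0 := by rw [hw]
                rw [h4, ← h3, rng_eC] at this
                exact this.symm
            · have h4 : v.1 j.succ = w.1 j := by rw [hw]
              rw [h4, ← h3]; rfl
        rw [Tg, hb, Tg, ← hbdef]
        by_cases h1 : rng (v.1 0) = orep (Γ := Γ) b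
        · rw [if_pos (⟨hbS, h1⟩ : b ∈ S ∧ _)]
          by_cases h3 : eC g b = w.1
          · rw [if_pos (key.2 ⟨h1, h3⟩), if_pos h3, ContinuousMap.mul_apply, ind_apply (hS b hbS)]
            simp
          · rw [if_neg (fun h => h3 (key.1 h).2), if_neg h3]
        · rw [if_neg (fun h => h1 (key.1 h).1), if_neg (fun h : b ∈ S ∧ _ => h1 h.2)]
      · intro x hx hne
        rw [Tg, hb, ContinuousMap.mul_apply, ind_apply (hS x hx), if_neg (fun h : b ∈ ({x} : Set X) => hne h.symm)]
        simp
      · intro h; exact absurd hbS h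
    · rw [if_neg (fun h : b ∈ S ∧ _ => hbS h.1)]
      apply Finset.sum_eq_zero
      intro x hx
      rw [Tg, hb, ContinuousMap.mul_apply, ind_apply (hS x hx),
        if_neg (fun h : b ∈ ({x} : Set X) => hbS (by rw [show b = x from h]; exact hx))]
      simp

lemma Th_Hl_zero {n : ℕ} (S : Finset X) (hS : ∀ x ∈ S, IsClopen ({x} : Set X)) (hinv : ∀ (γ : Γ) (x : X), γ • x ∈ S ↔ x ∈ S)
    (c : Ch Γ C(X, ℤ) (n+2)) (h : Th Γ X n c = 0) : Th Γ X (n+1) (Hl _ S c) = 0 := by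
  funext v
  have hw : (fun j : Fin (n+1) => v.1 j.succ) ∈ (D Γ X).Comps (n+1) := by
    rw [comps_iff]; intro j
    exact (comps_iff v.1).1 v.2 j.succ
  rw [Th_Hl S hS hinv c v ⟨_, hw⟩ rfl, h]
  simp
end NF
end OG

namespace Tower
open OG
variable {T : Tower}

lemma sep_fin (S : Finset T.Γ) : ∃ N, ∀ γ ∈ S, ∀ δ ∈ S, ∀ x : T.X, co x N ≠ none → γ • x = δ • x → γ = δ := by
  have h : ∀ γ δ : T.Γ, ∃ N, γ ≠ δ → ∀ x : T.X, γ • x = δ • x → co x N = none := by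
    intro γ δ
    by_cases hne : γ = δ
    · exact ⟨0, fun h => absurd hne h⟩
    · obtain ⟨N, hN⟩ := sep γ δ hne
      exact ⟨N, fun _ x hx => (hN x).1 hx⟩
  choose F hF using h
  refine ⟨S.sup fun γ => S.sup (F γ), fun γ hγ δ hδ x hx e => ?_⟩
  by_contra hne
  apply hx
  refine co_none_mono x ?_ (hF γ δ hne x e)
  exact (Finset.le_sup (f := F γ) hδ).trans (Finset.le_sup (f := fun γ => S.sup (F γ)) hγ)

/-- indicator of high points -/
def hi (N : ℕ) : C(T.X, ℤ) := ind {x : T.X | co x N = none}ᶜ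

lemma hi_apply (N : ℕ) (x : T.X) : hi N x = if co x N = none then 0 else 1 := by
  rw [hi, ind_apply (low_clopen N).compl]
  by_cases h : co x N = none <;> simp [h]

lemma hi_inv (N : ℕ) (h : T.Γ) : shm h (hi (T := T) N) = hi N := by
  ext x
  rw [shm_apply, hi_apply, hi_apply]
  simp only [co_smul_none]

lemma ker_nf {n : ℕ} (z : Ch T.Γ C(T.X, ℤ) (n+2)) (hz : Th T.Γ T.X n z = 0) :
    ∃ N, mulF _ (hi N) (nf _ z) = 0 := by
  obtain ⟨N, hN⟩ := sep_fin (T := T) ((nf _ z).support.biUnion fun g => Finset.univ.image g)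
  refine ⟨N, ?_⟩
  ext g x
  have : mulF _ (hi N) (nf _ z) g x = hi N x * nf _ z g x := by simp [mulF]
  rw [this, hi_apply]
  split_ifs with hx
  · simp
  · rw [one_mul]
    refine sg_coeff (nf _ z) (nf_last z) (by rw [Th_nf, hz]) x ?_ g
    intro g g' hg hg' h
    funext j
    refine hN _ ?_ _ ?_ x hx (h j)
    · exact Finset.mem_biUnion.2 ⟨g, Finsupp.mem_support_iff.2 hg, Finset.mem_image_of_mem _ (Finset.mem_univ _)⟩
    · exact Finset.mem_biUnion.2 ⟨g', Finsupp.mem_support_iff.2 hg', Finset.mem_image_of_mem _ (Finset.mem_univ _)⟩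

/-- contraction data -/
def Rq (q : T.Q 0) (a b : T.Γ) : T.Γ × T.Γ →₀ ℤ := Finsupp.single (b, b) 1 - (T.P b q - T.P a q)

lemma Rq1 (q : T.Q 0) (a b : T.Γ) : bdE T.Γ (Rq q a b) = Finsupp.single a 1 - Finsupp.single b 1 := by
  rw [Rq, map_sub, map_sub, T.P_bd, T.P_bd, bdE_single]; abel

lemma Rq2 (q : T.Q 0) (a b c : T.Γ) : Rq q a b + Rq q b c - Rq q a c = Finsupp.single (b, b) 1 := by
  unfold Rq; abel

lemma Rq_sh (q : T.Q 0) (a b h : T.Γ) : Rq q (a * h) (b * h) = shE h (Rq (T.φ 0 h * q) a b) := by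
  rw [Rq, Rq, T.P_coc, T.P_coc, map_sub, map_sub, shE_single]; abel

/-- level zero indicator -/
def i0 (q : T.Q 0) : C(T.X, ℤ) := ind {x : T.X | co x 0 = some q}

lemma i0_clopen (q : T.Q 0) : IsClopen {x : T.X | co x 0 = some q} :=
  (isClopen_discrete ({some q} : Set (Option (T.Q 0)))).preimage (co_cont 0)

lemma i0_apply (q : T.Q 0) (x : T.X) : i0 q x = if co x 0 = some q then 1 else 0 := by
  rw [i0, ind_apply (i0_clopen q)]
  by_cases h : co x 0 = some q <;> simp [h]

lemma i0_sum : ∑ q : T.Q 0, i0 q = (1 : C(T.X, ℤ)) := by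
  ext x
  obtain ⟨y, hy⟩ := Option.ne_none_iff_exists'.1 (co_zero x)
  simp [i0_apply, hy]

lemma i0_sh (q : T.Q 0) (h : T.Γ) : shm h (i0 (T.φ 0 h * q)) = i0 q := by
  ext x
  obtain ⟨y, hy⟩ := Option.ne_none_iff_exists'.1 (co_zero x)
  rw [shm_apply, i0_apply, i0_apply, co_smul, hy]
  simp

/-- the main contraction -/
def Hm (L : ℕ) : Ch T.Γ C(T.X, ℤ) (L+2) →+ Ch T.Γ C(T.X, ℤ) (L+3) :=
  ∑ q : T.Q 0, (ctr (Rq q) L).comp (mulF _ (i0 q))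

lemma Hm_apply (L : ℕ) (c : Ch T.Γ C(T.X, ℤ) (L+2)) : Hm L c = ∑ q : T.Q 0, ctr (Rq q) L (mulF _ (i0 q) c) := by
  simp [Hm, AddMonoidHom.finsetSum_apply]

lemma bd_Hm (L : ℕ) (c : Ch T.Γ C(T.X, ℤ) (L+3)) : bdC (L+3) (Hm (L+1) c) + Hm L (bdC (L+2) c) = c := by
  rw [Hm_apply, Hm_apply, map_sum, ← Finset.sum_add_distrib]
  have : ∀ q : T.Q 0, bdC (L+3) (ctr (Rq q) (L+1) (mulF _ (i0 q) c)) +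
      ctr (Rq q) L (mulF _ (i0 q) (bdC (L+2) c)) = mulF _ (i0 q) c := by
    intro q
    rw [← mulF_bdC, ctr_homotopy (Rq1 q) (Rq2 q)]
  simp only [this]
  rw [mulF_sum, i0_sum, mulF_one]

lemma Th_edge_sh {n : ℕ} (s : Fin (n+1) → T.Γ) (h : T.Γ) (m : C(T.X, ℤ)) (r : T.Γ × T.Γ →₀ ℤ) :
    Th T.Γ T.X (n+1) (edge (fun j => s j * h) (shm h m) (shE h r)) = Th T.Γ T.X (n+1) (edge s m r) := by
  induction r using Finsupp.induction_linear with
  | zero => simp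
  | add a b ha hb => simp only [map_add, ha, hb]
  | single p k =>
    obtain ⟨a, b⟩ := p
    rw [shE_single, edge_single, edge_single, map_zsmul, map_zsmul]
    have : (Fin.cons (a * h) (Fin.cons (b * h) fun j => s j * h : Fin (n+2) → T.Γ) : Fin (n+3) → T.Γ) =
      fun j => (Fin.cons a (Fin.cons b s : Fin (n+2) → T.Γ) : Fin (n+3) → T.Γ) j * h := by
      funext j
      refine Fin.cases rfl (fun j => ?_) j
      refine Fin.cases rfl (fun j => rfl) j
    rw [this, Th_shift]

lemma Th_Hm_nf {n : ℕ} (c : Ch T.Γ C(T.X, ℤ) (n+2)) :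
    Th T.Γ T.X (n+1) (Hm n (nf _ c)) = Th T.Γ T.X (n+1) (Hm n c) := by
  refine ch_hom_ext (f := ((Th T.Γ T.X (n+1)).comp (Hm n)).comp (nf _)) (f' := (Th T.Γ T.X (n+1)).comp (Hm n)) ?_ c
  intro g m
  simp only [AddMonoidHom.comp_apply]
  rw [nf_sg]
  generalize (g (Fin.last _))⁻¹ = h
  rw [Hm_apply, Hm_apply, map_sum, map_sum]
  simp only [mulF_sg, ctr_sg]
  refine Fintype.sum_equiv (Equiv.mulLeft (T.φ 0 h)) _ _ fun q => ?_
  rw [Rq_sh, Equiv.coe_mulLeft, ← i0_sh q h]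
  exact Th_edge_sh (Fin.tail g) h (i0 (T.φ 0 h * q) * m) _

lemma low_single (N : ℕ) (x : T.X) (hx : co x N = none) : IsClopen ({x} : Set T.X) := by
  refine ⟨isClosed_singleton, ?_⟩
  have h : ({x} : Set T.X) = {y | co y N = none} \ ({y | co y N = none} \ {x}) := by
    ext y
    constructor
    · rintro rfl; exact ⟨hx, fun h => h.2 rfl⟩
    · rintro ⟨h1, h2⟩
      by_contra hc
      exact h2 ⟨h1, hc⟩
  rw [h]
  exact (low_clopen N).isOpen.sdiff (((low_finite N).subset Set.sdiff_subset).isClosed)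

lemma aux_sub {A : Type} [AddCommGroup A] {a b c x y : A} (h : a + b = c) : (a - x) + (b - y) = c - x - y := by
  rw [← h]; abel

theorem cycle_bdry (k : ℕ) (f : ↥((D T.Γ T.X).Comps (k+2)) → ℤ) (hf : f ∈ ccZ ↥((D T.Γ T.X).Comps (k+2)))
    (hz : (D T.Γ T.X).mBdry (k+1) f = 0) :
    ∃ a ∈ ccZ ↥((D T.Γ T.X).Comps (k+3)), (D T.Γ T.X).mBdry (k+2) a = f := by
  obtain ⟨c, rfl⟩ := Th_surj f hf
  rw [mBdry_Th] at hz
  obtain ⟨N, hN⟩ := ker_nf _ hz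
  let S : Finset T.X := (low_finite (T := T) N).toFinset
  have hS : ∀ x : T.X, x ∈ S ↔ co x N = none := fun x => (low_finite N).mem_toFinset
  refine ⟨Th T.Γ T.X (k+2) (Hm (k+1) (mulF _ (hi N) c) + Hl _ S c), Th_cc _, ?_⟩
  rw [mBdry_Th, map_add]
  have e1 := bd_Hm k (mulF _ (hi N) c)
  have e2 := bd_Hl S c
  have e3 : hi N + ∑ x ∈ S, ind {x} = (1 : C(T.X, ℤ)) := by
    ext x
    rw [ContinuousMap.add_apply, hi_apply, ContinuousMap.sum_apply]
    by_cases hx : co x N = none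
    · rw [if_pos hx, Finset.sum_eq_single x]
      · rw [ind_apply (low_single N x hx)]; simp
      · intro y hy hne
        rw [ind_apply (low_single N y ((hS y).1 hy)), if_neg (fun h : x ∈ ({y} : Set T.X) => hne h.symm)]
      · intro h; exact absurd ((hS x).2 hx) h
    · rw [if_neg hx, Finset.sum_eq_zero]
      · simp
      · intro y hy
        rw [ind_apply (low_single N y ((hS y).1 hy)), if_neg]
        intro h
        have h : x = y := h
        exact hx (by rw [h]; exact (hS y).1 hy)
  have e4 : mulF _ (hi N) c + mulF _ (∑ x ∈ S, ind {x}) c = c := by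
    have := mulF_sum (Γ := T.Γ) Finset.univ (fun b : Bool => if b then hi N else ∑ x ∈ S, ind {x}) c
    simp only [Fintype.sum_bool, if_true] at this
    refine Eq.trans ?_ (mulF_one c)
    rw [← e3]
    simpa using this
  have z1 : Th T.Γ T.X (k+1) (Hm k (bdC (k+2) (mulF _ (hi N) c))) = 0 := by
    rw [mulF_bdC, ← Th_Hm_nf, mulF_nf _ (hi_inv N), hN]; simp
  have z2 : Th T.Γ T.X (k+1) (Hl _ S (bdC (k+2) c)) = 0 := by
    refine Th_Hl_zero S (fun x hx => low_single N x ((hS x).1 hx)) (fun γ x => ?_) _ hz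
    rw [hS, hS, co_smul_none]
  have e5 : bdC (k+3) (Hm (k+1) (mulF _ (hi N) c)) + bdC (k+3) (Hl _ S c) =
     c - Hm k (bdC (k+2) (mulF _ (hi N) c)) - Hl _ S (bdC (k+2) c) := by
    have h1 : bdC (k+3) (Hm (k+1) (mulF _ (hi N) c)) = mulF _ (hi N) c - Hm k (bdC (k+2) (mulF _ (hi N) c)) :=
      eq_sub_of_add_eq e1
    have h2 : bdC (k+3) (Hl _ S c) = mulF _ (∑ x ∈ S, ind {x}) c - Hl _ S (bdC (k+2) c) := eq_sub_of_add_eq e2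
    rw [h1, h2]
    exact aux_sub e4
  rw [e5, map_sub, map_sub, z1, z2, sub_zero, sub_zero]

theorem homology_vanish (n : ℕ) (hn : 2 ≤ n) (x : (D T.Γ T.X).Homology n) : x = 0 := by
  obtain ⟨k, rfl⟩ := Nat.exists_eq_add_of_le' hn
  refine QuotientAddGroup.induction_on x fun a => ?_
  refine (QuotientAddGroup.eq_zero_iff a).2 ?_
  show a.1 ∈ (D T.Γ T.X).mBdries (k+2)
  have ha := a.2
  refine (AddSubgroup.closure_le ((D T.Γ T.X).mBdries (k+2))).2 ?_ ha
  rintro f ⟨hf, hz⟩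
  obtain ⟨b, hb, e⟩ := cycle_bdry k f hf hz
  exact AddSubgroup.subset_closure ⟨b, hb, e⟩
end Tower

/-- `ccC` as a submodule. -/
def ccCSub (Y : Type) [TopologicalSpace Y] : Submodule ℂ (Y → ℂ) where
  carrier := ccC Y
  add_mem' {a b} ha hb := ⟨ha.1.add hb.1, ha.2.add hb.2⟩
  zero_mem' := ⟨continuous_const, by
    have h : tsupport (0 : Y → ℂ) = ∅ := by simp [tsupport]
    unfold HasCompactSupport
    rw [h]; exact isCompact_empty⟩
  smul_mem' c f hf := ⟨hf.1.const_smul c, HasCompactSupport.smul_left (f := fun _ => c) hf.2⟩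

namespace OG
section Conv
variable {Γ X : Type} [Group Γ] [MulAction Γ X]

/-- function supported on the graph of `γ` -/
def aG (γ : Γ) (m : X → ℂ) (g : OG Γ X) : ℂ := if rng g = γ • src g then m (src g) else 0

/-- left translate of an arrow -/
def lsh (γ : Γ) (g : OG Γ X) : OG Γ X := ⟨(γ • rng g, src g), by
  obtain ⟨δ, hδ⟩ := g.2
  exact ⟨γ * δ, by show γ • g.1.1 = (γ * δ) • g.1.2; rw [hδ, mul_smul]⟩⟩

@[simp] lemma src_lsh (γ : Γ) (g : OG Γ X) : src (lsh γ g) = src g := rfl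
@[simp] lemma rng_lsh (γ : Γ) (g : OG Γ X) : rng (lsh γ g) = γ • rng g := rfl

lemma lsh_mul (γ δ : Γ) (g : OG Γ X) : lsh γ (lsh δ g) = lsh (γ * δ) g := ext' (by simp [mul_smul]) rfl
lemma lsh_one (g : OG Γ X) : lsh (1 : Γ) g = g := ext' (by simp) rfl

/-- the left translation as a permutation -/
def lshE (γ : Γ) : OG Γ X ≃ OG Γ X where
  toFun := lsh γ
  invFun := lsh γ⁻¹
  left_inv g := by rw [lsh_mul, inv_mul_cancel, lsh_one]
  right_inv g := by rw [lsh_mul, mul_inv_cancel, lsh_one]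

/-- finite sums -/
def PF (s : Finset Γ) (m : Γ → X → ℂ) : OG Γ X → ℂ := fun g => ∑ γ ∈ s, aG γ (m γ) g

lemma conv_supp (γ : Γ) (m : X → ℂ) (f : OG Γ X → ℂ) (g h : OG Γ X)
    (hne : h ≠ arr γ (γ⁻¹ • rng g)) :
    (if (D Γ X).range h = (D Γ X).range g then aG γ m h * f ((D Γ X).mul ((D Γ X).inv h) g) else 0) = 0 := by
  split_ifs with hr
  · rw [D_range, D_range] at hr
    have hr' : rng h = rng g := arr_inj 1 hr
    rw [aG, if_neg, zero_mul]
    intro hh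
    apply hne
    apply ext'
    · simp [hr']
    · rw [src_arr, ← hr', hh, inv_smul_smul]
  · rfl

lemma convC_PF (s : Finset Γ) (m : Γ → X → ℂ) (f : OG Γ X → ℂ) (g : OG Γ X) :
    (D Γ X).convC (PF s m) f g = ∑ γ ∈ s, m γ (γ⁻¹ • rng g) * f (lsh γ⁻¹ g) := by
  unfold GroupoidData.convC
  have h1 : ∀ h : OG Γ X, (if (D Γ X).range h = (D Γ X).range g then PF s m h * f ((D Γ X).mul ((D Γ X).inv h) g) else 0) =
      ∑ γ ∈ s, if (D Γ X).range h = (D Γ X).range g then aG γ (m γ) h * f ((D Γ X).mul ((D Γ X).inv h) g) else 0 := by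
    intro h
    split_ifs
    · rw [PF, Finset.sum_mul]
    · simp
  simp only [h1]
  rw [finsum_sum_comm]
  · refine Finset.sum_congr rfl fun γ _ => ?_
    rw [finsum_eq_single _ (arr γ (γ⁻¹ • rng g)) (fun h hne => conv_supp γ (m γ) f g h hne)]
    have hr : (D Γ X).range (arr γ (γ⁻¹ • rng g)) = (D Γ X).range g := by
      rw [D_range, D_range, rng_arr, smul_inv_smul]
    rw [if_pos hr]
    have h2 : aG γ (m γ) (arr γ (γ⁻¹ • rng g)) = m γ (γ⁻¹ • rng g) := by
      rw [aG, src_arr, rng_arr, if_pos rfl]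
    have e : src ((D Γ X).inv (arr γ (γ⁻¹ • rng g))) = rng g := by
      rw [D_inv]; show γ • γ⁻¹ • rng g = rng g; rw [smul_inv_smul]
    have h3 : (D Γ X).mul ((D Γ X).inv (arr γ (γ⁻¹ • rng g))) g = lsh γ⁻¹ g := by
      apply ext'
      · rw [rng_mul _ _ e, D_inv]; rfl
      · rw [src_mul _ _ e]; rfl
    rw [h2, h3]
  · intro γ _
    refine (Set.finite_singleton (arr γ (γ⁻¹ • rng g))).subset fun h hh => ?_
    by_contra hne
    exact hh (conv_supp γ (m γ) f g h hne)

lemma PF_single (γ : Γ) (m : X → ℂ) : PF {γ} (fun _ => m) = aG γ m := by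
  funext g; simp [PF]

lemma convC_aG (γ : Γ) (m : X → ℂ) (f : OG Γ X → ℂ) (g : OG Γ X) :
    (D Γ X).convC (aG γ m) f g = m (γ⁻¹ • rng g) * f (lsh γ⁻¹ g) := by
  rw [← PF_single, convC_PF, Finset.sum_singleton]

lemma convC_aG_aG (γ δ : Γ) (m m' : X → ℂ) :
    (D Γ X).convC (aG γ m) (aG δ m') = aG (γ * δ) (fun x => m (δ • x) * m' x) := by
  funext g
  rw [convC_aG, aG, aG, rng_lsh, src_lsh, mul_smul]
  by_cases h : γ⁻¹ • rng g = δ • src g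
  · rw [if_pos h, if_pos (inv_smul_eq_iff.1 h), h]
  · rw [if_neg h, if_neg (fun h' => h (inv_smul_eq_iff.2 h')), mul_zero]

lemma starC_aG (γ : Γ) (m : X → ℂ) :
    (D Γ X).starC (aG γ m) = aG γ⁻¹ (fun x => starRingEnd ℂ (m (γ⁻¹ • x))) := by
  funext g
  unfold GroupoidData.starC aG
  rw [D_inv]
  have h1 : rng (ginv g) = src g := rfl
  have h2 : src (ginv g) = rng g := rfl
  rw [h1, h2]
  by_cases h : src g = γ • rng g
  · have h' : γ⁻¹ • src g = rng g := inv_smul_eq_iff.2 h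
    rw [if_pos h, if_pos h'.symm]
    show _ = starRingEnd ℂ (m (γ⁻¹ • src g))
    rw [h']
  · rw [if_neg h, if_neg (fun h' => h (inv_smul_eq_iff.1 h'.symm)), map_zero]
end Conv

section ConvTop
variable {Γ X : Type} [Group Γ] [Countable Γ] [TopologicalSpace X] [CompactSpace X] [T2Space X]
  [TotallyDisconnectedSpace X] [SecondCountableTopology X] [MulAction Γ X] [ContinuousConstSMul Γ X] [OpenFix Γ X]

lemma aG_range (γ : Γ) (m : X → ℂ) (g : OG Γ X) : aG γ m g = if g ∈ Set.range (arr (X := X) γ) then m (src g) else 0 := by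
  have : rng g = γ • src g ↔ g ∈ Set.range (arr (X := X) γ) := by
    constructor
    · intro h; exact ⟨src g, ext' h.symm rfl⟩
    · rintro ⟨x, rfl⟩; rfl
  rw [aG]
  simp only [this]

lemma aG_cc (γ : Γ) (m : X → ℂ) (hm : Continuous m) : aG γ m ∈ ccC (OG Γ X) := by
  have h : aG γ m = fun g : OG Γ X => if g ∈ Set.range (arr (X := X) γ) then m (src g) else 0 := funext (aG_range γ m)
  rw [h]
  constructor
  · refine Continuous.if ?_ (hm.comp src_cont) continuous_const
    intro v hv
    have hv : v ∈ frontier (Set.range (arr (X := X) γ)) := hv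
    rw [(range_arr_clopen γ).frontier_eq] at hv
    exact absurd hv (Set.notMem_empty _)
  · refine HasCompactSupport.intro (isCompact_range (arr_continuous (X := X) γ)) ?_
    intro g hg
    rw [if_neg hg]

lemma PF_eq (s : Finset Γ) (m : Γ → X → ℂ) : PF s m = ∑ γ ∈ s, aG γ (m γ) := by
  funext g; rw [PF, Finset.sum_apply]

lemma PF_cc (s : Finset Γ) (m : Γ → X → ℂ) (hm : ∀ γ ∈ s, Continuous (m γ)) : PF s m ∈ ccC (OG Γ X) := by
  rw [PF_eq]
  exact (ccCSub (OG Γ X)).sum_mem fun γ h => aG_cc γ _ (hm γ h)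

lemma cc_PF_aux (s : Finset Γ) : ∀ f ∈ ccC (OG Γ X), (∀ g, f g ≠ 0 → ∃ γ ∈ s, g ∈ Set.range (arr (X := X) γ)) →
    ∃ m : Γ → X → ℂ, (∀ γ, Continuous (m γ)) ∧ f = PF s m := by
  induction s using Finset.induction_on with
  | empty =>
    intro f _ h
    refine ⟨fun _ _ => 0, fun _ => continuous_const, ?_⟩
    funext g
    by_contra hc
    obtain ⟨γ, hγ, _⟩ := h g (fun h0 => hc (by rw [h0]; simp [PF]))
    simp at hγ
  | insert γ s hγs ih =>
    intro f hf h
    have hc : Continuous fun x => f (arr γ x) := hf.1.comp (arr_continuous γ)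
    obtain ⟨m, hm, e⟩ := ih (f - aG γ fun x => f (arr γ x)) ((ccCSub _).sub_mem hf (aG_cc γ _ hc)) (by
      intro g hg
      rw [Pi.sub_apply, aG_range] at hg
      split_ifs at hg with h1
      · obtain ⟨x, rfl⟩ := h1
        exact absurd (sub_self _) hg
      · rw [sub_zero] at hg
        obtain ⟨δ, hδ, hx⟩ := h g hg
        rcases Finset.mem_insert.1 hδ with rfl | h'
        · exact absurd hx h1
        · exact ⟨δ, h', hx⟩)
    refine ⟨fun δ => if δ = γ then fun x => f (arr γ x) else m δ, fun δ => ?_, ?_⟩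
    · show Continuous (if δ = γ then fun x => f (arr γ x) else m δ)
      split_ifs
      · exact hc
      · exact hm δ
    · rw [sub_eq_iff_eq_add] at e
      have hs : ∑ δ ∈ s, aG δ (if δ = γ then (fun x => f (arr γ x)) else m δ) = ∑ δ ∈ s, aG δ (m δ) := by
        refine Finset.sum_congr rfl fun δ hδ => ?_
        rw [if_neg]
        rintro rfl
        exact hγs hδ
      refine e.trans ?_
      rw [PF_eq, PF_eq, Finset.sum_insert hγs]
      refine (add_comm _ _).trans (congrArg₂ _ ?_ hs.symm)
      exact congrArg (aG γ) (if_pos rfl).symm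

lemma cc_PF (f : OG Γ X → ℂ) (hf : f ∈ ccC (OG Γ X)) :
    ∃ (s : Finset Γ) (m : Γ → X → ℂ), (∀ γ, Continuous (m γ)) ∧ f = PF s m := by
  obtain ⟨s, hs⟩ := IsCompact.elim_finite_subcover (hf.2 : IsCompact (tsupport f))
    (fun γ : Γ => Set.range (arr (X := X) γ)) (fun γ => (range_arr_clopen γ).isOpen) (by
      intro g _
      obtain ⟨γ, h⟩ := exists_arr g
      exact Set.mem_iUnion.2 ⟨γ, src g, h.symm⟩)
  refine ⟨s, cc_PF_aux s f hf fun g hg => ?_⟩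
  have := hs (subset_tsupport f hg)
  simp only [Set.mem_iUnion] at this
  obtain ⟨γ, hγ, h⟩ := this
  exact ⟨γ, hγ, h⟩

lemma convC_cc (f f' : OG Γ X → ℂ) (hf : f ∈ ccC (OG Γ X)) (hf' : f' ∈ ccC (OG Γ X)) :
    (D Γ X).convC f f' ∈ ccC (OG Γ X) := by
  obtain ⟨s, m, hm, rfl⟩ := cc_PF f hf
  obtain ⟨s', m', hm', rfl⟩ := cc_PF f' hf'
  have : (D Γ X).convC (PF s m) (PF s' m') = ∑ γ ∈ s, ∑ δ ∈ s', aG (γ * δ) (fun x => m γ (δ • x) * m' δ x) := by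
    funext g
    rw [convC_PF, Finset.sum_apply]
    refine Finset.sum_congr rfl fun γ _ => ?_
    rw [PF, Finset.mul_sum, Finset.sum_apply]
    refine Finset.sum_congr rfl fun δ _ => ?_
    rw [← convC_aG_aG, convC_aG]
  rw [this]
  refine (ccCSub _).sum_mem fun γ _ => (ccCSub _).sum_mem fun δ _ => ?_
  exact aG_cc _ _ (((hm γ).comp (continuous_const_smul δ)).mul (hm' δ))

lemma starC_cc (f : OG Γ X → ℂ) (hf : f ∈ ccC (OG Γ X)) : (D Γ X).starC f ∈ ccC (OG Γ X) := by
  obtain ⟨s, m, hm, rfl⟩ := cc_PF f hf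
  have : (D Γ X).starC (PF s m) = ∑ γ ∈ s, aG γ⁻¹ (fun x => starRingEnd ℂ (m γ (γ⁻¹ • x))) := by
    funext g
    rw [Finset.sum_apply]
    unfold GroupoidData.starC PF
    rw [map_sum]
    refine Finset.sum_congr rfl fun γ _ => ?_
    rw [← starC_aG]; rfl
  rw [this]
  refine (ccCSub _).sum_mem fun γ _ => aG_cc _ _ ?_
  exact Complex.continuous_conj.comp ((hm γ).comp (continuous_const_smul _))
end ConvTop
end OG

namespace KT
open Matrix

section MvN
variable {R : Type} [Ring R] [StarRing R]

/-- Self-adjoint idempotent matrices. -/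
def IsP {ι : Type} [Fintype ι] (p : Matrix ι ι R) : Prop := p * p = p ∧ pᴴ = p

/-- Murray-von Neumann equivalence. -/
def MvN {ι κ : Type} [Fintype ι] [Fintype κ] (p : Matrix ι ι R) (q : Matrix κ κ R) : Prop :=
  ∃ v : Matrix ι κ R, v * vᴴ = p ∧ vᴴ * v = q

variable {ι κ μ ι' κ' : Type} [Fintype ι] [Fintype κ] [Fintype μ] [Fintype ι'] [Fintype κ']

lemma MvN.rfl' {p : Matrix ι ι R} (h : IsP p) : MvN p p := ⟨p, by rw [h.2, h.1], by rw [h.2, h.1]⟩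

lemma MvN.symm {p : Matrix ι ι R} {q : Matrix κ κ R} (h : MvN p q) : MvN q p := by
  obtain ⟨v, h1, h2⟩ := h
  exact ⟨vᴴ, by rw [conjTranspose_conjTranspose, h2], by rw [conjTranspose_conjTranspose, h1]⟩

lemma MvN.trans {p : Matrix ι ι R} {q : Matrix κ κ R} {r : Matrix μ μ R} (hp : IsP p) (hr : IsP r)
    (h : MvN p q) (h' : MvN q r) : MvN p r := by
  obtain ⟨v, h1, h2⟩ := h
  obtain ⟨w, h3, h4⟩ := h'
  refine ⟨v * w, ?_, ?_⟩
  · rw [conjTranspose_mul, Matrix.mul_assoc, ← Matrix.mul_assoc w, h3, ← h2, Matrix.mul_assoc, ← Matrix.mul_assoc v,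
      h1, hp.1]
  · rw [conjTranspose_mul, Matrix.mul_assoc, ← Matrix.mul_assoc _ v, h2, ← h3, Matrix.mul_assoc, ← Matrix.mul_assoc wᴴ,
      h4, hr.1]

lemma IsP.reindex {p : Matrix ι ι R} (h : IsP p) (e : ι ≃ κ) : IsP (reindex e e p) := by
  constructor
  · rw [reindex_apply, submatrix_mul_equiv, h.1]
  · rw [reindex_apply, conjTranspose_submatrix, h.2]

lemma MvN.reindex {p : Matrix ι ι R} (h : IsP p) (e : ι ≃ κ) : MvN p (reindex e e p) := by
  refine ⟨p.submatrix (Equiv.refl ι) e.symm, ?_, ?_⟩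
  · rw [conjTranspose_submatrix, submatrix_mul_equiv, h.2, h.1]; rfl
  · rw [conjTranspose_submatrix, submatrix_mul_equiv, h.2, h.1]; rfl

lemma IsP.blk {p : Matrix ι ι R} {q : Matrix κ κ R} (h : IsP p) (h' : IsP q) : IsP (fromBlocks p 0 0 q) := by
  constructor
  · rw [fromBlocks_multiply]; simp [h.1, h'.1]
  · rw [fromBlocks_conjTranspose]; simp [h.2, h'.2]

lemma MvN.blk {p : Matrix ι ι R} {q : Matrix κ κ R} {p' : Matrix ι' ι' R} {q' : Matrix κ' κ' R}
    (h : MvN p p') (h' : MvN q q') : MvN (fromBlocks p 0 0 q) (fromBlocks p' 0 0 q') := by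
  obtain ⟨v, h1, h2⟩ := h
  obtain ⟨w, h3, h4⟩ := h'
  refine ⟨fromBlocks v 0 0 w, ?_, ?_⟩ <;> rw [fromBlocks_conjTranspose, fromBlocks_multiply] <;>
    simp [h1, h2, h3, h4]

lemma IsP.bSum {m n : ℕ} {p : Matrix (Fin m) (Fin m) R} {q : Matrix (Fin n) (Fin n) R} (h : IsP p) (h' : IsP q) :
    IsP (bSum p q) := (h.blk h').reindex _

lemma MvN.bSum' {m n : ℕ} {p : Matrix (Fin m) (Fin m) R} {q : Matrix (Fin n) (Fin n) R} (h : IsP p) (h' : IsP q) :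
    MvN (fromBlocks p 0 0 q) (bSum p q) := MvN.reindex (h.blk h') _

lemma isP_zero : IsP (0 : Matrix ι ι R) := ⟨by simp, by simp⟩

lemma MvN.bSum {m n m' n' : ℕ} {p : Matrix (Fin m) (Fin m) R} {q : Matrix (Fin n) (Fin n) R}
    {p' : Matrix (Fin m') (Fin m') R} {q' : Matrix (Fin n') (Fin n') R} (hp : IsP p) (hq : IsP q)
    (hp' : IsP p') (hq' : IsP q')
    (h : MvN p p') (h' : MvN q q') : MvN (bSum p q) (bSum p' q') :=
  (MvN.bSum' hp hq).symm.trans (hp.bSum hq) (hp'.bSum hq')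
    ((h.blk h').trans (hp.blk hq) (hp'.bSum hq') (MvN.bSum' hp' hq'))

lemma MvN.bSum_comm {m n : ℕ} {p : Matrix (Fin m) (Fin m) R} {q : Matrix (Fin n) (Fin n) R} (hp : IsP p) (hq : IsP q) :
    MvN (_root_.bSum p q) (_root_.bSum q p) := by
  refine (MvN.bSum' hp hq).symm.trans (hp.bSum hq) (hq.bSum hp) (MvN.trans (hp.blk hq) (hq.bSum hp) ?_ (MvN.bSum' hq hp))
  have := MvN.reindex (hp.blk hq) (Equiv.sumComm _ _)
  rw [reindex_apply] at this
  convert this using 1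
  ext (i | i) (j | j) <;> rfl

lemma bSum_val {m n : ℕ} (a : Matrix (Fin m) (Fin m) R) (b : Matrix (Fin n) (Fin n) R) (i j : Fin (m + n)) :
    bSum a b i j = if h : i.1 < m ∧ j.1 < m then a ⟨i, h.1⟩ ⟨j, h.2⟩ else
      if h' : m ≤ i.1 ∧ m ≤ j.1 then b ⟨i - m, by omega⟩ ⟨j - m, by omega⟩ else 0 := by
  unfold bSum
  rw [reindex_apply]
  induction i using Fin.addCases <;> induction j using Fin.addCases <;> simp

lemma castM_val {α : Type} {a b : ℕ} (h : a = b) (M : Matrix (Fin a) (Fin a) α) (i j : Fin b) :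
    castM h M i j = M ⟨i, by omega⟩ ⟨j, by omega⟩ := rfl

lemma bSum_assoc {m n k : ℕ} (a : Matrix (Fin m) (Fin m) R) (b : Matrix (Fin n) (Fin n) R) (c : Matrix (Fin k) (Fin k) R) :
    bSum a (bSum b c) = castM (Nat.add_assoc m n k) (bSum (bSum a b) c) := by
  ext i j
  rw [castM_val]
  simp only [bSum_val]
  split_ifs <;> first | rfl | omega | (congr 1 <;> ext <;> simp <;> omega)

lemma castM_castM {α : Type} {a b c : ℕ} (h : a = b) (h' : b = c) (M : Matrix (Fin a) (Fin a) α) :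
    castM h' (castM h M) = castM (h.trans h') M := rfl

lemma bSum_castM {a b n : ℕ} (h : a = b) (p : Matrix (Fin a) (Fin a) R) (q : Matrix (Fin n) (Fin n) R) :
    bSum (castM h p) q = castM (by rw [h]) (bSum p q) := by
  subst h
  rfl

lemma MvN.bSum_assoc {m n k : ℕ} {a : Matrix (Fin m) (Fin m) R} {b : Matrix (Fin n) (Fin n) R} {c : Matrix (Fin k) (Fin k) R}
    (ha : IsP a) (hb : IsP b) (hc : IsP c) :
    MvN (_root_.bSum (_root_.bSum a b) c) (_root_.bSum a (_root_.bSum b c)) := by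
  rw [KT.bSum_assoc]
  exact MvN.reindex ((ha.bSum hb).bSum hc) _

variable (R) in
/-- Projections of all sizes. -/
def PM : Type := {x : Σ n : ℕ, Matrix (Fin n) (Fin n) R // IsP x.2}

/-- The setoid of Murray-von Neumann equivalence. -/
instance PMs : Setoid (PM R) where
  r x y := MvN x.1.2 y.1.2
  iseqv := ⟨fun x => MvN.rfl' x.2, fun h => MvN.symm h, fun {x _ z} h h' => MvN.trans x.2 z.2 h h'⟩

/-- Block sum of projections. -/
def PM.add (x y : PM R) : PM R := ⟨⟨x.1.1 + y.1.1, bSum x.1.2 y.1.2⟩, x.2.bSum y.2⟩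

variable (R) in
/-- The monoid of equivalence classes of projections. -/
def VM : Type := Quotient (PMs (R := R))

instance : Zero (VM R) := ⟨Quotient.mk _ (⟨⟨0, 0⟩, isP_zero⟩ : PM R)⟩

instance : Add (VM R) := ⟨Quotient.map₂ PM.add (fun x x' h y y' h' => MvN.bSum x.2 y.2 x'.2 y'.2 h h')⟩

/-- The class of a projection in the monoid. -/
def VM.mk (x : PM R) : VM R := Quotient.mk _ x

instance : AddCommMonoid (VM R) where
  nsmul := nsmulRec
  add_assoc x y z := by
    induction x using Quotient.inductionOn
    induction y using Quotient.inductionOn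
    induction z using Quotient.inductionOn
    rename_i x y z
    exact Quotient.sound (MvN.bSum_assoc x.2 y.2 z.2)
  add_comm x y := by
    induction x using Quotient.inductionOn
    induction y using Quotient.inductionOn
    rename_i x y
    exact Quotient.sound (MvN.bSum_comm x.2 y.2)
  zero_add x := by
    induction x using Quotient.inductionOn
    rename_i x
    refine Quotient.sound ?_
    show MvN (bSum (0 : Matrix (Fin 0) (Fin 0) R) x.1.2) x.1.2
    refine (MvN.bSum' isP_zero x.2).symm.trans (isP_zero.bSum x.2) x.2 ?_
    have := MvN.reindex ((isP_zero (R := R) (ι := Fin 0)).blk x.2) (Equiv.emptySum _ _)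
    exact this
  add_zero x := by
    induction x using Quotient.inductionOn
    rename_i x
    refine Quotient.sound ?_
    show MvN (bSum x.1.2 (0 : Matrix (Fin 0) (Fin 0) R)) x.1.2
    refine (MvN.bSum' x.2 isP_zero).symm.trans (x.2.bSum isP_zero) x.2 ?_
    have := MvN.reindex (x.2.blk (isP_zero (R := R) (ι := Fin 0))) (Equiv.sumEmpty _ _)
    exact this

variable (R) in
/-- The enveloping group. -/
abbrev KG : Type := Algebra.GrothendieckAddGroup (VM R)

/-- The class of a projection matrix. -/
def pc {n : ℕ} (p : Matrix (Fin n) (Fin n) R) : KG R :=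
  if h : IsP p then Algebra.GrothendieckAddGroup.of (M := VM R) (VM.mk ⟨⟨n, p⟩, h⟩) else 0

lemma pc_congr {n m : ℕ} {p : Matrix (Fin n) (Fin n) R} {q : Matrix (Fin m) (Fin m) R} (hp : IsP p) (hq : IsP q)
    (h : MvN p q) : pc p = pc q := by
  rw [pc, pc, dif_pos hp, dif_pos hq]
  exact congrArg _ (Quotient.sound h)

lemma pc_bSum {n m : ℕ} {p : Matrix (Fin n) (Fin n) R} {q : Matrix (Fin m) (Fin m) R} (hp : IsP p) (hq : IsP q) :
    pc (bSum p q) = pc p + pc q := by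
  rw [pc, pc, pc, dif_pos hp, dif_pos hq, dif_pos (hp.bSum hq)]
  exact map_add (Algebra.GrothendieckAddGroup.of (M := VM R)) (VM.mk ⟨⟨n, p⟩, hp⟩) (VM.mk ⟨⟨m, q⟩, hq⟩)

lemma pc_eq {n m : ℕ} {p : Matrix (Fin n) (Fin n) R} {q : Matrix (Fin m) (Fin m) R} (hp : IsP p) (hq : IsP q)
    (h : pc p = pc q) : ∃ (k : ℕ) (r : Matrix (Fin k) (Fin k) R), IsP r ∧ MvN (bSum p r) (bSum q r) := by
  rw [pc, pc, dif_pos hp, dif_pos hq] at h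
  obtain ⟨⟨c, _⟩, hc⟩ := (AddSubmonoid.LocalizationMap.eq_iff_exists _).1 h
  induction c using Quotient.inductionOn
  rename_i r hr
  refine ⟨r.1.1, r.1.2, r.2, ?_⟩
  have h1 : MvN (bSum r.1.2 p) (bSum r.1.2 q) := Quotient.exact hc
  exact (MvN.bSum_comm hp r.2).trans (hp.bSum r.2) (hq.bSum r.2)
    (h1.trans (r.2.bSum hp) (hq.bSum r.2) (MvN.bSum_comm r.2 hq))

lemma pc_zero (n : ℕ) : pc (0 : Matrix (Fin n) (Fin n) R) = 0 := by
  have h : pc (0 : Matrix (Fin n) (Fin n) R) = pc (0 : Matrix (Fin 0) (Fin 0) R) :=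
    pc_congr isP_zero isP_zero ⟨0, by simp, by simp⟩
  have h2 : pc (0 : Matrix (Fin 0) (Fin 0) R) = 0 := by
    rw [pc, dif_pos isP_zero]
    exact map_zero _
  rw [h, h2]
end MvN
end KT

namespace KT
open Matrix
section PV
variable {R : Type} [Ring R] [StarRing R] [Algebra ℂ R] [StarModule ℂ R]
/-- The first half of the path. -/
def pv {ι : Type} (v Q : Matrix ι ι R) (c s : ℂ) : Matrix (ι ⊕ ι) ι R :=
  fromRows (c ^ 2 • v + s ^ 2 • Q) ((c * s) • (v - Q))

/-- The second half of the path. -/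
def pw {ι : Type} (v Q : Matrix ι ι R) (c s : ℂ) : Matrix ι (ι ⊕ ι) R :=
  fromCols (c ^ 2 • vᴴ + s ^ 2 • Q) ((c * s) • (vᴴ - Q))

lemma pv_star {ι : Type} (v Q : Matrix ι ι R) (hQ : Qᴴ = Q) (c s : ℂ)
    (hc : star c = c) (hs : star s = s) : (pv v Q c s)ᴴ = pw v Q c s := by
  unfold pv pw
  rw [conjTranspose_fromRows_eq_fromCols_conjTranspose]
  congr 1
  · rw [conjTranspose_add, conjTranspose_smul, conjTranspose_smul, hQ, star_pow, star_pow, hc, hs]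
  · rw [conjTranspose_smul, conjTranspose_sub, hQ, star_mul, hc, hs, mul_comm]

lemma pw_pv {ι : Type} [Fintype ι] (v Q : Matrix ι ι R) (h1 : vᴴ * v = Q)
    (h2 : Q * Q = Q) (c s : ℂ) (h : c ^ 2 + s ^ 2 = 1) : pw v Q c s * pv v Q c s = Q := by
  unfold pv pw
  rw [fromCols_mul_fromRows]
  simp only [Matrix.mul_add, Matrix.add_mul, Matrix.mul_sub, Matrix.sub_mul, Matrix.smul_mul, Matrix.mul_smul, h1, h2]
  match_scalars
  · linear_combination (c ^ 2 + s ^ 2 + 1) * h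
  · ring
  · ring

lemma pv_Q {ι : Type} [Fintype ι] (v Q : Matrix ι ι R) (h1 : v * Q = v)
    (h2 : Q * Q = Q) (c s : ℂ) : pv v Q c s * Q = pv v Q c s := by
  unfold pv
  rw [fromRows_mul]
  simp only [Matrix.add_mul, Matrix.sub_mul, Matrix.smul_mul, h1, h2]

end PV

section Htpy
variable {B : Type} [NonUnitalNormedRing B] [StarRing B] [NormedSpace ℂ B]
  [IsScalarTower ℂ B B] [SMulCommClass ℂ B B] [StarModule ℂ B]

/-- Componentwise continuity. -/
def CP (f : ℝ → Unitization ℂ B) : Prop := Continuous (fun t => (f t).fst) ∧ Continuous (fun t => (f t).snd)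

lemma CP.const (a : Unitization ℂ B) : CP (fun _ => a) := ⟨continuous_const, continuous_const⟩
lemma CP.add {f g : ℝ → Unitization ℂ B} (hf : CP f) (hg : CP g) : CP (fun t => f t + g t) :=
  ⟨hf.1.add hg.1, hf.2.add hg.2⟩
lemma CP.smul {c : ℝ → ℂ} (hc : Continuous c) {f : ℝ → Unitization ℂ B} (hf : CP f) : CP (fun t => c t • f t) :=
  ⟨hc.smul hf.1, hc.smul hf.2⟩
lemma CP.mul {f g : ℝ → Unitization ℂ B} (hf : CP f) (hg : CP g) : CP (fun t => f t * g t) :=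
  ⟨hf.1.mul hg.1, ((hf.1.smul hg.2).add (hg.1.smul hf.2)).add (hf.2.mul hg.2)⟩
lemma CP.sum {ι : Type} (s : Finset ι) {f : ι → ℝ → Unitization ℂ B} (hf : ∀ i ∈ s, CP (f i)) :
    CP (fun t => ∑ i ∈ s, f i t) := by
  induction s using Finset.induction_on with
  | empty => simpa using CP.const 0
  | insert i s h ih =>
    simp only [Finset.sum_insert h]
    exact (hf i (by simp)).add (ih fun j hj => hf j (by simp [hj]))

lemma MvN.htpy {N : ℕ} {P Q : Matrix (Fin N) (Fin N) (Unitization ℂ B)} (hP : IsP P) (hQ : IsP Q) (h : MvN P Q) :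
    ProjHtpy Set.univ (_root_.bSum P (0 : Matrix (Fin N) (Fin N) (Unitization ℂ B)))
      (_root_.bSum Q (0 : Matrix (Fin N) (Fin N) (Unitization ℂ B))) := by
  obtain ⟨v, hv, hv1, hv2⟩ : ∃ v : Matrix (Fin N) (Fin N) (Unitization ℂ B), v * vᴴ = P ∧ vᴴ * v = Q ∧ v * Q = v := by
    obtain ⟨w, h1, h2⟩ := h
    refine ⟨w * Q, ?_, ?_, ?_⟩
    · rw [conjTranspose_mul, hQ.2, Matrix.mul_assoc, ← Matrix.mul_assoc Q, hQ.1, ← h2, Matrix.mul_assoc,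
        ← Matrix.mul_assoc w, h1, hP.1]
    · rw [conjTranspose_mul, hQ.2, Matrix.mul_assoc, ← Matrix.mul_assoc wᴴ, h2, hQ.1, hQ.1]
    · rw [Matrix.mul_assoc, hQ.1]
  let c : ℝ → ℂ := fun t => ((Real.cos (Real.pi / 2 * t) : ℝ) : ℂ)
  let s : ℝ → ℂ := fun t => ((Real.sin (Real.pi / 2 * t) : ℝ) : ℂ)
  have hc : Continuous c := Complex.continuous_ofReal.comp (Real.continuous_cos.comp (continuous_const.mul continuous_id))
  have hs : Continuous s := Complex.continuous_ofReal.comp (Real.continuous_sin.comp (continuous_const.mul continuous_id))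
  have hcs : ∀ t, c t ^ 2 + s t ^ 2 = 1 := by
    intro t
    show ((Real.cos (Real.pi / 2 * t) : ℝ) : ℂ) ^ 2 + ((Real.sin (Real.pi / 2 * t) : ℝ) : ℂ) ^ 2 = 1
    rw [← Complex.ofReal_pow, ← Complex.ofReal_pow, ← Complex.ofReal_add, Real.cos_sq_add_sin_sq, Complex.ofReal_one]
  have hcr : ∀ t, star (c t) = c t := fun t => Complex.conj_ofReal _
  have hsr : ∀ t, star (s t) = s t := fun t => Complex.conj_ofReal _
  have c0 : c 0 = 1 := by simp [c]
  have s0 : s 0 = 0 := by simp [s]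
  have c1 : c 1 = 0 := by simp [c]
  have s1 : s 1 = 1 := by simp [s]
  refine ⟨fun t => Matrix.reindex finSumFinEquiv finSumFinEquiv (pv v Q (c t) (s t) * pw v Q (c t) (s t)), ?_, ?_, ?_, ?_⟩
  · intro i j
    have key : ∀ a b : Fin N ⊕ Fin N, CP (fun t => (pv v Q (c t) (s t) * pw v Q (c t) (s t)) a b) := by
      intro a b
      simp only [Matrix.mul_apply]
      refine CP.sum _ fun k _ => CP.mul ?_ ?_
      · rcases a with a | a
        · exact ((CP.const (v a k)).smul (hc.pow 2)).add ((CP.const (Q a k)).smul (hs.pow 2))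
        · exact (CP.const (v a k - Q a k)).smul (hc.mul hs)
      · rcases b with b | b
        · exact ((CP.const (vᴴ k b)).smul (hc.pow 2)).add ((CP.const (Q k b)).smul (hs.pow 2))
        · exact (CP.const (vᴴ k b - Q k b)).smul (hc.mul hs)
    exact key _ _
  · show Matrix.reindex _ _ (pv v Q (c 0) (s 0) * pw v Q (c 0) (s 0)) = _
    rw [c0, s0, _root_.bSum]
    unfold pv pw
    rw [fromRows_mul_fromCols]
    simp [hv]
  · show Matrix.reindex _ _ (pv v Q (c 1) (s 1) * pw v Q (c 1) (s 1)) = _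
    rw [c1, s1, _root_.bSum]
    unfold pv pw
    rw [fromRows_mul_fromCols]
    simp [hQ.1]
  · intro t _
    have h1 : IsP (pv v Q (c t) (s t) * pw v Q (c t) (s t)) := by
      constructor
      · rw [Matrix.mul_assoc, ← Matrix.mul_assoc (pw v Q (c t) (s t)), pw_pv v Q hv1 hQ.1 _ _ (hcs t), ← Matrix.mul_assoc,
          pv_Q v Q hv2 hQ.1]
      · rw [← pv_star v Q hQ.2 _ _ (hcr t) (hsr t), conjTranspose_mul, conjTranspose_conjTranspose]
    have h2 := h1.reindex (finSumFinEquiv (m := N) (n := N))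
    exact ⟨h2.1, h2.2, fun _ _ => Set.mem_univ _⟩

lemma ProjHtpy.cast {a b : ℕ} (h : a = b) {p q : Matrix (Fin a) (Fin a) (Unitization ℂ B)} (H : ProjHtpy Set.univ p q) :
    ProjHtpy Set.univ (castM h p) (castM h q) := by
  subst h; exact H

lemma isProjM_iff {n : ℕ} (p : Matrix (Fin n) (Fin n) (Unitization ℂ B)) : IsProjM Set.univ p ↔ IsP p :=
  ⟨fun h => ⟨h.1, h.2.1⟩, fun h => ⟨h.1, h.2, fun _ _ => Set.mem_univ _⟩⟩

/-- The class of a cycle. -/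
def cls (x : K0Cycle B) : KG (Unitization ℂ B) := pc x.2.1 - pc x.2.2

lemma isP_castM {R : Type} [Ring R] [StarRing R] {a b : ℕ} (h : a = b) {p : Matrix (Fin a) (Fin a) R} (H : IsP p) : IsP (castM h p) := by
  subst h; exact H

lemma K0Rel_of_cls {x y : K0Cycle B} (hx : IsK0Cycle Set.univ x) (hy : IsK0Cycle Set.univ y) (h : cls x = cls y) :
    K0Rel Set.univ x y := by
  have xp := (isProjM_iff _).1 hx.1
  have xq := (isProjM_iff _).1 hx.2.1
  have yp := (isProjM_iff _).1 hy.1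
  have yq := (isProjM_iff _).1 hy.2.1
  have h1 : pc (_root_.bSum x.2.1 y.2.2) = pc (_root_.bSum y.2.1 x.2.2) := by
    rw [pc_bSum xp yq, pc_bSum yp xq]
    exact sub_eq_sub_iff_add_eq_add.1 h
  obtain ⟨k, r, hr, hm⟩ := pc_eq (xp.bSum yq) (yp.bSum xq) h1
  have e : y.1 + x.1 + k = x.1 + y.1 + k := by omega
  have h2 : MvN (_root_.bSum (_root_.bSum x.2.1 y.2.2) r) (castM e (_root_.bSum (_root_.bSum y.2.1 x.2.2) r)) :=
    hm.trans ((xp.bSum yq).bSum hr) (isP_castM e ((yp.bSum xq).bSum hr)) (MvN.reindex ((yp.bSum xq).bSum hr) _)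
  have h3 := MvN.htpy ((xp.bSum yq).bSum hr) (isP_castM e ((yp.bSum xq).bSum hr)) h2
  have h4 := ProjHtpy.cast (Nat.add_assoc (x.1 + y.1) k (x.1 + y.1 + k)) h3
  refine ⟨hx, hy, k + (x.1 + y.1 + k), _root_.bSum r 0, (isProjM_iff _).2 (hr.bSum isP_zero), ?_⟩
  rw [bSum_castM, castM_castM] at h4
  rw [bSum_assoc, bSum_assoc, castM_castM]
  exact h4

lemma K0Eq_of_cls {x y : K0Cycle B} (hx : IsK0Cycle Set.univ x) (hy : IsK0Cycle Set.univ y) (h : cls x = cls y) :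
    K0Eq Set.univ x y := RelGen.rel (K0Rel_of_cls hx hy h)

lemma isK0_blk {x y : K0Cycle B} (hx : IsK0Cycle Set.univ x) (hy : IsK0Cycle Set.univ y) :
    IsK0Cycle Set.univ (k0blk x y) := by
  refine ⟨(isProjM_iff _).2 (((isProjM_iff _).1 hx.1).bSum ((isProjM_iff _).1 hy.1)),
    (isProjM_iff _).2 (((isProjM_iff _).1 hx.2.1).bSum ((isProjM_iff _).1 hy.2.1)), ?_⟩
  intro i j
  show (_root_.bSum x.2.1 y.2.1 i j).fst = (_root_.bSum x.2.2 y.2.2 i j).fst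
  refine (congrArg (fun z : Unitization ℂ B => z.fst) (bSum_val x.2.1 y.2.1 i j)).trans (Eq.trans ?_ (congrArg (fun z : Unitization ℂ B => z.fst) (bSum_val x.2.2 y.2.2 i j)).symm)
  split_ifs
  · exact hx.2.2 _ _
  · exact hy.2.2 _ _
  · rfl

lemma cls_blk {x y : K0Cycle B} (hx : IsK0Cycle Set.univ x) (hy : IsK0Cycle Set.univ y) :
    cls (k0blk x y) = cls x + cls y := by
  show pc (_root_.bSum x.2.1 y.2.1) - pc (_root_.bSum x.2.2 y.2.2) = _
  rw [pc_bSum ((isProjM_iff _).1 hx.1) ((isProjM_iff _).1 hy.1),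
    pc_bSum ((isProjM_iff _).1 hx.2.1) ((isProjM_iff _).1 hy.2.1), cls, cls]
  abel

variable (B) in
/-- The subgroup of classes of cycles. -/
def I0 : AddSubgroup (KG (Unitization ℂ B)) where
  carrier := {z | ∃ x : K0Cycle B, IsK0Cycle Set.univ x ∧ cls x = z}
  add_mem' := by
    rintro _ _ ⟨x, hx, rfl⟩ ⟨y, hy, rfl⟩
    exact ⟨k0blk x y, isK0_blk hx hy, cls_blk hx hy⟩
  zero_mem' := ⟨⟨0, 0, 0⟩, ⟨(isProjM_iff _).2 isP_zero, (isProjM_iff _).2 isP_zero, fun _ _ => rfl⟩, sub_self _⟩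
  neg_mem' := by
    rintro _ ⟨x, hx, rfl⟩
    exact ⟨⟨x.1, x.2.2, x.2.1⟩, ⟨hx.2.1, hx.1, fun i j => (hx.2.2 i j).symm⟩, (neg_sub _ _).symm⟩
end Htpy
end KT

namespace OG
section MuZero
variable {Γ X : Type} [Group Γ] [Countable Γ] [TopologicalSpace X] [CompactSpace X] [T2Space X]
  [TotallyDisconnectedSpace X] [SecondCountableTopology X] [MulAction Γ X] [ContinuousConstSMul Γ X] [OpenFix Γ X]

/-- Pushing a 1-chain to the unit space along an endpoint map. -/
def S0 (i : Fin 2) : Ch Γ C(X, ℤ) 2 →+ C(X, ℤ) := Finsupp.liftAddHom fun g => shm (g i)⁻¹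

lemma S0_sg (i : Fin 2) (g : Fin 2 → Γ) (m : C(X, ℤ)) : S0 i (Finsupp.single g m) = shm (g i)⁻¹ m := by
  unfold S0
  rw [Finsupp.liftAddHom_apply_single]

lemma push0 (ep : OG Γ X → X) (i : Fin 2) (hep : ∀ (g : Fin 2 → Γ) x, ep (eC (n := 0) g x 0) = g i • x) (z : X)
    (c : Ch Γ C(X, ℤ) 2) :
    ({x : ↥((D Γ X).Comps 1) | ep (x.1 0) = z} ∩ support (Th Γ X 0 c)).Finite ∧
    ∑ᶠ x ∈ {x : ↥((D Γ X).Comps 1) | ep (x.1 0) = z}, Th Γ X 0 c x = S0 i c z := by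
  induction c using Finsupp.induction_linear with
  | zero => simp
  | add a b ha hb =>
    constructor
    · refine (ha.1.union hb.1).subset ?_
      rw [← Set.inter_union_distrib_left, map_add]
      exact Set.inter_subset_inter_right _ (Function.support_add _ _)
    · rw [map_add, map_add, ContinuousMap.add_apply, ← ha.2, ← hb.2, ← finsum_mem_add_distrib' ha.1 hb.1]
      rfl
  | single g m =>
    have key : ∀ x : ↥((D Γ X).Comps 1), ep (x.1 0) = z →
        Th Γ X 0 (sg g m) x ≠ 0 → x = ⟨eC (n := 0) g ((g i)⁻¹ • z), eC_mem _ _⟩ := by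
      intro x hx hne
      rw [Th_sg] at hne
      obtain ⟨y, hy⟩ := Tg_ne hne
      rw [← hy, hep] at hx
      apply Subtype.ext
      rw [← hy, ← hx, inv_smul_smul]
    constructor
    · refine (Set.finite_singleton (⟨eC (n := 0) g ((g i)⁻¹ • z), eC_mem _ _⟩ : ↥((D Γ X).Comps 1))).subset ?_
      rintro x ⟨hx, hne⟩
      exact key x hx hne
    · rw [S0_sg, shm_apply]
      show ∑ᶠ x ∈ {x : ↥((D Γ X).Comps 1) | ep (x.1 0) = z}, Th Γ X 0 (sg g m) x = _
      have hmem : (⟨eC (n := 0) g ((g i)⁻¹ • z), eC_mem _ _⟩ : ↥((D Γ X).Comps 1)) ∈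
          {x : ↥((D Γ X).Comps 1) | ep (x.1 0) = z} := by
        show ep _ = _
        rw [hep, smul_inv_smul]
      rw [finsum_eq_single _ _ (fun x hne => ?_), finsum_eq_if, if_pos hmem, Th_sg, Tg_eC]
      rw [finsum_eq_if]
      split_ifs with hx
      · by_contra hc
        exact hne (key x hx hc)
      · rfl

variable (Γ X) in
/-- Units as points of the degree zero space. -/
def un (x : X) : (D Γ X).MSp 0 := ⟨arr 1 x, x, rfl⟩

variable (Γ X) in
lemma un_cont : Continuous (un Γ X) := Continuous.subtype_mk (arr_continuous (1 : Γ)) _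

lemma mBdry0 (c : Ch Γ C(X, ℤ) 2) (z : X) :
    (D Γ X).mBdry 0 (Th Γ X 0 c) (un Γ X z) = S0 1 c z - S0 0 c z := by
  rw [← (push0 src 1 (fun _ _ => rfl) z c).2, ← (push0 rng 0 (fun g x => rng_eC g x 0) z c).2]
  have e : ∀ (w : X), arr (1 : Γ) w = arr (1 : Γ) z ↔ w = z := fun w => ⟨fun h => congrArg src h, fun h => by rw [h]⟩
  have e1 : {x : ↥((D Γ X).Comps 1) | (D Γ X).source (x.1 0) = (un Γ X z).1} =
      {x : ↥((D Γ X).Comps 1) | src (x.1 0) = z} := Set.ext fun x => e _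
  have e2 : {x : ↥((D Γ X).Comps 1) | (D Γ X).range (x.1 0) = (un Γ X z).1} =
      {x : ↥((D Γ X).Comps 1) | rng (x.1 0) = z} := Set.ext fun x => e _
  rw [← e1, ← e2]
  rfl

lemma indC_cont {V : Set X} (hV : IsClopen V) : Continuous (indC V) := by
  unfold indC
  refine Continuous.if ?_ continuous_const continuous_const
  intro v hv
  have hv : v ∈ frontier V := hv
  rw [hV.frontier_eq] at hv
  exact absurd hv (Set.notMem_empty _)

variable {B : Type} [NonUnitalNormedRing B] [StarRing B] [NormedSpace ℂ B]
  [IsScalarTower ℂ B B] [SMulCommClass ℂ B B] [StarModule ℂ B] (ρ : (D Γ X).RedCStarRep B)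
open Matrix KT

/-- One by one matrices from the groupoid algebra. -/
def jm (γ : Γ) (m : X → ℂ) : Matrix (Fin 1) (Fin 1) (Unitization ℂ B) :=
  Matrix.of fun _ _ => (Unitization.inr (ρ.j (aG γ m)) : Unitization ℂ B)

lemma jm_mul (γ δ : Γ) (m m' : X → ℂ) (hm : Continuous m) (hm' : Continuous m') :
    jm ρ γ m * jm ρ δ m' = jm ρ (γ * δ) (fun x => m (δ • x) * m' x) := by
  ext i j : 1
  rw [Matrix.mul_apply, Fin.sum_univ_one]
  show (Unitization.inr (ρ.j (aG γ m)) : Unitization ℂ B) * Unitization.inr (ρ.j (aG δ m')) = Unitization.inr _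
  rw [← convC_aG_aG, ρ.j_mul _ (aG_cc γ m hm) _ (aG_cc δ m' hm'), Unitization.inr_mul]

lemma jm_star (γ : Γ) (m : X → ℂ) (hm : Continuous m) :
    (jm ρ γ m)ᴴ = jm ρ γ⁻¹ (fun x => starRingEnd ℂ (m (γ⁻¹ • x))) := by
  ext i j : 1
  show star (Unitization.inr (ρ.j (aG γ m)) : Unitization ℂ B) = Unitization.inr _
  rw [← starC_aG, ρ.j_star _ (aG_cc γ m hm), Unitization.inr_star]

lemma jm_add (γ : Γ) (m m' : X → ℂ) (hm : Continuous m) (hm' : Continuous m') :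
    jm ρ γ (m + m') = jm ρ γ m + jm ρ γ m' := by
  ext i j : 1
  show (Unitization.inr _ : Unitization ℂ B) = Unitization.inr (ρ.j (aG γ m)) + Unitization.inr (ρ.j (aG γ m'))
  rw [← Unitization.inr_add, ← ρ.j_add _ (aG_cc γ m hm) _ (aG_cc γ m' hm')]
  congr 2
  funext g
  simp only [aG, Pi.add_apply]
  split_ifs <;> simp

lemma j_zero : ρ.j 0 = 0 := by
  have := ρ.j_smul 0 0 ((ccCSub _).zero_mem)
  rwa [zero_smul, zero_smul] at this

lemma jm_zero (γ : Γ) : jm ρ γ (fun _ => 0) = 0 := by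
  ext i j : 1
  show (Unitization.inr (ρ.j (aG γ _)) : Unitization ℂ B) = 0
  have : aG γ (fun _ : X => (0 : ℂ)) = 0 := by funext g; simp [aG]
  rw [this, j_zero, Unitization.inr_zero]

/-- The projection of a clopen set. -/
def prj (V : Set X) : Matrix (Fin 1) (Fin 1) (Unitization ℂ B) := jm ρ 1 (indC V)

lemma prj_mul {V W : Set X} (hV : IsClopen V) (hW : IsClopen W) : prj ρ V * prj ρ W = prj ρ (V ∩ W) := by
  rw [prj, prj, jm_mul _ _ _ _ _ (indC_cont hV) (indC_cont hW), one_mul, prj]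
  congr 1
  funext x
  rw [one_smul]
  by_cases h : x ∈ V <;> by_cases h' : x ∈ W <;> simp [indC, h, h']

lemma prj_star {V : Set X} (hV : IsClopen V) : (prj ρ V)ᴴ = prj ρ V := by
  rw [prj, jm_star _ _ _ (indC_cont hV), inv_one]
  congr 1
  funext x
  rw [one_smul]
  by_cases h : x ∈ V <;> simp [indC, h]

lemma prj_isP {V : Set X} (hV : IsClopen V) : IsP (prj ρ V) := ⟨by rw [prj_mul ρ hV hV, Set.inter_self], prj_star ρ hV⟩

lemma prj_empty : prj ρ ∅ = 0 := by
  rw [prj, ← jm_zero ρ 1]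
  congr 1
  funext x
  simp [indC]

lemma prj_union {V W : Set X} (hV : IsClopen V) (hW : IsClopen W) (hd : Disjoint V W) :
    prj ρ (V ∪ W) = prj ρ V + prj ρ W := by
  rw [prj, prj, prj, ← jm_add _ _ _ _ (indC_cont hV) (indC_cont hW)]
  congr 1
  funext x
  by_cases h : x ∈ V
  · have h' : x ∉ W := Set.disjoint_left.1 hd h
    simp [indC, h, h']
  · by_cases h' : x ∈ W <;> simp [indC, h, h']

/-- The class of a clopen set. -/
def nu (V : Set X) : KG (Unitization ℂ B) := pc (prj ρ V)

lemma nu_empty : nu ρ ∅ = 0 := by rw [nu, prj_empty, pc_zero]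

lemma nu_union {V W : Set X} (hV : IsClopen V) (hW : IsClopen W) (hd : Disjoint V W) :
    nu ρ (V ∪ W) = nu ρ V + nu ρ W := by
  have p1 := prj_isP ρ hV
  have p2 := prj_isP ρ hW
  have p3 := prj_isP ρ (hV.union hW)
  rw [nu, nu, nu, ← pc_bSum p1 p2]
  refine pc_congr p3 (p1.bSum p2) (MvN.trans p3 (p1.bSum p2) (q := fromBlocks (prj ρ V) 0 0 (prj ρ W)) ?_ (MvN.bSum' p1 p2))
  refine ⟨fromCols (prj ρ V) (prj ρ W), ?_, ?_⟩
  · rw [conjTranspose_fromCols_eq_fromRows_conjTranspose, fromCols_mul_fromRows, p1.2, p2.2, p1.1, p2.1, prj_union ρ hV hW hd]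
  · rw [conjTranspose_fromCols_eq_fromRows_conjTranspose, fromRows_mul_fromCols, p1.2, p2.2, p1.1, p2.1,
      prj_mul ρ hV hW, prj_mul ρ hW hV, Set.inter_comm W, Set.disjoint_iff_inter_eq_empty.1 hd, prj_empty]

lemma clopen_pre {V : Set X} (hV : IsClopen V) (γ : Γ) : IsClopen ((fun x => γ • x) ⁻¹' V) :=
  hV.preimage (continuous_const_smul γ)

lemma nu_smul {V : Set X} (hV : IsClopen V) (γ : Γ) : nu ρ ((fun x => γ • x) ⁻¹' V) = nu ρ V := by
  have p1 := prj_isP ρ hV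
  have p2 := prj_isP ρ (clopen_pre hV γ)
  have hc : Continuous fun x => starRingEnd ℂ (indC V (γ⁻¹⁻¹ • x)) :=
    Complex.continuous_conj.comp ((indC_cont hV).comp (continuous_const_smul _))
  refine pc_congr p2 p1 ⟨jm ρ γ⁻¹ (indC V), ?_, ?_⟩
  · rw [jm_star _ _ _ (indC_cont hV), jm_mul _ _ _ _ _ (indC_cont hV) hc, prj, inv_inv, inv_mul_cancel]
    congr 1
    funext x
    by_cases h : γ • x ∈ V <;> simp [indC, h]
  · rw [jm_star _ _ _ (indC_cont hV), jm_mul _ _ _ _ _ hc (indC_cont hV), prj, inv_inv, mul_inv_cancel]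
    congr 1
    funext x
    by_cases h : x ∈ V <;> simp [indC, h]

lemma nu_fin {Z : Type} [TopologicalSpace Z] [DiscreteTopology Z] (π : X → Z) (hπ : Continuous π) (s : Finset Z) :
    nu ρ (π ⁻¹' (s : Set Z)) = ∑ i ∈ s, nu ρ (π ⁻¹' {i}) := by
  induction s using Finset.induction_on with
  | empty => simp [nu_empty]
  | insert i s hi ih =>
    rw [Finset.sum_insert hi, ← ih, ← nu_union ρ ((isClopen_discrete _).preimage hπ) ((isClopen_discrete _).preimage hπ),
      Finset.coe_insert, Set.insert_eq, Set.preimage_union]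
    refine Disjoint.preimage _ ?_
    rw [Set.disjoint_singleton_left]
    exact_mod_cast hi

lemma nu_cov {Z : Type} [TopologicalSpace Z] [DiscreteTopology Z] (π : X → Z) (hπ : Continuous π) (s : Finset Z)
    (hs : ∀ x, π x ∈ s) (t : Set Z) : nu ρ (π ⁻¹' t) = ∑ i ∈ s.filter (fun i => i ∈ t), nu ρ (π ⁻¹' {i}) := by
  rw [← nu_fin ρ π hπ]
  congr 1
  ext x
  simp [hs]

/-- The homomorphism on functions. -/
def Psi (f : X → ℤ) : KG (Unitization ℂ B) := ∑ᶠ c : ℤ, c • nu ρ (f ⁻¹' {c})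

lemma Psi_eq {Z : Type} [TopologicalSpace Z] [DiscreteTopology Z] (π : X → Z) (hπ : Continuous π) (s : Finset Z)
    (hs : ∀ x, π x ∈ s) (h : Z → ℤ) : Psi ρ (fun x => h (π x)) = ∑ i ∈ s, h i • nu ρ (π ⁻¹' {i}) := by
  rw [Psi, finsum_eq_sum_of_support_subset (s := s.image h)]
  · rw [← Finset.sum_fiberwise_of_maps_to (g := h) (t := s.image h) (fun i hi => Finset.mem_image_of_mem h hi)]
    refine Finset.sum_congr rfl fun c _ => ?_
    have e : (fun x => h (π x)) ⁻¹' {c} = π ⁻¹' (h ⁻¹' {c}) := rfl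
    rw [e, nu_cov ρ π hπ s hs, Finset.smul_sum]
    refine Finset.sum_congr ?_ fun i hi => ?_
    · ext i; simp
    · rw [(Finset.mem_filter.1 hi).2]
  · intro c hc
    by_contra hn
    apply hc
    have : (fun x => h (π x)) ⁻¹' {c} = ∅ := by
      rw [Set.eq_empty_iff_forall_notMem]
      intro x hx
      apply hn
      have hx : h (π x) = c := hx
      rw [← hx]
      exact Finset.mem_coe.2 (Finset.mem_image_of_mem h (hs x))
    show c • nu ρ _ = 0
    rw [this, nu_empty, smul_zero]

lemma fin_range {Z : Type} [TopologicalSpace Z] [DiscreteTopology Z] (π : X → Z) (hπ : Continuous π) :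
    ∃ s : Finset Z, ∀ x, π x ∈ s := by
  have h : (Set.range π).Finite := (isCompact_range hπ).finite_of_discrete
  exact ⟨h.toFinset, fun x => h.mem_toFinset.2 ⟨x, rfl⟩⟩

lemma Psi_add (f g : X → ℤ) (hf : Continuous f) (hg : Continuous g) : Psi ρ (f + g) = Psi ρ f + Psi ρ g := by
  have hc : Continuous fun x => (f x, g x) := hf.prodMk hg
  obtain ⟨s, hs⟩ := fin_range _ hc
  have h1 := Psi_eq ρ _ hc s hs (fun i => i.1 + i.2)
  have h2 := Psi_eq ρ _ hc s hs (fun i => i.1)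
  have h3 := Psi_eq ρ _ hc s hs (fun i => i.2)
  have e1 : f + g = fun x => (fun i : ℤ × ℤ => i.1 + i.2) ((fun x => (f x, g x)) x) := rfl
  have e2 : Psi ρ f = Psi ρ (fun x => (fun i : ℤ × ℤ => i.1) ((fun x => (f x, g x)) x)) := rfl
  have e3 : Psi ρ g = Psi ρ (fun x => (fun i : ℤ × ℤ => i.2) ((fun x => (f x, g x)) x)) := rfl
  rw [e1, h1, e2, h2, e3, h3, ← Finset.sum_add_distrib]
  exact Finset.sum_congr rfl fun i _ => add_smul _ _ _

/-- The homomorphism on continuous functions. -/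
def PsiH : C(X, ℤ) →+ KG (Unitization ℂ B) := AddMonoidHom.mk' (fun f => Psi ρ f) fun f g => Psi_add ρ f g f.2 g.2

lemma PsiH_shm (h : Γ) (f : C(X, ℤ)) : PsiH ρ (shm h f) = PsiH ρ f := by
  show ∑ᶠ c : ℤ, c • nu ρ _ = ∑ᶠ c : ℤ, c • nu ρ _
  refine finsum_congr fun c => ?_
  rw [← nu_smul ρ (V := f ⁻¹' {c}) ((isClopen_discrete _).preimage f.2) h]
  rfl

lemma PsiH_S0 (c : Ch Γ C(X, ℤ) 2) : PsiH ρ (S0 1 c) = PsiH ρ (S0 0 c) := by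
  refine ch_hom_ext (f := (PsiH ρ).comp (S0 1)) (f' := (PsiH ρ).comp (S0 0)) (fun g m => ?_) c
  show PsiH ρ (S0 1 (Finsupp.single g m)) = PsiH ρ (S0 0 (Finsupp.single g m))
  rw [S0_sg, S0_sg, PsiH_shm, PsiH_shm]

lemma Psi_ind {V : Set X} (hV : IsClopen V) : Psi ρ (indZ V) = nu ρ V := by
  rw [Psi, finsum_eq_single _ 1]
  · rw [one_smul]
    congr 1
    ext x
    by_cases h : x ∈ V <;> simp [indZ, h]
  · intro c hc
    by_cases h0 : c = 0
    · rw [h0, zero_smul]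
    · have : indZ V ⁻¹' {c} = ∅ := by
        rw [Set.eq_empty_iff_forall_notMem]
        intro x hx
        have hx : indZ V x = c := hx
        by_cases h : x ∈ V
        · simp [indZ, h] at hx; exact hc hx.symm
        · simp [indZ, h] at hx; exact h0 hx.symm
      rw [this, nu_empty, smul_zero]

/-- Restriction of cycles to the space. -/
def toX : (D Γ X).mCycles 0 →+ C(X, ℤ) where
  toFun a := ⟨fun x => a.1 (un Γ X x), (show a.1 ∈ ccZ _ from a.2).1.comp (un_cont Γ X)⟩
  map_zero' := rfl
  map_add' _ _ := rfl

lemma bd_ker (a : (D Γ X).mCycles 0) (h : a.1 ∈ (D Γ X).mBdries 0) : PsiH ρ (toX a) = 0 := by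
  have hle : (D Γ X).mBdries 0 ≤ AddSubgroup.map ((D Γ X).mCycles 0).subtype ((PsiH ρ).comp toX).ker := by
    unfold GroupoidData.mBdries
    rw [AddSubgroup.closure_le]
    rintro _ ⟨f, hf, rfl⟩
    obtain ⟨c, rfl⟩ := Th_surj (n := 0) f hf
    have e : ∀ u : (D Γ X).MSp 0, ∃ z, u = un Γ X z := by
      rintro ⟨_, z, rfl⟩; exact ⟨z, rfl⟩
    have hcyc : (D Γ X).mBdry 0 (Th Γ X 0 c) ∈ (D Γ X).mCycles 0 := by
      show _ ∈ ccZ _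
      have h1 : (D Γ X).mBdry 0 (Th Γ X 0 c) = fun u : (D Γ X).MSp 0 => (S0 1 c - S0 0 c) (src u.1) := by
        funext u
        obtain ⟨z, rfl⟩ := e u
        rw [mBdry0]; rfl
      rw [h1]
      constructor
      · exact (S0 1 c - S0 0 c).2.comp (src_cont.comp continuous_subtype_val)
      · have : CompactSpace ((D Γ X).MSp 0) := isCompact_iff_compactSpace.1 (isCompact_range (arr_continuous (X := X) (1 : Γ)))
        exact HasCompactSupport.of_compactSpace _
    refine ⟨⟨_, hcyc⟩, ?_, rfl⟩
    show PsiH ρ (toX _) = 0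
    have h2 : toX ⟨_, hcyc⟩ = S0 1 c - S0 0 c := by
      refine ContinuousMap.ext fun z => ?_
      exact mBdry0 c z
    rw [h2, map_sub, PsiH_S0, sub_self]
  obtain ⟨b, hb, e⟩ := hle h
  have : b = a := Subtype.ext e
  rw [← this]
  exact hb

/-- The homomorphism on homology. -/
def PsiQ : (D Γ X).Homology 0 →+ KG (Unitization ℂ B) :=
  QuotientAddGroup.lift _ ((PsiH ρ).comp toX) (fun a ha => bd_ker ρ a ha)

lemma nu_I0 {V : Set X} (hV : IsClopen V) : IsK0Cycle Set.univ (⟨1, prj ρ V, 0⟩ : K0Cycle B) ∧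
    cls (⟨1, prj ρ V, 0⟩ : K0Cycle B) = nu ρ V := by
  refine ⟨⟨(isProjM_iff _).2 (prj_isP ρ hV), (isProjM_iff _).2 isP_zero, fun _ _ => rfl⟩, ?_⟩
  show pc _ - pc 0 = _
  rw [pc_zero, sub_zero]; rfl

lemma PsiQ_mem (x : (D Γ X).Homology 0) : PsiQ ρ x ∈ I0 B := by
  induction x using QuotientAddGroup.induction_on with
  | H a =>
    show Psi ρ (toX a) ∈ I0 B
    rw [Psi]
    refine finsum_induction (· ∈ I0 B) (I0 B).zero_mem (fun _ _ => (I0 B).add_mem) fun c => ?_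
    refine (I0 B).zsmul_mem ⟨_, nu_I0 ρ ((isClopen_discrete _).preimage (toX a).2)⟩ c

theorem exists_mu0 : ∃ μ0 : (D Γ X).Homology 0 → K0Cycle B, (D Γ X).IsMu0 ρ μ0 := by
  choose μ h1 h2 using PsiQ_mem ρ
  refine ⟨μ, h1, fun x y => ?_, fun V hc ho hu hV => ?_⟩
  · refine K0Eq_of_cls (h1 _) (isK0_blk (h1 _) (h1 _)) ?_
    rw [cls_blk (h1 _) (h1 _), h2, h2, h2, map_add]
  · have hW : IsClopen (arr (1 : Γ) ⁻¹' V) := ⟨hc.isClosed.preimage (arr_continuous _), ho.preimage (arr_continuous _)⟩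
    have e : indC V = aG (1 : Γ) (indC (arr (1 : Γ) ⁻¹' V)) := by
      funext g
      rw [aG, one_smul]
      by_cases hg : rng g = src g
      · rw [if_pos hg]
        have : arr (1 : Γ) (src g) = g := ext' (by rw [rng_arr, one_smul, hg]) rfl
        by_cases h : g ∈ V
        · simp [indC, this, h]
        · simp [indC, this, h]
      · rw [if_neg hg, indC, if_neg]
        intro h
        obtain ⟨x, rfl⟩ := hu h
        exact hg (by simp)
    have e2 : (⟨1, Matrix.of fun _ _ => (Unitization.inr (ρ.j (indC V)) : Unitization ℂ B), 0⟩ : K0Cycle B) =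
        ⟨1, prj ρ (arr (1 : Γ) ⁻¹' V), 0⟩ := by rw [e]; rfl
    rw [e2]
    refine K0Eq_of_cls (h1 _) (nu_I0 ρ hW).1 ?_
    rw [h2, (nu_I0 ρ hW).2, ← Psi_ind ρ hW]
    rfl
end MuZero
end OG

namespace OG
section RedNorm
variable {Γ X : Type} [Group Γ] [Countable Γ] [TopologicalSpace X] [CompactSpace X] [T2Space X]
  [TotallyDisconnectedSpace X] [SecondCountableTopology X] [MulAction Γ X] [ContinuousConstSMul Γ X] [OpenFix Γ X]

/-- the squared `ℓ²` norm -/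
def sq2 {Y : Type} (ξ : Y → ℂ) : ℝ := ∑ᶠ y, ‖ξ y‖ ^ 2

lemma sq2_nonneg {Y : Type} (ξ : Y → ℂ) : 0 ≤ sq2 ξ := finsum_nonneg fun _ => sq_nonneg _

lemma fsum_mono {Y : Type} (f g : Y → ℝ) (hf : (support f).Finite) (hg : (support g).Finite) (h : ∀ y, f y ≤ g y) :
    ∑ᶠ y, f y ≤ ∑ᶠ y, g y := by
  rw [finsum_eq_sum_of_support_subset f (s := (hf.union hg).toFinset) (by simp),
    finsum_eq_sum_of_support_subset g (s := (hf.union hg).toFinset) (by simp)]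
  exact Finset.sum_le_sum fun y _ => h y

lemma conv_bound (s : Finset Γ) (m : Γ → X → ℂ) (M : ℝ) (hM : ∀ γ ∈ s, ∀ x, ‖m γ x‖ ≤ M) (ξ : OG Γ X → ℂ)
    (hξ : (support ξ).Finite) :
    (support ((D Γ X).convC (PF s m) ξ)).Finite ∧
    sq2 ((D Γ X).convC (PF s m) ξ) ≤ (s.card * M) ^ 2 * sq2 ξ := by
  have hfin : ∀ γ : Γ, (support fun g => ξ (lsh γ⁻¹ g)).Finite := by
    intro γ
    have : (support fun g => ξ (lsh γ⁻¹ g)) = (lshE (X := X) γ⁻¹) ⁻¹' (support ξ) := rfl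
    rw [this]
    exact hξ.preimage (lshE γ⁻¹).injective.injOn
  have hU : (⋃ γ ∈ s, support fun g => ξ (lsh γ⁻¹ g)).Finite := s.finite_toSet.biUnion fun γ _ => hfin γ
  have hsub : support ((D Γ X).convC (PF s m) ξ) ⊆ ⋃ γ ∈ s, support fun g => ξ (lsh γ⁻¹ g) := by
    intro g hg
    rw [mem_support, convC_PF] at hg
    obtain ⟨γ, h1, h2⟩ := Finset.exists_ne_zero_of_sum_ne_zero hg
    exact Set.mem_biUnion h1 (right_ne_zero_of_mul h2)
  refine ⟨hU.subset hsub, ?_⟩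
  have hs2 : ∀ (f : OG Γ X → ℂ), (support fun g => ‖f g‖ ^ 2) = support f := by
    intro f; ext g; simp
  have h1 : ∀ g, ‖(D Γ X).convC (PF s m) ξ g‖ ^ 2 ≤ (s.card * M ^ 2) * ∑ γ ∈ s, ‖ξ (lsh γ⁻¹ g)‖ ^ 2 := by
    intro g
    rw [convC_PF]
    calc ‖∑ γ ∈ s, m γ (γ⁻¹ • rng g) * ξ (lsh γ⁻¹ g)‖ ^ 2
        ≤ (∑ γ ∈ s, ‖m γ (γ⁻¹ • rng g) * ξ (lsh γ⁻¹ g)‖) ^ 2 := by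
          gcongr; exact norm_sum_le _ _
      _ ≤ s.card * ∑ γ ∈ s, ‖m γ (γ⁻¹ • rng g) * ξ (lsh γ⁻¹ g)‖ ^ 2 := sq_sum_le_card_mul_sum_sq
      _ ≤ s.card * ∑ γ ∈ s, M ^ 2 * ‖ξ (lsh γ⁻¹ g)‖ ^ 2 := by
          gcongr with γ hγ
          rw [norm_mul, mul_pow]
          gcongr
          exact hM γ hγ _
      _ = _ := by rw [← Finset.mul_sum]; ring
  have h2 : sq2 ((D Γ X).convC (PF s m) ξ) ≤ ∑ᶠ g, (s.card * M ^ 2) * ∑ γ ∈ s, ‖ξ (lsh γ⁻¹ g)‖ ^ 2 := by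
    refine fsum_mono _ _ ?_ ?_ h1
    · show (support _).Finite
      rw [hs2]; exact hU.subset hsub
    · show (support _).Finite
      refine hU.subset ?_
      intro g hg
      obtain ⟨γ, h1, h2⟩ := Finset.exists_ne_zero_of_sum_ne_zero (right_ne_zero_of_mul hg)
      exact Set.mem_biUnion h1 (by simpa using h2)
  refine h2.trans (le_of_eq ?_)
  have hfin2 : ∀ γ ∈ s, (support fun g => ‖ξ (lsh γ⁻¹ g)‖ ^ 2).Finite := by
    intro γ _; rw [hs2 (fun g => ξ (lsh γ⁻¹ g))]; exact hfin γ
  rw [← mul_finsum, finsum_sum_comm _ _ hfin2]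
  · have : ∀ γ ∈ s, ∑ᶠ g, ‖ξ (lsh γ⁻¹ g)‖ ^ 2 = sq2 ξ := fun γ _ =>
      finsum_comp_equiv (lshE (X := X) γ⁻¹) (f := fun g => ‖ξ g‖ ^ 2)
    rw [Finset.sum_congr rfl this, Finset.sum_const, nsmul_eq_mul]
    ring

lemma l2_eq {Y : Type} (ξ : Y → ℂ) : GroupoidData.l2norm ξ = Real.sqrt (sq2 ξ) := rfl

lemma l2_bound {Y : Type} (ξ η : Y → ℂ) (C : ℝ) (hC : 0 ≤ C) (h : sq2 ξ ≤ C ^ 2 * sq2 η)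
    (h1 : GroupoidData.l2norm η ≤ 1) : GroupoidData.l2norm ξ ≤ C := by
  rw [l2_eq] at *
  have : sq2 η ≤ 1 := by
    rw [← Real.sqrt_one] at h1
    exact (Real.sqrt_le_sqrt_iff (by norm_num)).1 h1
  refine Real.sqrt_le_iff.2 ⟨hC, h.trans ?_⟩
  have := sq_nonneg C
  nlinarith [sq2_nonneg η]

lemma redNorm_le (f : OG Γ X → ℂ) (C : ℝ) (hC : 0 ≤ C)
    (h : ∀ x (ξ : OG Γ X → ℂ), (support ξ).Finite → (∀ g, ξ g ≠ 0 → src g = x) →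
      sq2 ((D Γ X).convC f ξ) ≤ C ^ 2 * sq2 ξ) : (D Γ X).redNorm f ≤ C := by
  refine Real.sSup_le ?_ hC
  rintro _ ⟨x, ⟨y, rfl⟩, rfl⟩
  refine Real.sSup_le ?_ hC
  rintro _ ⟨ξ, h1, h2, h3, rfl⟩
  refine l2_bound _ ξ C hC (h y ξ h1 fun g hg => ?_) h3
  have := h2 g hg
  exact congrArg src this

lemma cc_bdd (f : OG Γ X → ℂ) (hf : f ∈ ccC (OG Γ X)) : ∃ C : ℝ, 0 ≤ C ∧ ∀ ξ : OG Γ X → ℂ, (support ξ).Finite →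
    (support ((D Γ X).convC f ξ)).Finite ∧ sq2 ((D Γ X).convC f ξ) ≤ C ^ 2 * sq2 ξ := by
  obtain ⟨s, m, hm, rfl⟩ := cc_PF f hf
  have : ∀ γ, ∃ M, ∀ x, ‖m γ x‖ ≤ M := by
    intro γ
    obtain ⟨M, hM⟩ := isCompact_univ.exists_bound_of_continuousOn (hm γ).continuousOn
    exact ⟨M, fun x => hM x trivial⟩
  choose M hM using this
  refine ⟨s.card * ∑ γ ∈ s, |M γ|, by positivity, fun ξ hξ => conv_bound s m _ (fun γ hγ x => ?_) ξ hξ⟩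
  exact ((hM γ x).trans (le_abs_self _)).trans (Finset.single_le_sum (f := fun γ => |M γ|) (fun _ _ => abs_nonneg _) hγ)

lemma le_redNorm (f : OG Γ X → ℂ) (hf : f ∈ ccC (OG Γ X)) (g : OG Γ X) : ‖f g‖ ≤ (D Γ X).redNorm f := by
  obtain ⟨C, hC, hb⟩ := cc_bdd f hf
  have hbd1 : ∀ x, ∀ c ∈ {c | ∃ ξ : OG Γ X → ℂ, (Function.support ξ).Finite ∧ (∀ g, ξ g ≠ 0 → (D Γ X).source g = x) ∧
    GroupoidData.l2norm ξ ≤ 1 ∧ c = GroupoidData.l2norm ((D Γ X).convC f ξ)}, c ≤ C := by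
    rintro x _ ⟨ξ, h1, h2, h3, rfl⟩
    exact l2_bound _ ξ C hC (hb ξ h1).2 h3
  have hop : ∀ x, (D Γ X).opNormAt x f ≤ C := fun x => Real.sSup_le (hbd1 x) hC
  let ξ : OG Γ X → ℂ := fun h => if h = arr 1 (src g) then 1 else 0
  have hξs : support ξ ⊆ {arr 1 (src g)} := by
    intro h hh
    by_contra hne
    exact hh (if_neg hne)
  have hξf : (support ξ).Finite := (Set.finite_singleton _).subset hξs
  have hξ1 : sq2 ξ = 1 := by
    unfold sq2
    rw [finsum_eq_single _ (arr 1 (src g))]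
    · simp [ξ]
    · intro h hh; simp [ξ, hh]
  have h1 : GroupoidData.l2norm ((D Γ X).convC f ξ) ≤ (D Γ X).opNormAt (arr 1 (src g)) f := by
    refine le_csSup ⟨C, hbd1 _⟩ ⟨ξ, hξf, ?_, by rw [l2_eq, hξ1, Real.sqrt_one], rfl⟩
    intro h hh
    rw [hξs hh]; rfl
  have h2 : (D Γ X).opNormAt (arr 1 (src g)) f ≤ (D Γ X).redNorm f := by
    refine le_csSup ⟨C, ?_⟩ ⟨_, ⟨src g, rfl⟩, rfl⟩
    rintro _ ⟨x, -, rfl⟩; exact hop x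
  refine le_trans ?_ (h1.trans h2)
  have h3 : (D Γ X).convC f ξ g = f g := by
    obtain ⟨s, m, hm, rfl⟩ := cc_PF f hf
    rw [convC_PF, PF]
    refine Finset.sum_congr rfl fun γ _ => ?_
    unfold aG
    by_cases h : rng g = γ • src g
    · have : lsh γ⁻¹ g = arr 1 (src g) := ext' (by simp [h]) rfl
      simp only [ξ, this, if_true, if_pos h, mul_one]
      rw [h, inv_smul_smul]
    · have : lsh γ⁻¹ g ≠ arr 1 (src g) := by
        intro h'
        have := congrArg rng h'
        simp only [rng_lsh, rng_arr, one_smul] at this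
        exact h (by rw [← this, smul_inv_smul])
      simp only [ξ, if_neg this, if_neg h, mul_zero]
  rw [l2_eq]
  refine Real.le_sqrt_of_sq_le ?_
  rw [← h3]
  refine single_le_finsum (M := ℝ) g (f := fun y => ‖(D Γ X).convC f ξ y‖ ^ 2) ?_ (fun _ => sq_nonneg _)
  refine ((hb ξ hξf).1).subset ?_
  intro h hh
  simpa using hh

variable {B : Type} [NonUnitalNormedRing B] [StarRing B] [NormedSpace ℂ B] (ρ : (D Γ X).RedCStarRep B)

/-- the embedding of `C_c(G)` as a linear map -/
def jL : ccCSub (OG Γ X) →ₗ[ℂ] B where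
  toFun f := ρ.j f.1
  map_add' f f' := ρ.j_add _ f.2 _ f'.2
  map_smul' c f := ρ.j_smul c _ f.2

/-- point evaluation on `C_c(G)` -/
def evL (g : OG Γ X) : ccCSub (OG Γ X) →ₗ[ℂ] ℂ where
  toFun f := f.1 g
  map_add' _ _ := rfl
  map_smul' _ _ := rfl

lemma jL_dense : DenseRange (jL ρ) := by
  have : Set.range (jL ρ) = ρ.j '' ccC (OG Γ X) := by
    ext b
    constructor
    · rintro ⟨f, rfl⟩; exact ⟨f.1, f.2, rfl⟩
    · rintro ⟨f, hf, rfl⟩; exact ⟨⟨f, hf⟩, rfl⟩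
  rw [DenseRange, this]
  exact dense_iff_closure_eq.2 ρ.j_dense

/-- point evaluation on the reduced algebra -/
def ev (g : OG Γ X) : B →L[ℂ] ℂ := (evL g).extendOfNorm (jL ρ)

lemma ev_j (g : OG Γ X) (f : OG Γ X → ℂ) (hf : f ∈ ccC (OG Γ X)) : ev ρ g (ρ.j f) = f g :=
  LinearMap.extendOfNorm_eq (f := evL g) (jL_dense ρ) ⟨1, fun f => by
    rw [one_mul]
    show ‖f.1 g‖ ≤ ‖ρ.j f.1‖
    rw [ρ.j_norm _ f.2]
    exact le_redNorm _ f.2 g⟩ ⟨f, hf⟩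

end RedNorm
end OG

namespace Tower
section NormEst
variable {T : Tower}

/-- the level-`n` label of the range of an arrow -/
def lab (n : ℕ) (g : OG T.Γ T.X) : T.Q n := (co (OG.rng g) n).getD 1

lemma rng_none (g : OG T.Γ T.X) (n : ℕ) : co (OG.rng g) n = none ↔ co (OG.src g) n = none := by
  obtain ⟨γ, hγ⟩ := g.2
  have : OG.rng g = γ • OG.src g := hγ
  rw [this, co_smul_none]

lemma lab_some (n : ℕ) (g : OG T.Γ T.X) (h : co (OG.src g) n ≠ none) : co (OG.rng g) n = some (lab n g) := by
  have h' : co (OG.rng g) n ≠ none := fun e => h ((rng_none g n).1 e)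
  obtain ⟨y, hy⟩ := Option.ne_none_iff_exists'.1 h'
  rw [lab, hy]; rfl

lemma lab_lsh (n : ℕ) (γ : T.Γ) (g : OG T.Γ T.X) (h : co (OG.src g) n ≠ none) :
    lab n (OG.lsh γ g) = T.φ n γ * lab n g := by
  have h1 : co (OG.rng (OG.lsh γ g)) n = some (lab n (OG.lsh γ g)) := lab_some n _ h
  rw [OG.rng_lsh, co_smul, lab_some n g h] at h1
  simpa using h1.symm

lemma exists_level (x : T.X) (W : Finset (OG T.Γ T.X)) (hW : ∀ g ∈ W, OG.src g = x) :
    ∃ n, co x n ≠ none ∧ Set.InjOn (lab n) (W : Set (OG T.Γ T.X)) := by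
  have h1 : ∀ p : OG T.Γ T.X × OG T.Γ T.X, ∃ i, (p.1 ∈ W → p.2 ∈ W → p.1 ≠ p.2 → co (OG.rng p.1) i ≠ co (OG.rng p.2) i) ∧
      co x i ≠ none := by
    intro p
    by_cases h : p.1 ∈ W ∧ p.2 ∈ W ∧ p.1 ≠ p.2
    · obtain ⟨ha, hb, hne⟩ := h
      have : ∃ i, co (OG.rng p.1) i ≠ co (OG.rng p.2) i := by
        by_contra hc
        push Not at hc
        exact hne (OG.ext' (X_ext hc) ((hW _ ha).trans (hW _ hb).symm))
      obtain ⟨i, hi⟩ := this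
      refine ⟨i, fun _ _ _ => hi, fun hx => hi ?_⟩
      rw [(rng_none p.1 i).2 (by rw [hW _ ha, hx]), (rng_none p.2 i).2 (by rw [hW _ hb, hx])]
    · exact ⟨0, fun a b c => absurd ⟨a, b, c⟩ h, co_zero x⟩
  choose i hi hi' using h1
  obtain ⟨n, hn, hmax⟩ : ∃ n, co x n ≠ none ∧ ∀ p ∈ W ×ˢ W, i p ≤ n := by
    rcases (W ×ˢ W).eq_empty_or_nonempty with he | hne
    · exact ⟨0, co_zero x, by simp [he]⟩
    · obtain ⟨p, _, hp⟩ := Finset.exists_max_image (W ×ˢ W) i hne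
      exact ⟨i p, hi' p, hp⟩
  refine ⟨n, hn, fun g hg h hh e => ?_⟩
  by_contra hne
  have e1 := lab_some n g (by rwa [hW g hg])
  have e2 := lab_some n h (by rwa [hW h hh])
  have e3 : co (OG.rng g) n = co (OG.rng h) n := by rw [e1, e2, e]
  exact hi (g, h) hg hh hne (co_det _ _ n (by simp [e1]) e3 _ (hmax (g, h) (Finset.mem_product.2 ⟨hg, hh⟩)))

/-- the function on the groupoid attached to a group ring element -/
def Fc (c : MonoidAlgebra ℂ T.Γ) : OG T.Γ T.X → ℂ := OG.PF c.coeff.support (fun γ _ => c.coeff γ)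

lemma Fc_cc (c : MonoidAlgebra ℂ T.Γ) : Fc c ∈ ccC (OG T.Γ T.X) := OG.PF_cc _ _ fun _ _ => continuous_const

lemma Fc_norm (c : MonoidAlgebra ℂ T.Γ) (C : ℝ) (hC : 0 ≤ C)
    (h : ∀ n η, n2 (Lrep (T.φ n) c η) ≤ C ^ 2 * n2 η) : (OG.D T.Γ T.X).redNorm (Fc c) ≤ C := by
  refine OG.redNorm_le _ C hC fun x ξ hξ hx => ?_
  set f := (OG.D T.Γ T.X).convC (Fc c) ξ with hf
  have hfin : (support f).Finite := by
    obtain ⟨_, _, hb⟩ := OG.cc_bdd (Fc c) (Fc_cc c)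
    exact (hb ξ hξ).1
  have hfv : ∀ g, f g = ∑ γ ∈ c.coeff.support, c.coeff γ * ξ (OG.lsh γ⁻¹ g) := fun g => by
    rw [hf, Fc, OG.convC_PF]
  have hfx : ∀ g, f g ≠ 0 → OG.src g = x := by
    intro g hg
    rw [hfv] at hg
    obtain ⟨γ, h1, h2⟩ := Finset.exists_ne_zero_of_sum_ne_zero hg
    exact hx (OG.lsh γ⁻¹ g) (right_ne_zero_of_mul h2)
  let W0 := hfin.toFinset
  let W1 := hξ.toFinset
  let W2 := (W0 ×ˢ c.coeff.support).image fun p => OG.lsh p.2⁻¹ p.1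
  have hW0 : ∀ g ∈ W0, OG.src g = x := fun g hg => hfx g (by simpa [W0] using hg)
  have hW1 : ∀ g ∈ W1, OG.src g = x := fun g hg => hx g (by simpa [W1] using hg)
  have hW2 : ∀ g ∈ W2, OG.src g = x := by
    intro g hg
    obtain ⟨p, hp, rfl⟩ := Finset.mem_image.1 hg
    exact hW0 p.1 (Finset.mem_product.1 hp).1
  obtain ⟨n, hn, hinj⟩ := exists_level x (W0 ∪ W1 ∪ W2) (by
    intro g hg
    rcases Finset.mem_union.1 hg with hg | hg
    · rcases Finset.mem_union.1 hg with hg | hg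
      · exact hW0 g hg
      · exact hW1 g hg
    · exact hW2 g hg)
  let η : T.Q n → ℂ := fun y => ∑ g ∈ W1, if lab n g = y then ξ g else 0
  have hη : ∀ g ∈ W0 ∪ W1 ∪ W2, η (lab n g) = ξ g := by
    intro g hg
    show ∑ g' ∈ W1, (if lab n g' = lab n g then ξ g' else 0) = ξ g
    rw [Finset.sum_eq_single g]
    · simp
    · intro b hb hne
      rw [if_neg]
      intro e
      exact hne (hinj (by simp [hb]) (by exact_mod_cast hg) e)
    · intro hg1
      have : ξ g = 0 := by simpa [W1] using hg1
      simp [this]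
  have h1 : n2 η = OG.sq2 ξ := by
    have : OG.sq2 ξ = ∑ g ∈ W1, ‖ξ g‖ ^ 2 := finsum_eq_sum_of_support_subset _ (by
      intro g hg
      have : ξ g ≠ 0 := by simpa using hg
      simpa [W1] using this)
    rw [this]
    have h2 : n2 η = ∑ y ∈ W1.image (lab n), ‖η y‖ ^ 2 := by
      unfold n2
      symm
      refine Finset.sum_subset (Finset.subset_univ _) fun y _ hy => ?_
      have : η y = 0 := Finset.sum_eq_zero fun g hg => if_neg fun e => hy (Finset.mem_image.2 ⟨g, hg, e⟩)
      simp [this]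
    rw [h2, Finset.sum_image (fun a ha b hb e => hinj (by simp [ha]) (by simp [hb]) e)]
    refine Finset.sum_congr rfl fun g hg => ?_
    rw [hη g (by simp [hg])]
  have h3 : ∀ g ∈ W0, Lrep (T.φ n) c η (lab n g) = f g := by
    intro g hg
    rw [Lrep_apply, hfv]
    refine Finset.sum_congr rfl fun γ hγ => ?_
    have : (T.φ n γ)⁻¹ * lab n g = lab n (OG.lsh γ⁻¹ g) := by
      rw [lab_lsh n _ g (by rw [hW0 g hg]; exact hn), map_inv]
    rw [this, hη _ (Finset.mem_union_right _ (Finset.mem_image.2 ⟨(g, γ), Finset.mem_product.2 ⟨hg, hγ⟩, rfl⟩))]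
  have h4 : OG.sq2 f ≤ n2 (Lrep (T.φ n) c η) := by
    have : OG.sq2 f = ∑ g ∈ W0, ‖f g‖ ^ 2 := finsum_eq_sum_of_support_subset _ (by
      intro g hg
      have : f g ≠ 0 := by simpa using hg
      simpa [W0] using this)
    rw [this, Finset.sum_congr rfl fun g hg => by rw [← h3 g hg]]
    rw [← Finset.sum_image (f := fun y => ‖Lrep (T.φ n) c η y‖ ^ 2) (g := lab n)
      (fun a ha b hb e => hinj (by simp [Finset.mem_coe.1 ha]) (by simp [Finset.mem_coe.1 hb]) e)]
    exact Finset.sum_le_sum_of_subset_of_nonneg (Finset.subset_univ _) fun _ _ _ => sq_nonneg _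
  calc OG.sq2 f ≤ _ := h4
    _ ≤ _ := h n η
    _ = _ := by rw [h1]

variable {B : Type} [NonUnitalNormedRing B] [StarRing B] [NormedSpace ℂ B] (ρ : (OG.D T.Γ T.X).RedCStarRep B)

/-- the group ring inside the reduced algebra -/
def Phi : MonoidAlgebra ℂ T.Γ →+ B :=
  (Finsupp.liftAddHom fun γ : T.Γ =>
    (AddMonoidHom.mk' (fun r : ℂ => ρ.j (OG.aG γ (fun _ => r))) fun r s => by
      rw [← ρ.j_add _ (OG.aG_cc γ _ continuous_const) _ (OG.aG_cc γ _ continuous_const)]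
      congr 1
      funext g
      simp only [OG.aG, Pi.add_apply]
      split_ifs <;> simp)).comp MonoidAlgebra.coeffAddEquiv.toAddMonoidHom

lemma Phi_single (γ : T.Γ) (r : ℂ) : Phi ρ (MonoidAlgebra.single γ r) = ρ.j (OG.aG γ (fun _ => r)) := by
  show Finsupp.liftAddHom _ (Finsupp.single γ r) = _
  rw [Finsupp.liftAddHom_apply_single]; rfl

lemma Phi_eq_sum (c : MonoidAlgebra ℂ T.Γ) : Phi ρ c = ∑ γ ∈ c.coeff.support, ρ.j (OG.aG γ (fun _ => c.coeff γ)) := rfl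

lemma Phi_eq (c : MonoidAlgebra ℂ T.Γ) : Phi ρ c = ρ.j (Fc c) := by
  rw [Phi_eq_sum]
  have h1 : ∑ γ ∈ c.coeff.support, ρ.j (OG.aG γ (fun _ => c.coeff γ)) =
    ∑ γ ∈ c.coeff.support, OG.jL ρ ⟨OG.aG γ (fun _ => c.coeff γ), OG.aG_cc γ _ continuous_const⟩ := rfl
  rw [h1, ← map_sum]
  show ρ.j _ = _
  congr 1
  rw [Fc, OG.PF_eq]
  simp

lemma Phi_mul (c d : MonoidAlgebra ℂ T.Γ) : Phi ρ (c * d) = Phi ρ c * Phi ρ d := by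
  induction c using MonoidAlgebra.induction_linear with
  | zero => simp
  | add a b ha hb => rw [add_mul, map_add, ha, hb, map_add, add_mul]
  | single γ r =>
    induction d using MonoidAlgebra.induction_linear with
    | zero => simp
    | add a b ha hb => rw [mul_add, map_add, ha, hb, map_add, mul_add]
    | single δ s =>
      rw [MonoidAlgebra.single_mul_single, Phi_single, Phi_single, Phi_single,
        ← ρ.j_mul _ (OG.aG_cc γ _ continuous_const) _ (OG.aG_cc δ _ continuous_const), OG.convC_aG_aG]

lemma Phi_star (c : MonoidAlgebra ℂ T.Γ) (hc : ∀ γ, c.coeff γ⁻¹ = starRingEnd ℂ (c.coeff γ)) :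
    star (Phi ρ c) = Phi ρ c := by
  rw [Phi_eq_sum, star_sum]
  refine Finset.sum_nbij' (fun γ => γ⁻¹) (fun γ => γ⁻¹) ?_ ?_ (by simp) (by simp) ?_
  · intro γ hγ; simp only [Finsupp.mem_support_iff, hc, ne_eq, map_eq_zero] at *; exact hγ
  · intro γ hγ; simp only [Finsupp.mem_support_iff, hc, ne_eq, map_eq_zero] at *; exact hγ
  · intro γ hγ
    rw [← ρ.j_star _ (OG.aG_cc γ _ continuous_const), OG.starC_aG, hc]

lemma Phi_norm (c : MonoidAlgebra ℂ T.Γ) (C : ℝ) (hC : 0 ≤ C)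
    (h : ∀ n η, n2 (Lrep (T.φ n) c η) ≤ C ^ 2 * n2 η) : ‖Phi ρ c‖ ≤ C := by
  rw [Phi_eq, ρ.j_norm _ (Fc_cc c)]
  exact Fc_norm c C hC h

end NormEst
end Tower

namespace Tower
section Proj
variable {T : Tower}

lemma sum_Lrep (n : ℕ) (η : T.Q n → ℂ) : ∑ y, Lrep (T.φ n) T.a η y = ∑ y, η y := by
  have h := T.a_sym n (fun _ => 1) η
  rw [T.a_one] at h
  simpa [ipF] using h.symm

lemma pow_gap (n k : ℕ) (η : T.Q n → ℂ) (h : ∑ y, η y = 0) :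
    n2 (Lrep (T.φ n) (T.a ^ k) η) ≤ (T.lam ^ k) ^ 2 * n2 η := by
  induction k generalizing η with
  | zero => simp
  | succ k ih =>
    rw [pow_succ, map_mul, Module.End.mul_apply]
    refine (ih _ (by rw [sum_Lrep, h])).trans ?_
    calc (T.lam ^ k) ^ 2 * n2 (Lrep (T.φ n) T.a η) ≤ (T.lam ^ k) ^ 2 * (T.lam ^ 2 * n2 η) := by
          gcongr; exact T.gap n η h
      _ = _ := by ring

lemma n2_sub_le {S : Type} [Fintype S] (f g : S → ℂ) : n2 (f - g) ≤ 2 * n2 f + 2 * n2 g := by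
  unfold n2
  rw [Finset.mul_sum, Finset.mul_sum, ← Finset.sum_add_distrib]
  refine Finset.sum_le_sum fun s _ => ?_
  have h := norm_sub_le (f s) (g s)
  have h0 := norm_nonneg (f s - g s)
  show ‖f s - g s‖ ^ 2 ≤ _
  nlinarith [sq_nonneg (‖f s‖ - ‖g s‖)]

lemma step_est (n k : ℕ) (η : T.Q n → ℂ) :
    n2 (Lrep (T.φ n) (T.a ^ k - T.a ^ (k+1)) η) ≤ (2 * T.lam ^ k) ^ 2 * n2 η := by
  have e : T.a ^ k - T.a ^ (k+1) = T.a ^ k * (1 - T.a) := by rw [mul_sub, mul_one, pow_succ]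
  have e2 : Lrep (T.φ n) (1 - T.a) η = η - Lrep (T.φ n) T.a η := by
    rw [map_sub, map_one]; rfl
  rw [e, map_mul, Module.End.mul_apply]
  refine (pow_gap n k _ ?_).trans ?_
  · rw [e2]
    simp only [Pi.sub_apply, Finset.sum_sub_distrib, sum_Lrep, sub_self]
  · have h1 : n2 (Lrep (T.φ n) (1 - T.a) η) ≤ 4 * n2 η := by
      rw [e2]
      have := n2_sub_le η (Lrep (T.φ n) T.a η)
      have h2 := T.a_contr n η
      linarith
    calc _ ≤ (T.lam ^ k) ^ 2 * (4 * n2 η) := by gcongr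
      _ = _ := by ring

lemma pow_one (n k : ℕ) (r : ℂ) : Lrep (T.φ n) (T.a ^ k) (fun _ => r) = fun _ => r := by
  induction k with
  | zero => simp
  | succ k ih =>
    rw [pow_succ, map_mul, Module.End.mul_apply]
    have : Lrep (T.φ n) T.a (fun _ => r) = fun _ => r := by
      have e : (fun _ : T.Q n => r) = r • (fun _ : T.Q n => (1:ℂ)) := by funext y; simp
      rw [e, map_smul, T.a_one]
    rw [this, ih]

open Filter Topology in
lemma pow_lim (n : ℕ) (z y : T.Q n) :
    Tendsto (fun k => Lrep (T.φ n) (T.a ^ k) (fun w => if w = z then 1 else 0) y) atTop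
      (𝓝 ((Fintype.card (T.Q n) : ℂ)⁻¹)) := by
  set d : T.Q n → ℂ := fun w => if w = z then 1 else 0 with hd
  set r : ℂ := (Fintype.card (T.Q n) : ℂ)⁻¹ with hr
  let cr : T.Q n → ℂ := fun _ => r
  have h0 : ∑ w, (d - cr) w = 0 := by
    simp only [Pi.sub_apply, Finset.sum_sub_distrib, Finset.sum_const, hd, cr]
    have : (Fintype.card (T.Q n) : ℂ) ≠ 0 := by exact_mod_cast Fintype.card_ne_zero
    simp [hr, this]
  have hk : ∀ k, ‖Lrep (T.φ n) (T.a ^ k) d y - r‖ ≤ T.lam ^ k * Real.sqrt (n2 (d - cr)) := by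
    intro k
    have e : Lrep (T.φ n) (T.a ^ k) d y - r = Lrep (T.φ n) (T.a ^ k) (d - cr) y := by
      rw [map_sub, show Lrep (T.φ n) (T.a ^ k) cr = cr from pow_one n k r]; rfl
    rw [e]
    refine abs_le_of_sq_le_sq' ?_ (mul_nonneg (pow_nonneg T.lam0 k) (Real.sqrt_nonneg _)) |>.2
    rw [mul_pow, Real.sq_sqrt (n2_nonneg _)]
    refine le_trans ?_ (pow_gap n k _ h0)
    exact Finset.single_le_sum (f := fun s => ‖Lrep (T.φ n) (T.a ^ k) (d - cr) s‖ ^ 2)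
      (fun _ _ => sq_nonneg _) (Finset.mem_univ y)
  rw [tendsto_iff_norm_sub_tendsto_zero]
  refine squeeze_zero (fun _ => norm_nonneg _) hk ?_
  simpa using (tendsto_pow_atTop_nhds_zero_of_lt_one T.lam0 T.lam1).mul_const _

lemma Fc_val (n : ℕ) (c : MonoidAlgebra ℂ T.Γ) (g : OG T.Γ T.X) (y z : T.Q n)
    (hr : OG.rng g = ptq n y) (hs : OG.src g = ptq n z) :
    Fc c g = Lrep (T.φ n) c (fun w => if w = z then 1 else 0) y := by
  rw [Lrep_apply, Fc, OG.PF]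
  refine Finset.sum_congr rfl fun γ _ => ?_
  rw [OG.aG, hr, hs, smul_ptq]
  by_cases h : y = T.φ n γ * z
  · subst h; simp
  · rw [if_neg (fun e => h (ptq_inj n e)), if_neg (fun e => h (by rw [← e]; simp)), mul_zero]

variable {B : Type} [NonUnitalNormedRing B] [StarRing B] [NormedSpace ℂ B] (ρ : (OG.D T.Γ T.X).RedCStarRep B)

open Filter Topology in
lemma exists_proj [CStarRing B] [CompleteSpace B] : ∃ p : B, p * p = p ∧ star p = p ∧
    ∀ n (g : OG T.Γ T.X) (y z : T.Q n), OG.rng g = ptq n y → OG.src g = ptq n z →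
      OG.ev ρ g p = (Fintype.card (T.Q n) : ℂ)⁻¹ := by
  have hc : CauchySeq fun k => Phi ρ (T.a ^ k) := by
    refine cauchySeq_of_le_geometric T.lam 2 T.lam1 fun k => ?_
    rw [dist_eq_norm, ← map_sub]
    exact Phi_norm ρ _ _ (mul_nonneg (by norm_num) (pow_nonneg T.lam0 k)) fun n η => step_est n k η
  obtain ⟨p, hp⟩ := cauchySeq_tendsto_of_complete hc
  refine ⟨p, ?_, ?_, ?_⟩
  · have h1 := hp.mul hp
    have h2 : Tendsto (fun k : ℕ => Phi ρ (T.a ^ (k + k))) atTop (𝓝 p) :=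
      hp.comp (tendsto_atTop_mono (fun k => Nat.le_add_right k k) tendsto_id)
    refine tendsto_nhds_unique h1 (h2.congr fun k => ?_)
    rw [pow_add, Phi_mul]
  · have h1 := hp.star
    refine tendsto_nhds_unique h1 (hp.congr fun k => ?_)
    symm
    induction k with
    | zero =>
      rw [pow_zero]
      refine Phi_star ρ 1 fun γ => ?_
      simp only [MonoidAlgebra.one_def, MonoidAlgebra.coeff_single, Finsupp.single_apply]
      by_cases h : γ = 1
      · simp [h]
      · simp [Ne.symm h, h, eq_comm]
    | succ k ih =>
      rw [pow_succ, Phi_mul, star_mul, ih, Phi_star ρ T.a T.a_star, ← Phi_mul, ← pow_succ', ← Phi_mul, ← pow_succ]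
  · intro n g y z hr hs
    have h1 := ((OG.ev ρ g).continuous.tendsto p).comp hp
    refine tendsto_nhds_unique h1 ((pow_lim n z y).congr fun k => ?_)
    show _ = OG.ev ρ g (Phi ρ (T.a ^ k))
    rw [Phi_eq, OG.ev_j ρ g _ (Fc_cc _), Fc_val n _ g y z hr hs]

end Proj
end Tower

namespace Tower
section Rank
variable {T : Tower}

/-- the arrow between two level-`n` points -/
def aq (n : ℕ) (y z : T.Q n) : OG T.Γ T.X := ⟨(ptq n y, ptq n z), by
  obtain ⟨γ, hγ⟩ := T.φ_surj n (y * z⁻¹)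
  exact ⟨γ, by show ptq n y = γ • ptq n z; rw [smul_ptq, hγ, inv_mul_cancel_right]⟩⟩

lemma conv_aq (n : ℕ) (f f' : OG T.Γ T.X → ℂ) (y z : T.Q n) :
    (OG.D T.Γ T.X).convC f f' (aq n y z) = ∑ w, f (aq n y w) * f' (aq n w z) := by
  unfold GroupoidData.convC
  have hinj : Injective fun w => aq n y w := fun a b h => ptq_inj n (congrArg OG.src h)
  rw [finsum_eq_sum_of_support_subset (s := Finset.univ.image fun w => aq n y w)]
  · rw [Finset.sum_image (fun a _ b _ h => hinj h)]
    refine Finset.sum_congr rfl fun w _ => ?_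
    have e : (OG.D T.Γ T.X).range (aq n y w) = (OG.D T.Γ T.X).range (aq n y z) := rfl
    rw [if_pos e, OG.D_inv, OG.D_mul _ _ rfl]
    rfl
  · intro h hh
    have hr : (OG.D T.Γ T.X).range h = (OG.D T.Γ T.X).range (aq n y z) := by
      by_contra hc
      exact hh (if_neg hc)
    have hr' : OG.rng h = ptq n y := congrArg OG.src hr
    obtain ⟨γ, hγ⟩ := h.2
    have hγ' : OG.rng h = γ • OG.src h := hγ
    have hs : OG.src h = ptq n (T.φ n γ⁻¹ * y) := by
      rw [← smul_ptq, ← hr', hγ', inv_smul_smul]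
    simp only [Finset.coe_image, Finset.coe_univ, Set.image_univ, Set.mem_range]
    exact ⟨_, OG.ext' hr'.symm hs.symm⟩

variable {B : Type} [NonUnitalNormedRing B] [StarRing B] [NormedSpace ℂ B] (ρ : (OG.D T.Γ T.X).RedCStarRep B)

/-- the level-`n` representation of the reduced algebra -/
def mat (n : ℕ) (b : B) : Matrix (T.Q n) (T.Q n) ℂ := Matrix.of fun y z => OG.ev ρ (aq n y z) b

lemma mat_mul (n : ℕ) (b c : B) : mat ρ n (b * c) = mat ρ n b * mat ρ n c := by
  ext y z
  rw [Matrix.mul_apply]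
  show OG.ev ρ (aq n y z) (b * c) = ∑ w, OG.ev ρ (aq n y w) b * OG.ev ρ (aq n w z) c
  refine (OG.jL_dense ρ).induction_on₂ (p := fun b c => OG.ev ρ (aq n y z) (b * c) = ∑ w, OG.ev ρ (aq n y w) b * OG.ev ρ (aq n w z) c) ?_ ?_ b c
  · exact isClosed_eq (by fun_prop) (by fun_prop)
  · intro f f'
    show OG.ev ρ (aq n y z) (ρ.j f.1 * ρ.j f'.1) = ∑ w, OG.ev ρ (aq n y w) (ρ.j f.1) * OG.ev ρ (aq n w z) (ρ.j f'.1)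
    rw [← ρ.j_mul _ f.2 _ f'.2, OG.ev_j ρ _ _ (OG.convC_cc _ _ f.2 f'.2), conv_aq]
    refine Finset.sum_congr rfl fun w _ => ?_
    rw [OG.ev_j ρ _ _ f.2, OG.ev_j ρ _ _ f'.2]

lemma mat_add (n : ℕ) (b c : B) : mat ρ n (b + c) = mat ρ n b + mat ρ n c := by
  ext y z; exact map_add (OG.ev ρ (aq n y z)) b c
lemma mat_smul (n : ℕ) (r : ℂ) (c : B) : mat ρ n (r • c) = r • mat ρ n c := by
  ext y z; exact map_smul (OG.ev ρ (aq n y z)) r c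
lemma mat_zero (n : ℕ) : mat ρ n 0 = 0 := by
  ext y z; exact map_zero (OG.ev ρ (aq n y z))

/-- its extension to the unitization -/
def mu (n : ℕ) (b : Unitization ℂ B) : Matrix (T.Q n) (T.Q n) ℂ := b.fst • 1 + mat ρ n b.snd

lemma mu_mul [IsScalarTower ℂ B B] [SMulCommClass ℂ B B] (n : ℕ) (b c : Unitization ℂ B) :
    mu ρ n (b * c) = mu ρ n b * mu ρ n c := by
  simp only [mu, Unitization.fst_mul, Unitization.snd_mul, mat_add, mat_smul, mat_mul]
  rw [add_mul, mul_add, mul_add]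
  simp only [smul_mul_assoc, mul_smul_comm, one_mul, mul_one, smul_smul]
  rw [mul_comm c.fst b.fst]
  abel

lemma mu_add (n : ℕ) (b c : Unitization ℂ B) : mu ρ n (b + c) = mu ρ n b + mu ρ n c := by
  simp only [mu, Unitization.fst_add, Unitization.snd_add, mat_add, add_smul]
  abel

lemma mu_zero (n : ℕ) : mu ρ n 0 = 0 := by
  simp [mu, mat_zero]

/-- the level-`n` matrix of a matrix over the unitization -/
def big (n : ℕ) {k : ℕ} (P : Matrix (Fin k) (Fin k) (Unitization ℂ B)) :
    Matrix (Fin k × T.Q n) (Fin k × T.Q n) ℂ := Matrix.of fun a b => mu ρ n (P a.1 b.1) a.2 b.2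

lemma big_mul [IsScalarTower ℂ B B] [SMulCommClass ℂ B B] (n : ℕ) {k : ℕ} (P R : Matrix (Fin k) (Fin k) (Unitization ℂ B)) :
    big ρ n (P * R) = big ρ n P * big ρ n R := by
  let M : Unitization ℂ B →+ Matrix (T.Q n) (T.Q n) ℂ := AddMonoidHom.mk' (mu ρ n) (mu_add ρ n)
  ext ⟨i, y⟩ ⟨j, z⟩
  rw [Matrix.mul_apply, Fintype.sum_prod_type]
  show mu ρ n ((P * R) i j) y z = ∑ l, ∑ w, mu ρ n (P i l) y w * mu ρ n (R l j) w z
  rw [Matrix.mul_apply]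
  have h : mu ρ n (∑ l, P i l * R l j) = ∑ l, mu ρ n (P i l * R l j) := map_sum M _ _
  rw [h, Matrix.sum_apply]
  refine Finset.sum_congr rfl fun l _ => ?_
  rw [mu_mul, Matrix.mul_apply]

/-- the level-`n` trace -/
def trn (n : ℕ) {k : ℕ} (P : Matrix (Fin k) (Fin k) (Unitization ℂ B)) : ℂ := ∑ i, (mu ρ n (P i i)).trace

lemma trn_eq (n : ℕ) {k : ℕ} (P : Matrix (Fin k) (Fin k) (Unitization ℂ B)) : trn ρ n P = (big ρ n P).trace := by
  rw [Matrix.trace, Fintype.sum_prod_type]; rfl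

lemma trace_idem {ι : Type} [Fintype ι] [DecidableEq ι] (A : Matrix ι ι ℂ) (h : A * A = A) : ∃ k : ℕ, A.trace = k := by
  have h1 : IsIdempotentElem (Matrix.toLin' A) := by
    show Matrix.toLin' A * Matrix.toLin' A = _
    rw [Module.End.mul_eq_comp, ← Matrix.toLin'_mul, h]
  exact ⟨Module.finrank ℂ (LinearMap.range (Matrix.toLin' A)), by
    rw [← Matrix.trace_toLin'_eq]
    exact (LinearMap.IsIdempotentElem.isProj_range _ h1).trace⟩

lemma trn_nat [IsScalarTower ℂ B B] [SMulCommClass ℂ B B] (n : ℕ) {k : ℕ} (P : Matrix (Fin k) (Fin k) (Unitization ℂ B))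
    (h : P * P = P) : ∃ l : ℕ, trn ρ n P = l := by
  rw [trn_eq]
  exact trace_idem _ (by rw [← big_mul, h])

lemma trn_bSum (n : ℕ) {k l : ℕ} (P : Matrix (Fin k) (Fin k) (Unitization ℂ B)) (R : Matrix (Fin l) (Fin l) (Unitization ℂ B)) :
    trn ρ n (bSum P R) = trn ρ n P + trn ρ n R := by
  unfold trn
  rw [Fin.sum_univ_add]
  congr 1
  · refine Finset.sum_congr rfl fun i _ => ?_
    simp [bSum]
  · refine Finset.sum_congr rfl fun i _ => ?_
    simp [bSum]

lemma trn_castM (n : ℕ) {k l : ℕ} (h : k = l) (P : Matrix (Fin k) (Fin k) (Unitization ℂ B)) :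
    trn ρ n (castM h P) = trn ρ n P := by
  subst h; rfl

instance natC_disc : DiscreteTopology (Set.range (Nat.cast : ℕ → ℂ)) := by
  have h : Topology.IsEmbedding (Nat.cast : ℕ → ℂ) := by
    have h1 : (Nat.cast : ℕ → ℂ) = (fun r : ℝ => (r : ℂ)) ∘ (Nat.cast : ℕ → ℝ) := by funext n; simp
    rw [h1]
    exact Complex.isometry_ofReal.isEmbedding.comp Nat.isClosedEmbedding_coe_real.isEmbedding
  exact h.toHomeomorph.symm.isEmbedding.discreteTopology

lemma trn_htpy [IsScalarTower ℂ B B] [SMulCommClass ℂ B B] [StarModule ℂ B] (n : ℕ) {k : ℕ}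
    (P R : Matrix (Fin k) (Fin k) (Unitization ℂ B)) (h : ProjHtpy Set.univ P R) : trn ρ n P = trn ρ n R := by
  obtain ⟨H, hc, h0, h1, hp⟩ := h
  have hcont : Continuous fun t => trn ρ n (H t) := by
    unfold trn Matrix.trace
    refine continuous_finsetSum _ fun i _ => continuous_finsetSum _ fun y _ => ?_
    show Continuous fun t => (H t i i).fst * (1 : Matrix (T.Q n) (T.Q n) ℂ) y y + OG.ev ρ (aq n y y) (H t i i).snd
    exact ((hc i i).1.mul continuous_const).add ((OG.ev ρ (aq n y y)).continuous.comp (hc i i).2)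
  have := (isPreconnected_Icc (a := (0:ℝ)) (b := 1)).constant_of_mapsTo (T := Set.range (Nat.cast : ℕ → ℂ)) ⟨natC_disc⟩
    (f := fun t => trn ρ n (H t)) hcont.continuousOn
    (fun t ht => by
      obtain ⟨l, hl⟩ := trn_nat ρ n (H t) (hp t ht).1
      exact ⟨l, hl.symm⟩) (x := 0) (y := 1) (by simp) (by simp)
  simpa [h0, h1] using this

/-- the level-`n` rank of a `K₀`-cycle -/
def rk (n : ℕ) (x : K0Cycle B) : ℂ := trn ρ n x.2.1 - trn ρ n x.2.2

lemma rk_blk (n : ℕ) (x y : K0Cycle B) : rk ρ n (k0blk x y) = rk ρ n x + rk ρ n y := by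
  show trn ρ n (bSum x.2.1 y.2.1) - trn ρ n (bSum x.2.2 y.2.2) = (trn ρ n x.2.1 - trn ρ n x.2.2) + (trn ρ n y.2.1 - trn ρ n y.2.2)
  rw [trn_bSum, trn_bSum]; ring

lemma rk_eq [IsScalarTower ℂ B B] [SMulCommClass ℂ B B] [StarModule ℂ B] (n : ℕ) (x y : K0Cycle B)
    (h : K0Eq Set.univ x y) : rk ρ n x = rk ρ n y := by
  induction h with
  | refl => rfl
  | symm _ ih => exact ih.symm
  | trans _ _ ih1 ih2 => exact ih1.trans ih2
  | rel h =>
    obtain ⟨_, _, k, r, _, hh⟩ := h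
    have := trn_htpy ρ n _ _ hh
    rw [trn_castM, trn_bSum, trn_bSum, trn_bSum, trn_bSum] at this
    unfold rk
    linear_combination this

lemma rk_one (n : ℕ) (b : B) :
    rk ρ n (⟨1, Matrix.of fun _ _ => (Unitization.inr b : Unitization ℂ B), 0⟩ : K0Cycle B) = ∑ y, OG.ev ρ (aq n y y) b := by
  show ∑ i : Fin 1, (mu ρ n (Unitization.inr b : Unitization ℂ B)).trace - ∑ i : Fin 1, (mu ρ n 0).trace = _
  rw [mu_zero]
  simp [mu, Matrix.trace, mat]

end Rank
end Tower

namespace Tower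
section Final
variable {T : Tower}

lemma clopen_ind {W : Set T.X} (hW : IsClopen W) :
    IsCompact (OG.arr (1 : T.Γ) '' W) ∧ IsOpen (OG.arr (1 : T.Γ) '' W) ∧
    OG.arr (1 : T.Γ) '' W ⊆ (OG.D T.Γ T.X).unitSpace ∧
    ((fun u : (OG.D T.Γ T.X).MSp 0 => indZ (OG.arr (1 : T.Γ) '' W) u.1) ∈ (OG.D T.Γ T.X).mCycles 0) ∧
    indC (OG.arr (1 : T.Γ) '' W) ∈ ccC (OG T.Γ T.X) := by
  have hc : IsCompact (OG.arr (1 : T.Γ) '' W) := hW.isClosed.isCompact.image (OG.arr_continuous _)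
  have ho : IsOpen (OG.arr (1 : T.Γ) '' W) := OG.arr_isOpenMap _ _ hW.isOpen
  have hcl : IsClopen (OG.arr (1 : T.Γ) '' W) := ⟨hc.isClosed, ho⟩
  refine ⟨hc, ho, ?_, ?_, ?_⟩
  · rintro _ ⟨x, _, rfl⟩; exact ⟨x, rfl⟩
  · show _ ∈ ccZ _
    constructor
    · refine Continuous.comp (g := indZ (OG.arr (1 : T.Γ) '' W)) ?_ continuous_subtype_val
      unfold indZ
      refine Continuous.if ?_ continuous_const continuous_const
      intro v hv
      have hv : v ∈ frontier (OG.arr (1 : T.Γ) '' W) := hv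
      rw [hcl.frontier_eq] at hv
      exact absurd hv (Set.notMem_empty _)
    · have : CompactSpace ((OG.D T.Γ T.X).MSp 0) := isCompact_iff_compactSpace.1 (isCompact_range (OG.arr_continuous (X := T.X) (1 : T.Γ)))
      exact HasCompactSupport.of_compactSpace _
  · constructor
    · unfold indC
      refine Continuous.if ?_ continuous_const continuous_const
      intro v hv
      have hv : v ∈ frontier (OG.arr (1 : T.Γ) '' W) := hv
      rw [hcl.frontier_eq] at hv
      exact absurd hv (Set.notMem_empty _)
    · refine HasCompactSupport.intro hc fun x hx => ?_
      exact if_neg hx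

lemma ind_arr (W : Set T.X) (x : T.X) : indZ (OG.arr (1 : T.Γ) '' W) (OG.arr 1 x) = indZ W x := by
  have : OG.arr (1 : T.Γ) x ∈ OG.arr (1 : T.Γ) '' W ↔ x ∈ W := (OG.arr_inj 1).mem_set_image
  by_cases h : x ∈ W
  · simp only [indZ, if_pos h, if_pos (this.2 h)]
  · simp only [indZ, if_neg h, if_neg (fun h' => h (this.1 h'))]

lemma indC_arr (W : Set T.X) (x : T.X) : indC (OG.arr (1 : T.Γ) '' W) (OG.arr 1 x) = ((indZ W x : ℤ) : ℂ) := by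
  rw [← ind_arr]
  unfold indC indZ
  split_ifs <;> simp

lemma aq_diag (n : ℕ) (y : T.Q n) : aq n y y = OG.arr (1 : T.Γ) (ptq n y) :=
  OG.ext' (by rw [OG.rng_arr, one_smul]; rfl) rfl

variable {B : Type} [NonUnitalNormedRing B] [StarRing B] [NormedSpace ℂ B]
  [IsScalarTower ℂ B B] [SMulCommClass ℂ B B] [StarModule ℂ B] (ρ : (OG.D T.Γ T.X).RedCStarRep B)

lemma rk_mu0 (μ0 : (OG.D T.Γ T.X).Homology 0 → K0Cycle B) (hμ : (OG.D T.Γ T.X).IsMu0 ρ μ0) (n : ℕ)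
    (a : (OG.D T.Γ T.X).mCycles 0) :
    rk ρ n (μ0 (QuotientAddGroup.mk a)) = ((∑ y, OG.toX a (ptq n y) : ℤ) : ℂ) := by
  let R : (OG.D T.Γ T.X).Homology 0 →+ ℂ := AddMonoidHom.mk' (fun x => rk ρ n (μ0 x)) fun x y => by
    rw [rk_eq ρ n _ _ (hμ.2.1 x y), rk_blk]
  let q : (OG.D T.Γ T.X).mCycles 0 →+ (OG.D T.Γ T.X).Homology 0 := QuotientAddGroup.mk' _
  have hcl : ∀ v : ℤ, IsClopen (OG.toX a ⁻¹' {v}) := fun v => (isClopen_discrete _).preimage (OG.toX a).2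
  obtain ⟨s, hs⟩ := OG.fin_range (OG.toX a) (OG.toX a).2
  have hsum : ∀ x, OG.toX a x = ∑ v ∈ s, v * indZ (OG.toX a ⁻¹' {v}) x := by
    intro x
    rw [Finset.sum_eq_single (OG.toX a x)]
    · simp [indZ]
    · intro v _ hv
      have : x ∉ OG.toX a ⁻¹' {v} := fun h => hv (Eq.symm h)
      rw [indZ, if_neg this, mul_zero]
    · intro h; exact absurd (hs x) h
  have ha : a = ∑ v ∈ s, v • (⟨_, (clopen_ind (hcl v)).2.2.2.1⟩ : (OG.D T.Γ T.X).mCycles 0) := by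
    apply Subtype.ext
    funext u
    obtain ⟨x, hx⟩ : ∃ x, u = OG.un T.Γ T.X x := by
      obtain ⟨_, x, rfl⟩ := u; exact ⟨x, rfl⟩
    subst hx
    rw [AddSubgroup.val_finset_sum, Finset.sum_apply]
    refine (hsum x).trans (Finset.sum_congr rfl fun v _ => ?_)
    show v * _ = v • indZ (OG.arr (1 : T.Γ) '' (OG.toX a ⁻¹' {v})) (OG.arr 1 x)
    rw [ind_arr, smul_eq_mul]
  have hR : ∀ v, R (q (⟨_, (clopen_ind (hcl v)).2.2.2.1⟩ : (OG.D T.Γ T.X).mCycles 0)) =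
      ((∑ y, indZ (OG.toX a ⁻¹' {v}) (ptq n y) : ℤ) : ℂ) := by
    intro v
    obtain ⟨h1, h2, h3, h4, h5⟩ := clopen_ind (hcl v)
    show rk ρ n (μ0 ((OG.D T.Γ T.X).hcls _ h4)) = _
    rw [rk_eq ρ n _ _ (hμ.2.2 _ h1 h2 h3 h4), rk_one, Int.cast_sum]
    refine Finset.sum_congr rfl fun y _ => ?_
    rw [OG.ev_j ρ _ _ h5, aq_diag, indC_arr]
  have e : rk ρ n (μ0 (QuotientAddGroup.mk a)) = R (q a) := rfl
  have e2 : R (q a) = ∑ v ∈ s, v • R (q (⟨_, (clopen_ind (hcl v)).2.2.2.1⟩ : (OG.D T.Γ T.X).mCycles 0)) := by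
    conv_lhs => rw [ha]
    rw [map_sum, map_sum]
    refine Finset.sum_congr rfl fun v _ => ?_
    rw [map_zsmul, map_zsmul]
  rw [e, e2]
  have e3 : (∑ y, OG.toX a (ptq n y) : ℤ) = ∑ v ∈ s, v * ∑ y, indZ (OG.toX a ⁻¹' {v}) (ptq n y) := by
    rw [Finset.sum_congr rfl fun y _ => hsum (ptq n y), Finset.sum_comm]
    exact Finset.sum_congr rfl fun v _ => (Finset.mul_sum _ _ _).symm
  rw [e3, Int.cast_sum]
  refine Finset.sum_congr rfl fun v _ => ?_
  rw [hR v, zsmul_eq_mul, Int.cast_mul]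

lemma unif (f : C(T.X, ℤ)) : ∃ m : ℕ, ∀ x z : T.X, (∀ i ≤ m, co x i = co z i) → f x = f z := by
  by_contra hc
  push Not at hc
  let E : ℕ → Set (T.X × T.X) := fun m => {p | (∀ i ≤ m, co p.1 i = co p.2 i) ∧ f p.1 ≠ f p.2}
  have hcl : ∀ m, IsClosed (E m) := by
    intro m
    have e : E m = (⋂ i ≤ m, {p : T.X × T.X | co p.1 i = co p.2 i}) ∩ {p | f p.1 ≠ f p.2} := by
      ext p; simp [E]
    rw [e]
    refine IsClosed.inter (isClosed_iInter fun i => isClosed_iInter fun _ =>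
      isClosed_eq ((co_cont i).comp continuous_fst) ((co_cont i).comp continuous_snd)) ?_
    exact (isClosed_discrete {p : ℤ × ℤ | p.1 ≠ p.2}).preimage
      ((f.2.comp continuous_fst).prodMk (f.2.comp continuous_snd))
  obtain ⟨p, hp⟩ := IsCompact.nonempty_iInter_of_sequence_nonempty_isCompact_isClosed E
    (fun m p hp => ⟨fun i hi => hp.1 i (hi.trans (Nat.le_succ m)), hp.2⟩)
    (fun m => by obtain ⟨x, z, h1, h2⟩ := hc m; exact ⟨(x, z), h1, h2⟩)
    (hcl 0).isCompact hcl
  rw [Set.mem_iInter] at hp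
  refine (hp 0).2 ?_
  rw [X_ext fun n => (hp n).1 n le_rfl]

lemma pi_surj (n : ℕ) : Surjective (T.π n) := fun y => by
  obtain ⟨γ, rfl⟩ := T.φ_surj n y
  exact ⟨_, T.π_φ n γ⟩

lemma no_fun (f : C(T.X, ℤ)) (h : ∀ n, ∑ y, f (ptq n y) = 1) : False := by
  obtain ⟨m, hm⟩ := unif f
  have key : ∀ n, m ≤ n → Injective (T.π n) := by
    intro n hn
    have h1 : ∀ y, f (ptq (n+1) y) = f (ptq n (T.π n y)) := by
      intro y
      refine hm _ _ fun i hi => ?_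
      have e := co_succ _ n y (co_ptq (n+1) y)
      exact co_det _ _ n (by rw [e]; simp) (by rw [e, co_ptq]) i (hi.trans hn)
    have h2 := h (n+1)
    rw [Finset.sum_congr rfl fun y _ => h1 y, ← Finset.sum_fiberwise (g := T.π n)] at h2
    have h3 : ∀ z, ∑ y with T.π n y = z, f (ptq n (T.π n y)) =
        ((Finset.univ.filter fun y => T.π n y = 1).card : ℤ) * f (ptq n z) := by
      intro z
      rw [Finset.sum_congr rfl (g := fun _ => f (ptq n z)) (fun y hy => by rw [(Finset.mem_filter.1 hy).2]),
        Finset.sum_const, nsmul_eq_mul]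
      congr 2
      exact MonoidHom.card_fiber_eq_of_mem_range (T.π n) (pi_surj n z) (pi_surj n 1)
    rw [Finset.sum_congr rfl fun z _ => h3 z, ← Finset.mul_sum, h n, mul_one] at h2
    have h4 : (Finset.univ.filter fun y => T.π n y = 1).card = 1 := by exact_mod_cast h2
    rw [injective_iff_map_eq_one]
    intro y hy
    exact Finset.card_le_one.1 h4.le y (by simp [hy]) 1 (by simp)
  have inj : Injective (T.φ m) := by
    rw [injective_iff_map_eq_one]
    intro γ hγ
    by_contra hne
    obtain ⟨k, hk⟩ := T.faithful γ hne
    have : ∀ n, m ≤ n → T.φ n γ = 1 := by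
      intro n hn
      induction n, hn using Nat.le_induction with
      | base => exact hγ
      | succ n hn ih => exact key n hn (by rw [T.π_φ, ih, map_one])
    exact hk (phi_one_mono γ (le_max_left k m) (this _ (le_max_right k m)))
  have : Finite T.Γ := Finite.of_injective _ inj
  exact not_finite T.Γ

theorem not_surj [CStarRing B] [CompleteSpace B] (μ0 : (OG.D T.Γ T.X).Homology 0 → K0Cycle B)
    (hμ : (OG.D T.Γ T.X).IsMu0 ρ μ0) :
    ¬ (∀ c : K0Cycle B, IsK0Cycle Set.univ c → ∃ x, K0Eq Set.univ c (μ0 x)) := by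
  intro hs
  obtain ⟨p, h1, h2, h3⟩ := exists_proj ρ
  have hP : KT.IsP (Matrix.of fun _ _ : Fin 1 => (Unitization.inr p : Unitization ℂ B)) := by
    constructor
    · ext i j : 1
      rw [Matrix.mul_apply, Fin.sum_univ_one]
      show (Unitization.inr p : Unitization ℂ B) * Unitization.inr p = Unitization.inr p
      rw [← Unitization.inr_mul, h1]
    · ext i j : 1
      show star (Unitization.inr p : Unitization ℂ B) = Unitization.inr p
      rw [← Unitization.inr_star, h2]
  obtain ⟨x, hx⟩ := hs ⟨1, Matrix.of fun _ _ => (Unitization.inr p : Unitization ℂ B), 0⟩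
    ⟨(KT.isProjM_iff _).2 hP, (KT.isProjM_iff _).2 KT.isP_zero, fun _ _ => rfl⟩
  obtain ⟨a, rfl⟩ := QuotientAddGroup.mk_surjective x
  refine no_fun (OG.toX a) fun n => ?_
  have h4 := rk_eq ρ n _ _ hx
  rw [rk_one, rk_mu0 ρ μ0 hμ, Finset.sum_congr rfl fun y _ => h3 n (aq n y y) y y rfl rfl, Finset.sum_const,
    Finset.card_univ, nsmul_eq_mul, mul_inv_cancel₀ (by exact_mod_cast Fintype.card_ne_zero)] at h4
  exact_mod_cast h4.symm

end Final
end Tower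

/-- **Theorem F.**  There exists a locally compact, Hausdorff, étale, second countable,
principal, ample groupoid `G` with `H_n(G) = 0` for all `n ≥ 2` such that the canonical map
`μ₀ : H₀(G) → K₀(C*_r(G))` is not surjective. -/
theorem exists_groupoid_mu0_not_surjective :
    ∃ (G : Type) (τ : TopologicalSpace G) (D : GroupoidData G),
      @GroupoidData.Mu0NotSurjBody G τ D := by
  obtain ⟨T⟩ := exists_tower
  exact ⟨OG T.Γ T.X, inferInstance, OG.D T.Γ T.X, OG.D_ample, inferInstance, OG.D_principal, T.homology_vanish,
    fun B _ _ _ _ _ _ _ _ ρ => ⟨OG.exists_mu0 ρ, Tower.not_surj ρ⟩⟩
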